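/- Let (R,m) be a complete Noetherian local domain of mixed characteristic p > 0 with perfect residue field, of dimension d, and let p, x₂, …, x_d be a system of parameters of R. Then the nonzero element g ∈ R and the R-algebra T ⊆ R^+ of the preceding construction (a normal domain with compatible p-power roots of p and g, surjective Frobenius mod p, (pg)^{1/p^∞}-almost Cohen-Macaulay with respect to p, x₂, …, x_d, and ind-étale over R after inverting pg) can be chosen so that, in addition, for every 0 ≤ i ≤ d − 1 the local cohomology module H^i_m(T) is (pg)^{1/p^∞}-almost zero, i.e. every element of H^i_m(T) is annihilated by (pg)^{1/p^n} for all n > 0. -/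

import Mathlib

set_option maxHeartbeats 1000000
set_option synthInstance.maxHeartbeats 400000

section Part_LC1
set_option maxHeartbeats 1000000
set_option synthInstance.maxHeartbeats 400000
universe u
open CategoryTheory Limits Opposite in
theorem acm_op_homologyMap_zero {R : Type u} [CommRing R]
    (K : ChainComplex (ModuleCat.{u} R)ᵒᵖ ℕ) (φ : K ⟶ K) (n : ℕ)
    (h : ∀ z : (K.X n).unop, (K.d (n+1) n).unop.hom z = 0 →
      ∃ (m : ℕ) (ψ : (K.X m).unop), (φ.f n).unop.hom z = (K.d n m).unop.hom ψ) :
    HomologicalComplex.homologyMap φ n = 0 := by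
  rw [← cancel_epi (HomologicalComplex.homologyπ _ _), ← cancel_mono (HomologicalComplex.homologyι _ _)]
  simp only [Category.assoc, HomologicalComplex.homologyπ_naturality_assoc, HomologicalComplex.homology_π_ι,
    HomologicalComplex.cyclesMap_i_assoc, comp_zero, zero_comp]
  apply Quiver.Hom.unop_inj
  ext y
  have h1 : (K.d (n+1) n).unop.hom ((K.pOpcycles n).unop.hom y) = 0 := by
    have := congrArg (fun t => t.unop.hom y) (K.d_pOpcycles (n+1) n)
    exact this
  obtain ⟨m, ψ, hψ⟩ := h _ h1
  have h2 : (K.iCycles n).unop.hom ((K.d n m).unop.hom ψ) = 0 := by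
    have := congrArg (fun t => t.unop.hom ψ) (K.iCycles_d n m)
    exact this
  rw [← hψ] at h2
  exact h2

open CategoryTheory Limits Opposite in
theorem acm_ext_zero {R : Type u} [CommRing R] (N M : ModuleCat.{u} R) (f : M ⟶ M) (n : ℕ)
    (P : ProjectiveResolution N)
    (h : ∀ z : P.complex.X n ⟶ M, P.complex.d (n+1) n ≫ z = 0 →
      ∃ (m : ℕ) (ψ : P.complex.X m ⟶ M), z ≫ f = P.complex.d n m ≫ ψ) :
    ((Ext R (ModuleCat.{u} R) n).obj (op N)).map f = 0 := by
  have key : (NatTrans.leftDerived (NatTrans.rightOp ((linearYoneda R (ModuleCat.{u} R)).map f)) n).app N = 0 := by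
    rw [ProjectiveResolution.leftDerived_app_eq _ P]
    have : (HomologicalComplex.homologyFunctor (ModuleCat R)ᵒᵖ (ComplexShape.down ℕ) n).map
        ((NatTrans.mapHomologicalComplex (NatTrans.rightOp ((linearYoneda R (ModuleCat.{u} R)).map f)) (ComplexShape.down ℕ)).app P.complex) = 0 := by
      apply acm_op_homologyMap_zero
      intro z hz
      obtain ⟨m, ψ, h⟩ := h z hz
      exact ⟨m, ψ, h⟩
    rw [this]; simp
  have := congrArg Quiver.Hom.unop key
  exact this

open CategoryTheory Limits Opposite in
theorem acm_localCohomology_map_zero {R : Type u} [CommRing R] (J : Ideal R) (i : ℕ)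
    (M : ModuleCat.{u} R) (f : M ⟶ M)
    (h : ∀ t : ℕ, ((Ext R (ModuleCat.{u} R) i).obj (op (ModuleCat.of R (R ⧸ J ^ t)))).map f = 0) :
    (localCohomology J i).map f = 0 := by
  have := localCohomology.hasColimitDiagram.{u, 0} (localCohomology.idealPowersDiagram J) i
  change (colimit (localCohomology.diagram (localCohomology.idealPowersDiagram J) i)).map f = 0
  set F := localCohomology.diagram (localCohomology.idealPowersDiagram J) i
  apply (isColimitOfPreserves ((evaluation _ _).obj M) (colimit.isColimit F)).hom_ext
  intro j
  have h1 := (colimit.ι F j).naturality f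
  have h2 : (F.obj j).map f = 0 := h (unop (unop j))
  rw [h2, zero_comp] at h1
  simpa using h1.symm
end Part_LC1

section Part_LC2
set_option maxHeartbeats 1000000
set_option synthInstance.maxHeartbeats 400000
universe u

theorem acm_cocycle {R T : Type u} [CommRing R] [CommRing T] [Algebra R T]
    (p : ℕ) (hp : 2 ≤ p) (c : ℕ → T) (hc : ∀ n, c (n+1) ^ p = c n)
    (d : ℕ) (I : ℕ → Ideal T) (x : ℕ → R)
    (hI : ∀ j, j < d → I (j+1) = I j ⊔ Ideal.span {algebraMap R T (x j)})
    (hcol : ∀ j, j < d → ∀ n, 0 < n → ∀ t : T, algebraMap R T (x j) * t ∈ I j → c n * t ∈ I j)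
    (X : ℕ → Type u) [∀ i, AddCommGroup (X i)] [∀ i, Module R (X i)] [∀ i, Module.Projective R (X i)]
    (δ : ∀ i m, X i →ₗ[R] X m) (h0 : ∀ m, δ 0 m = 0) (h1 : ∀ i m, m ≠ i → δ (i+1) m = 0)
    (hδ : ∀ i m l, δ m l ∘ₗ δ i m = 0)
    (hN : ∀ j, j < d → ∃ s : ℕ, ∀ (i : ℕ) (l : ℕ) (φ : X i →ₗ[R] (T ⧸ I l)), φ ∘ₗ δ (i+1) i = 0 →
      ∃ (m : ℕ) (ψ : X m →ₗ[R] (T ⧸ I l)), (x j) ^ s • φ = ψ ∘ₗ δ i m)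
    (i : ℕ) : ∀ j, i + j < d → ∀ n, 0 < n → ∀ φ : X i →ₗ[R] (T ⧸ I j), φ ∘ₗ δ (i+1) i = 0 →
      ∃ (m : ℕ) (ψ : X m →ₗ[R] (T ⧸ I j)), c n • φ = ψ ∘ₗ δ i m := by
  have cc : ∀ n, c n = c (n+1) ^ (p-2) * (c (n+1) * c (n+1)) := by
    intro n
    rw [← hc n, ← pow_two, ← pow_add, Nat.sub_add_cancel hp]
  have hker : ∀ j, j < d → ∀ n, 0 < n → ∀ y : T ⧸ I j, x j • y = 0 → c n • y = 0 := by
    intro j hj n hn y hy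
    obtain ⟨t, rfl⟩ := Ideal.Quotient.mk_surjective y
    have e : x j • (Ideal.Quotient.mk (I j) t) = Ideal.Quotient.mk (I j) (algebraMap R T (x j) * t) := by
      rw [Algebra.smul_def]; rfl
    rw [e, Ideal.Quotient.eq_zero_iff_mem] at hy
    have := hcol j hj n hn t hy
    rw [← Ideal.Quotient.eq_zero_iff_mem] at this
    exact this
  -- single step
  have single : ∀ i j, i + j < d → (∀ k, i = k + 1 → ∀ n, 0 < n → ∀ φ : X k →ₗ[R] (T ⧸ I (j+1)),
      φ ∘ₗ δ (k+1) k = 0 → ∃ (m : ℕ) (ψ : X m →ₗ[R] (T ⧸ I (j+1))), c n • φ = ψ ∘ₗ δ k m) →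
      ∀ φ : X i →ₗ[R] (T ⧸ I j), (∃ (m : ℕ) (ψ : X m →ₗ[R] (T ⧸ I j)), x j • φ = ψ ∘ₗ δ i m) →
      ∀ n, 0 < n → ∃ (m : ℕ) (ψ : X m →ₗ[R] (T ⧸ I j)), c n • φ = ψ ∘ₗ δ i m := by
    intro i j hij IH φ ⟨m, ψ, hψ⟩ n hn
    rcases i with _ | k
    · refine ⟨0, 0, ?_⟩
      rw [h0] at hψ
      ext y
      have := LinearMap.congr_fun hψ y
      simp at this
      simpa using hker j (by omega) n hn _ this
    · by_cases hm : m = k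
      swap
      · refine ⟨0, 0, ?_⟩
        rw [h1 _ _ hm] at hψ
        ext y
        have := LinearMap.congr_fun hψ y
        simp at this
        simpa using hker j (by omega) n hn _ this
      subst hm
      have hle : I j ≤ I (j+1) := by rw [hI j (by omega)]; exact le_sup_left
      let π : (T ⧸ I j) →ₗ[T] (T ⧸ I (j+1)) := Submodule.factor hle
      have hπ : Function.Surjective π := Submodule.factor_surjective hle
      have hπx : ∀ y, π (x j • y) = 0 := by
        intro y
        obtain ⟨t, rfl⟩ := Ideal.Quotient.mk_surjective y
        have : x j • (Ideal.Quotient.mk (I j) t) = Ideal.Quotient.mk (I j) (algebraMap R T (x j) * t) := by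
          rw [Algebra.smul_def]; rfl
        rw [this]
        change Ideal.Quotient.mk (I (j+1)) _ = 0
        rw [Ideal.Quotient.eq_zero_iff_mem, hI j (by omega)]
        exact Ideal.mul_mem_right _ _ (Ideal.mem_sup_right (Ideal.mem_span_singleton_self _))
      have hπk : ∀ y, π y = 0 → ∃ z, x j • z = y := by
        intro y hy
        obtain ⟨t, rfl⟩ := Ideal.Quotient.mk_surjective y
        change Ideal.Quotient.mk (I (j+1)) _ = 0 at hy
        rw [Ideal.Quotient.eq_zero_iff_mem, hI j (by omega), Submodule.mem_sup] at hy
        obtain ⟨a, ha, b, hb, rfl⟩ := hy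
        obtain ⟨z, rfl⟩ := Ideal.mem_span_singleton'.1 hb
        refine ⟨Ideal.Quotient.mk _ z, ?_⟩
        rw [map_add, Ideal.Quotient.eq_zero_iff_mem.2 ha, zero_add, mul_comm, Algebra.smul_def]; rfl
      let πR : (T ⧸ I j) →ₗ[R] (T ⧸ I (j+1)) := π.restrictScalars R
      obtain ⟨m', χ', hχ'⟩ := IH m rfl (n+1) (by omega) (πR ∘ₗ ψ) (by
        rw [LinearMap.comp_assoc, ← hψ]; ext y; exact hπx _)
      obtain ⟨χ, hχ⟩ := Module.projective_lifting_property πR χ' hπ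
      let mx : (T ⧸ I j) →ₗ[R] (T ⧸ I j) := LinearMap.lsmul R _ (x j)
      have hr : ∀ y, (c (n+1) • ψ - χ ∘ₗ δ m m') y ∈ LinearMap.range mx := by
        intro y
        obtain ⟨z, hz⟩ := hπk ((c (n+1) • ψ - χ ∘ₗ δ m m') y) (by
          have e1 := LinearMap.congr_fun hχ' y
          rw [← hχ] at e1
          simp only [LinearMap.smul_apply, LinearMap.comp_apply, LinearMap.sub_apply, map_sub, map_smul] at e1 ⊢
          rw [sub_eq_zero]
          exact e1)
        exact ⟨z, hz⟩
      obtain ⟨ρ, hρ⟩ := Module.projective_lifting_property mx.rangeRestrict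
        (LinearMap.codRestrict _ (c (n+1) • ψ - χ ∘ₗ δ m m') hr) mx.surjective_rangeRestrict
      have hρ' : ∀ y, x j • ρ y = c (n+1) • ψ y - χ (δ m m' y) := by
        intro y
        have := congrArg Subtype.val (LinearMap.congr_fun hρ y)
        simpa [mx] using this
      refine ⟨m, (c (n+1) ^ (p-2) * c (n+1)) • ρ, ?_⟩
      ext y
      have e2 : x j • (c (n+1) • φ y - ρ (δ (m+1) m y)) = 0 := by
        have e3 := LinearMap.congr_fun hψ y
        have e4 : δ m m' (δ (m+1) m y) = 0 := LinearMap.congr_fun (hδ (m+1) m m') y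
        simp only [LinearMap.smul_apply, LinearMap.comp_apply] at e3
        rw [smul_sub, hρ', smul_comm, e3, e4]
        simp
      have e5 := hker j (by omega) (n+1) (by omega) _ e2
      rw [smul_sub, sub_eq_zero] at e5
      simp only [LinearMap.smul_apply, LinearMap.comp_apply]
      rw [cc n, mul_smul, mul_smul, e5, mul_smul]
  have multi : ∀ i j, i + j < d → (∀ k, i = k + 1 → ∀ n, 0 < n → ∀ φ : X k →ₗ[R] (T ⧸ I (j+1)),
      φ ∘ₗ δ (k+1) k = 0 → ∃ (m : ℕ) (ψ : X m →ₗ[R] (T ⧸ I (j+1))), c n • φ = ψ ∘ₗ δ k m) →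
      ∀ s : ℕ, ∀ φ : X i →ₗ[R] (T ⧸ I j),
      (∃ (m : ℕ) (ψ : X m →ₗ[R] (T ⧸ I j)), x j ^ s • φ = ψ ∘ₗ δ i m) →
      ∀ n, 0 < n → ∃ (m : ℕ) (ψ : X m →ₗ[R] (T ⧸ I j)), c n • φ = ψ ∘ₗ δ i m := by
    intro i j hij IH s
    induction s with
    | zero =>
      rintro φ ⟨m, ψ, hψ⟩ n hn
      refine ⟨m, c n • ψ, ?_⟩
      rw [pow_zero, one_smul] at hψ
      rw [hψ, LinearMap.smul_comp]
    | succ s ihs =>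
      rintro φ ⟨m, ψ, hψ⟩ n hn
      obtain ⟨m1, ψ1, e1⟩ := single i j hij IH (x j ^ s • φ) ⟨m, ψ, by
        rw [← hψ, smul_smul, pow_succ, mul_comm]⟩ (n+1) (by omega)
      obtain ⟨m2, ψ2, e2⟩ := ihs (c (n+1) • φ) ⟨m1, ψ1, by rw [← e1, smul_comm]⟩ (n+1) (by omega)
      refine ⟨m2, c (n+1) ^ (p-2) • ψ2, ?_⟩
      rw [cc n, mul_smul, mul_smul, e2, LinearMap.smul_comp]
  induction i with
  | zero =>
    intro j hij n hn φ hφ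
    obtain ⟨s, hs⟩ := hN j (by omega)
    exact multi 0 j hij (by intro k hk; omega) s φ (hs 0 j φ hφ) n hn
  | succ k ih =>
    intro j hij n hn φ hφ
    obtain ⟨s, hs⟩ := hN j (by omega)
    refine multi (k+1) j hij ?_ s φ (hs _ j φ hφ) n hn
    intro k' hk'
    obtain rfl : k' = k := by omega
    exact ih (j+1) (by omega)

open CategoryTheory Limits Opposite in
theorem acm_localCohomology {R T : Type u} [CommRing R] [CommRing T] [Algebra R T]
    (J : Ideal R)
    (p : ℕ) (hp : 2 ≤ p) (c : ℕ → T) (hc : ∀ n, c (n+1) ^ p = c n)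
    (d : ℕ) (I : ℕ → Ideal T) (x : ℕ → R)
    (hxJ : ∀ j, j < d → x j ∈ J)
    (hI0 : I 0 = ⊥)
    (hI : ∀ j, j < d → I (j+1) = I j ⊔ Ideal.span {algebraMap R T (x j)})
    (hcol : ∀ j, j < d → ∀ n, 0 < n → ∀ t : T, algebraMap R T (x j) * t ∈ I j → c n * t ∈ I j)
    (i : ℕ) (hi : i < d) (n : ℕ) (hn : 0 < n) :
    (localCohomology J i).map (ModuleCat.ofHom (Algebra.lmul R T (c n) : T →ₗ[R] T)) = 0 := by
  apply acm_localCohomology_map_zero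
  intro t
  let N := ModuleCat.of R (R ⧸ J ^ t)
  let P := projectiveResolution N
  apply acm_ext_zero _ _ _ _ P
  intro z hz
  have : ∀ i, Module.Projective R (P.complex.X i) := fun i =>
    (IsProjective.iff_projective _).2 (P.projective i)
  obtain ⟨m, ψ, hψ⟩ := acm_cocycle p hp c hc d I x hI hcol (fun i => P.complex.X i)
    (fun i m => (P.complex.d i m).hom)
    (by intro m; rw [P.complex.shape 0 m (by simp)]; rfl)
    (by
      intro i m hm
      rw [P.complex.shape (i+1) m (by simpa using hm)]; rfl)
    (by
      intro i m l
      have := P.complex.d_comp_d i m l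
      exact congrArg ModuleCat.Hom.hom this)
    (by
      intro j hj
      refine ⟨t, ?_⟩
      intro i l φ hφ
      let r := x j ^ t
      have hr : r ∈ J ^ t := Ideal.pow_mem_pow (hxJ j hj) t
      let F : P.complex ⟶ P.complex := r • 𝟙 P.complex
      have hrN : r • 𝟙 N = 0 := by
        apply ModuleCat.hom_ext
        apply LinearMap.ext
        intro y
        change r • (y : R ⧸ J ^ t) = 0
        obtain ⟨y, rfl⟩ := Ideal.Quotient.mk_surjective y
        rw [← Ideal.Quotient.mk_eq_mk, ← Submodule.Quotient.mk_smul]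
        exact (Submodule.Quotient.mk_eq_zero _).2 (Ideal.mul_mem_right _ _ hr)
      have hF : F ≫ P.π = 0 := by
        have e1 : r • 𝟙 ((ChainComplex.single₀ (ModuleCat.{u} R)).obj N) = 0 := by
          rw [← CategoryTheory.Functor.map_id]
          have := (ChainComplex.single₀ (ModuleCat.{u} R)).congr_map hrN
          rw [Functor.map_zero] at this
          rw [← this]
          apply HomologicalComplex.to_single_hom_ext
          ext y
          rfl
        have e2 : F ≫ P.π = P.π ≫ (r • 𝟙 _) := by
          simp [F, Linear.smul_comp, Linear.comp_smul]
        rw [e2, e1, comp_zero]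
      let H := ProjectiveResolution.liftHomotopyZero F hF
      have hpd : prevD i H.hom = H.hom i (i+1) ≫ P.complex.d (i+1) i := prevD_eq _ (by simp)
      have hc := H.comm i
      rw [hpd] at hc
      replace hc := congrArg ModuleCat.Hom.hom hc
      refine ⟨(ComplexShape.down ℕ).next i, φ ∘ₗ (H.hom ((ComplexShape.down ℕ).next i) i).hom, ?_⟩
      ext y
      have h2 := congrArg φ (LinearMap.congr_fun hc y)
      have h3 : φ ((F.f i).hom y) = r • φ y := by
        rw [← map_smul]; rfl
      have h4 : ∀ w, φ ((P.complex.d (i+1) i).hom w) = 0 := fun w => LinearMap.congr_fun hφ w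
      rw [h3] at h2
      simp only [LinearMap.smul_apply, LinearMap.comp_apply]
      rw [h2]
      simp only [HomologicalComplex.zero_f, add_zero, ModuleCat.hom_add, LinearMap.add_apply, map_add]
      rw [ModuleCat.hom_comp, LinearMap.comp_apply, h4, add_zero]
      rfl)
    i 0 (by omega) n hn ((Submodule.mkQ (I 0)).restrictScalars R ∘ₗ z.hom) (by
      rw [LinearMap.comp_assoc]
      have : z.hom ∘ₗ (P.complex.d (i+1) i).hom = 0 := congrArg ModuleCat.Hom.hom hz
      rw [this]; simp)
  let e : (T ⧸ I 0) →ₗ[R] T := ((Submodule.quotEquivOfEqBot (I 0) hI0).toLinearMap).restrictScalars R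
  refine ⟨m, ModuleCat.ofHom (e ∘ₗ ψ), ?_⟩
  ext y
  have := congrArg e (LinearMap.congr_fun hψ y)
  have e1 : ∀ w : T, e (Submodule.Quotient.mk w) = w := fun w => by
    exact Submodule.quotEquivOfEqBot_apply_mk _ hI0 w
  have e2 : (c n • ((Submodule.mkQ (I 0)).restrictScalars R ∘ₗ z.hom)) y =
    Submodule.Quotient.mk (c n * z.hom y) := rfl
  rw [e2, e1] at this
  exact this
end Part_LC2

section Part_NC1
set_option maxHeartbeats 1000000
set_option synthInstance.maxHeartbeats 400000
set_option linter.unusedSectionVars false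
universe u

open IsLocalRing 

section NC1

theorem nc_rad {S : Type*} [CommRing S] [IsDomain S] [IsNoetherianRing S] [IsLocalRing S] (a : S)
    (h : ∀ Q : Ideal S, Q.IsPrime → Q ≠ ⊥ → a ∈ Q) (ha : a ≠ 0) : maximalIdeal S ≤ (Ideal.span {a}).radical := by
  rw [← Ideal.sInf_minimalPrimes]
  refine le_sInf fun Q0 hQ0 => ?_
  by_contra hne
  have hfin := Ideal.finite_minimalPrimes_of_isNoetherianRing S (Ideal.span {a})
  have hQ0p : Q0.IsPrime := hQ0.1.1
  by_cases hsub : (maximalIdeal S : Set S) ⊆ ⋃ i ∈ (hfin.toFinset : Set (Ideal S)), (i : Set S)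
  · rw [Ideal.subset_union_prime (f := fun i => i) ⊤ ⊤ (fun i hi _ _ => ((hfin.mem_toFinset).1 hi).1.1)] at hsub
    obtain ⟨Q, hQ, hmQ⟩ := hsub
    have hQ' := hfin.mem_toFinset.1 hQ
    have h1 : Q0 ≤ Q := (le_maximalIdeal hQ0p.ne_top).trans hmQ
    exact hne (hmQ.trans (hQ'.2 hQ0.1 h1))
  · rw [Set.not_subset] at hsub
    obtain ⟨b, hb, hbn⟩ := hsub
    have hbn' : ∀ Q ∈ (Ideal.span {a}).minimalPrimes, b ∉ Q := by
      intro Q hQ hbQ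
      apply hbn
      simp only [Set.mem_iUnion]
      exact ⟨Q, hfin.mem_toFinset.2 hQ, hbQ⟩
    have hb0 : b ≠ 0 := by
      rintro rfl
      exact hbn' Q0 hQ0 (Q0.zero_mem)
    obtain ⟨Q', hQ', -⟩ := Ideal.exists_minimalPrimes_le (I := Ideal.span {b}) (J := maximalIdeal S) 
      ((Ideal.span_singleton_le_iff_mem _).2 hb)
    have hQ'p : Q'.IsPrime := hQ'.1.1
    have hht := Ideal.height_le_one_of_isPrincipal_of_mem_minimalPrimes _ Q' hQ'
    have hbQ' : b ∈ Q' := hQ'.1.2 (Ideal.mem_span_singleton_self b)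
    have hQne : Q' ≠ ⊥ := by
      rintro rfl
      exact hb0 hbQ'
    obtain ⟨Q'', hQ'', hle⟩ := Ideal.exists_minimalPrimes_le (I := Ideal.span {a}) (J := Q') 
      ((Ideal.span_singleton_le_iff_mem _).2 (h Q' hQ'p hQne))
    have hlt : Q'' < Q' := lt_of_le_of_ne hle (by rintro rfl; exact hbn' _ hQ'' hbQ')
    have hQ''p : Q''.IsPrime := hQ''.1.1
    have h0 : Q''.height < 1 := Ideal.height_le_iff.1 hht Q'' hQ''p hlt
    rw [Order.lt_one_iff, Ideal.height_eq_zero_iff, IsDomain.minimalPrimes_eq_singleton_bot] at h0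
    apply ha
    have := hQ''.1.2 (Ideal.mem_span_singleton_self a)
    rw [Set.mem_singleton_iff.1 h0] at this
    exact this

theorem nc_prime {R : Type*} [CommRing R] [IsDomain R] [IsNoetherianRing R] [IsLocalRing R] (a : R) (ha : a ≠ 0) :
    ∃ (P : Ideal R) (_ : P.IsPrime), a ∉ P ∧ ∃ M : ℕ, maximalIdeal R ^ M ≤ Ideal.span {a} ⊔ P := by
  obtain ⟨P, ⟨hP, haP⟩, hmax⟩ := set_has_maximal_iff_noetherian.mpr (inferInstance : IsNoetherian R R) {P : Ideal R | P.IsPrime ∧ a ∉ P} 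
    ⟨⊥, Ideal.isPrime_bot, ha⟩
  refine ⟨P, hP, haP, ?_⟩
  have : IsLocalRing (R ⧸ P) := IsLocalRing.of_surjective' (Ideal.Quotient.mk P) Ideal.Quotient.mk_surjective
  have h1 := nc_rad (Ideal.Quotient.mk P a) (by
    intro Q hQ hQ0
    by_contra h
    have hQ' : (Q.comap (Ideal.Quotient.mk P)).IsPrime := hQ.comap _
    refine hmax (Q.comap (Ideal.Quotient.mk P)) ⟨hQ', h⟩ (lt_of_le_of_ne ?_ ?_)
    · intro z hz
      rw [Ideal.mem_comap, Ideal.Quotient.eq_zero_iff_mem.2 hz]; exact Q.zero_mem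
    · intro he
      apply hQ0
      rw [eq_bot_iff]
      intro z hz
      obtain ⟨z, rfl⟩ := Ideal.Quotient.mk_surjective z
      have : z ∈ P := by rw [he]; exact hz
      rw [Ideal.Quotient.eq_zero_iff_mem.2 this]; exact Ideal.zero_mem _) (fun h => haP (Ideal.Quotient.eq_zero_iff_mem.1 h))
  obtain ⟨M, hM⟩ := Ideal.exists_pow_le_of_le_radical_of_fg h1 (IsNoetherian.noetherian _)
  refine ⟨M, ?_⟩
  have h2 : (maximalIdeal R).map (Ideal.Quotient.mk P) ≤ maximalIdeal (R ⧸ P) := by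
    rw [Ideal.map_le_iff_le_comap]
    intro z hz hu
    have : IsLocalHom (Ideal.Quotient.mk P) := .of_surjective _ Ideal.Quotient.mk_surjective
    exact hz (isUnit_of_map_unit _ _ hu)
  intro z hz
  have h3 : Ideal.Quotient.mk P z ∈ Ideal.span {Ideal.Quotient.mk P a} := by
    apply hM
    apply Ideal.pow_right_mono h2
    rw [← Ideal.map_pow]
    exact Ideal.mem_map_of_mem _ hz
  obtain ⟨c, hc⟩ := Ideal.mem_span_singleton.1 h3
  obtain ⟨c, rfl⟩ := Ideal.Quotient.mk_surjective c
  rw [← map_mul, Ideal.Quotient.eq] at hc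
  have : z = a * c + (z - a * c) := by ring
  rw [this]
  exact Ideal.add_mem _ (Ideal.mem_sup_left (Ideal.mul_mem_right _ _ (Ideal.mem_span_singleton_self a))) (Ideal.mem_sup_right hc)

theorem noncont {R T : Type*} [CommRing R] [IsDomain R] [IsNoetherianRing R] [IsLocalRing R] [CommRing T] [Algebra R T]
    [Algebra.IsIntegral R T] (hinj : Function.Injective (algebraMap R T)) (p : ℕ) (hp : 2 ≤ p) (a : R) (ha : a ≠ 0) 
    (c : ℕ → T) (hc0 : c 0 = algebraMap R T a) (hc : ∀ n, c (n + 1) ^ p = c n) : 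
    ∃ n, c n ∉ Ideal.map (algebraMap R T) (maximalIdeal R) := by
  by_contra hcon
  push Not at hcon
  obtain ⟨P, hP, haP, M, hM⟩ := nc_prime a ha
  have hpow : ∀ n, c n ^ p ^ n = algebraMap R T a := by
    intro n
    induction n with
    | zero => rw [pow_zero, pow_one, hc0]
    | succ n ih => rw [pow_succ', pow_mul, hc, ih]
  have hlt : M + 1 ≤ p ^ (M + 1) := (Nat.lt_pow_self (by omega)).le
  have h1 : algebraMap R T a ∈ Ideal.map (algebraMap R T) (maximalIdeal R ^ (M + 1)) := by
    rw [← hpow (M + 1), Ideal.map_pow]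
    exact Ideal.pow_le_pow_right hlt (Ideal.pow_mem_pow (hcon _) _)
  have h2 : maximalIdeal R ^ (M + 1) ≤ Ideal.span {a} * maximalIdeal R ⊔ P := by
    rw [pow_succ]
    refine (Ideal.mul_mono_left hM).trans ?_
    rw [Ideal.sup_mul]
    exact sup_le_sup_left Ideal.mul_le_left _
  have h3 := Ideal.map_mono (f := algebraMap R T) h2 h1
  rw [Ideal.map_sup, Ideal.map_mul, Ideal.map_span, Set.image_singleton] at h3
  obtain ⟨u, hu, v, hv, huv⟩ := Submodule.mem_sup.1 h3
  obtain ⟨μ, hμ, rfl⟩ := Ideal.mem_span_singleton_mul.1 hu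
  have hunit : IsUnit (1 - μ) := by
    by_contra hnu
    obtain ⟨N, hN, hN'⟩ := exists_max_ideal_of_mem_nonunits hnu
    have h4 : (N.comap (algebraMap R T)).IsMaximal := Ideal.isMaximal_comap_of_isIntegral_of_isMaximal N
    have h5 : Ideal.map (algebraMap R T) (maximalIdeal R) ≤ N := by
      rw [Ideal.map_le_iff_le_comap, IsLocalRing.eq_maximalIdeal h4]
    apply hN.ne_top
    rw [Ideal.eq_top_iff_one]
    have := N.add_mem hN' (h5 hμ)
    simpa using this
  have h6 : algebraMap R T a ∈ Ideal.map (algebraMap R T) P := by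
    have : algebraMap R T a * (1 - μ) ∈ Ideal.map (algebraMap R T) P := by
      have e : algebraMap R T a * (1 - μ) = v := by
        rw [mul_sub, mul_one, sub_eq_iff_eq_add, add_comm]; exact huv.symm
      rw [e]; exact hv
    exact (Ideal.mul_unit_mem_iff_mem _ hunit).1 this
  obtain ⟨Q, -, hQ, hQP⟩ := Ideal.exists_ideal_over_prime_of_isIntegral (S := T) P ⊥ (by
    intro z hz
    have : z = 0 := hinj (by rw [map_zero]; exact hz)
    rw [this]; exact P.zero_mem)
  apply haP
  rw [← hQP, Ideal.mem_comap]
  exact (Ideal.map_le_iff_le_comap.2 hQP.ge) h6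

end NC1
end Part_NC1

section Part_SS1
set_option maxHeartbeats 1000000
set_option synthInstance.maxHeartbeats 400000
set_option linter.unusedSectionVars false
universe u

/-! The untilt `W(D)/(p-[t])`. -/

section SS
variable (p : ℕ) [Fact p.Prime]

/-- The untilt `W(D)/(p-[t])` of a perfect ring `D` of characteristic `p` along `t`. -/
abbrev SS (D : Type u) [CommRing D] (t : D) : Type u :=
  WittVector p D ⧸ Ideal.span {(p : WittVector p D) - WittVector.teichmuller p t}

/-- The sharp map `D → S(D)`. -/
noncomputable def SS.sharp (D : Type u) [CommRing D] (t : D) : D →* SS p D t :=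
  (Ideal.Quotient.mk _ : WittVector p D →+* SS p D t).toMonoidHom.comp (WittVector.teichmuller p)

theorem SS.sharp_def (D : Type u) [CommRing D] (t d : D) :
    SS.sharp p D t d = Ideal.Quotient.mk _ (WittVector.teichmuller p d) := rfl

theorem SS.sharp_t (D : Type u) [CommRing D] (t : D) : SS.sharp p D t t = p := by
  rw [SS.sharp_def, ← map_natCast (Ideal.Quotient.mk _), eq_comm, Ideal.Quotient.eq]
  exact Ideal.mem_span_singleton_self _

variable (D : Type u) [CommRing D] [CharP D p] [PerfectRing D p] (t : D)

/-- The residue map `S(D) → D/t`. -/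
noncomputable def SS.res : SS p D t →+* D ⧸ Ideal.span {t} :=
  Ideal.Quotient.lift _ ((Ideal.Quotient.mk (Ideal.span {t})).comp WittVector.constantCoeff) (by
    intro a ha
    obtain ⟨b, rfl⟩ := Ideal.mem_span_singleton'.1 ha
    rw [map_mul]
    have : ((Ideal.Quotient.mk (Ideal.span {t})).comp WittVector.constantCoeff)
        ((p : WittVector p D) - WittVector.teichmuller p t) = 0 := by
      rw [map_sub, map_natCast, RingHom.comp_apply]
      have h1 : WittVector.constantCoeff (WittVector.teichmuller p t) = t :=
        WittVector.teichmuller_coeff_zero p t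
      rw [h1, Ideal.Quotient.eq_zero_iff_mem.2 (Ideal.mem_span_singleton_self t), sub_zero]
      rw [← map_natCast (Ideal.Quotient.mk (Ideal.span {t})), CharP.cast_eq_zero, map_zero]
    rw [this, mul_zero])

theorem SS.res_mk (w : WittVector p D) :
    SS.res p D t (Ideal.Quotient.mk _ w) = Ideal.Quotient.mk _ (w.coeff 0) := rfl

theorem SS.res_sharp (d : D) : SS.res p D t (SS.sharp p D t d) = Ideal.Quotient.mk _ d := by
  rw [SS.sharp_def, SS.res_mk, WittVector.teichmuller_coeff_zero]

theorem SS.res_surjective : Function.Surjective (SS.res p D t) := fun y => by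
  obtain ⟨d, rfl⟩ := Ideal.Quotient.mk_surjective y
  exact ⟨_, SS.res_sharp p D t d⟩

theorem SS.res_p : SS.res p D t p = 0 := by
  rw [← SS.sharp_t, SS.res_sharp]
  exact Ideal.Quotient.eq_zero_iff_mem.2 (Ideal.mem_span_singleton_self t)

theorem SS.res_eq_zero (s : SS p D t) : SS.res p D t s = 0 ↔ (p : SS p D t) ∣ s := by
  constructor
  · intro h
    obtain ⟨w, rfl⟩ := Ideal.Quotient.mk_surjective s
    rw [SS.res_mk, Ideal.Quotient.eq_zero_iff_mem] at h
    obtain ⟨e, he⟩ := Ideal.mem_span_singleton'.1 h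
    have h1 : w - WittVector.teichmuller p e * WittVector.teichmuller p t ∈
        Ideal.span {(p : WittVector p D)} := by
      rw [← WittVector.ker_constantCoeff, RingHom.mem_ker, map_sub, map_mul]
      have h2 : ∀ a : D, WittVector.constantCoeff (WittVector.teichmuller p a) = a :=
        WittVector.teichmuller_coeff_zero p
      rw [h2, h2, he]
      simp
    obtain ⟨v, hv⟩ := Ideal.mem_span_singleton'.1 h1
    have h3 := congrArg (Ideal.Quotient.mk (Ideal.span {(p : WittVector p D) - WittVector.teichmuller p t})) hv
    simp only [map_mul, map_sub, map_natCast] at h3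
    rw [← SS.sharp_def, ← SS.sharp_def, SS.sharp_t] at h3
    exact ⟨Ideal.Quotient.mk _ v + SS.sharp p D t e, by linear_combination -h3⟩
  · rintro ⟨v, rfl⟩
    rw [map_mul, SS.res_p, zero_mul]

theorem SS.exists_sharp (s : SS p D t) : ∃ (d : D) (s' : SS p D t), s = SS.sharp p D t d + p * s' := by
  obtain ⟨d, hd⟩ := Ideal.Quotient.mk_surjective (SS.res p D t s)
  have : SS.res p D t (s - SS.sharp p D t d) = 0 := by
    rw [map_sub, SS.res_sharp, hd, sub_self]
  obtain ⟨s', hs'⟩ := (SS.res_eq_zero p D t _).1 this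
  exact ⟨d, s', by linear_combination hs'⟩

theorem SS.p_reg (ht : ∀ d : D, t * d = 0 → d = 0) (s : SS p D t) (hs : (p : SS p D t) * s = 0) : s = 0 := by
  obtain ⟨w, rfl⟩ := Ideal.Quotient.mk_surjective s
  rw [← map_natCast (Ideal.Quotient.mk _), ← map_mul, Ideal.Quotient.eq_zero_iff_mem] at hs
  obtain ⟨y, hy⟩ := Ideal.mem_span_singleton'.1 hs
  have h0 : y.coeff 0 = 0 := by
    have := congrArg WittVector.constantCoeff hy
    rw [map_mul, map_mul, map_sub, map_natCast, CharP.cast_eq_zero, zero_mul, zero_sub] at this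
    have h2 : WittVector.constantCoeff (WittVector.teichmuller p t) = t :=
        WittVector.teichmuller_coeff_zero p t
    rw [h2] at this
    have h3 : t * WittVector.constantCoeff y = 0 := by linear_combination -this
    exact ht _ h3
  rw [← WittVector.mem_span_p_iff_coeff_zero_eq_zero] at h0
  obtain ⟨y', rfl⟩ := Ideal.mem_span_singleton'.1 h0
  rw [Ideal.Quotient.eq_zero_iff_mem]
  have : w - y' * ((p : WittVector p D) - WittVector.teichmuller p t) = 0 := by
    apply WittVector.eq_zero_of_p_mul_eq_zero
    linear_combination -hy
  rw [sub_eq_zero.1 this]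
  exact Ideal.mul_mem_left _ _ (Ideal.mem_span_singleton_self _)

variable {D}
variable {D' : Type u} [CommRing D'] [CharP D' p] [PerfectRing D' p] (t' : D')

/-- Functoriality of the untilt. -/
noncomputable def SS.map (f : D →+* D') (hf : f t = t') : SS p D t →+* SS p D' t' :=
  Ideal.quotientMap _ (WittVector.map f) (by
    rw [Ideal.span_singleton_le_iff_mem, Ideal.mem_comap, map_sub, map_natCast,
      WittVector.map_teichmuller, hf]
    exact Ideal.mem_span_singleton_self _)

theorem SS.map_mk (f : D →+* D') (hf : f t = t') (w : WittVector p D) :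
    SS.map p t t' f hf (Ideal.Quotient.mk _ w) = Ideal.Quotient.mk _ (WittVector.map f w) := rfl

theorem SS.map_sharp (f : D →+* D') (hf : f t = t') (d : D) :
    SS.map p t t' f hf (SS.sharp p D t d) = SS.sharp p D' t' (f d) := by
  rw [SS.sharp_def, SS.map_mk, WittVector.map_teichmuller]; rfl

theorem SS.res_map (f : D →+* D') (hf : f t = t') (s : SS p D t) (d : D)
    (h : SS.res p D t s = Ideal.Quotient.mk _ d) :
    SS.res p D' t' (SS.map p t t' f hf s) = Ideal.Quotient.mk _ (f d) := by
  obtain ⟨w, rfl⟩ := Ideal.Quotient.mk_surjective s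
  rw [SS.res_mk, Ideal.Quotient.eq] at h
  rw [SS.map_mk, SS.res_mk, Ideal.Quotient.eq, WittVector.map_coeff, ← map_sub]
  obtain ⟨e, he⟩ := Ideal.mem_span_singleton'.1 h
  rw [← he, map_mul, hf]
  exact Ideal.mul_mem_left _ _ (Ideal.mem_span_singleton_self _)

theorem SS.map_comp {D'' : Type u} [CommRing D''] [CharP D'' p] [PerfectRing D'' p] (t'' : D'')
    (f : D →+* D') (hf : f t = t') (g : D' →+* D'') (hg : g t' = t'') (s : SS p D t) :
    SS.map p t' t'' g hg (SS.map p t t' f hf s) =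
      SS.map p t t'' (g.comp f) (by rw [RingHom.comp_apply, hf, hg]) s := by
  obtain ⟨w, rfl⟩ := Ideal.Quotient.mk_surjective s
  rw [SS.map_mk, SS.map_mk, SS.map_mk]
  congr 1

end SS
end Part_SS1

section Part_REG1
set_option maxHeartbeats 1000000
set_option synthInstance.maxHeartbeats 400000
set_option linter.unusedSectionVars false
universe u

/-! Weakly regular sequences modulo an ideal, elementwise. -/

section WReg

/-- `l` is a weakly regular sequence on `D/I`. -/
def WReg {D : Type*} [CommRing D] : Ideal D → List D → Prop
  | _, [] => True
  | I, a :: l => (∀ d, a * d ∈ I → d ∈ I) ∧ WReg (I ⊔ Ideal.span {a}) l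

variable {D : Type*} [CommRing D]

theorem WReg.nil (I : Ideal D) : WReg I [] := trivial

theorem WReg.cons_iff (I : Ideal D) (a : D) (l : List D) :
    WReg I (a :: l) ↔ (∀ d, a * d ∈ I → d ∈ I) ∧ WReg (I ⊔ Ideal.span {a}) l := Iff.rfl

theorem mem_sup_span_singleton {I : Ideal D} {a d : D} :
    d ∈ I ⊔ Ideal.span {a} ↔ ∃ e, d - a * e ∈ I := by
  constructor
  · intro h
    obtain ⟨i, hi, j, hj, rfl⟩ := Submodule.mem_sup.1 h
    obtain ⟨e, rfl⟩ := Ideal.mem_span_singleton'.1 hj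
    exact ⟨e, by convert hi using 1; ring⟩
  · rintro ⟨e, he⟩
    have : d = (d - a * e) + a * e := by ring
    rw [this]
    exact Ideal.add_mem _ (Ideal.mem_sup_left he)
      (Ideal.mem_sup_right (Ideal.mul_mem_right _ _ (Ideal.mem_span_singleton_self a)))

/-- Extension lemma. -/
theorem WReg.ext (a : D) (l : List D) : ∀ (I1 I2 I3 : Ideal D),
    I3 = I2 ⊔ Ideal.span {a} → (∀ e, a * e ∈ I2 ↔ e ∈ I1) →
    WReg I1 l → WReg I3 l → WReg I2 l := by
  induction l with
  | nil => intros; trivial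
  | cons b l ih =>
    intro I1 I2 I3 h3 h1 hl1 hl3
    refine ⟨fun d hd => ?_, ?_⟩
    · have : d ∈ I3 := hl3.1 d (by rw [h3]; exact Ideal.mem_sup_left hd)
      rw [h3, mem_sup_span_singleton] at this
      obtain ⟨e, he⟩ := this
      have h4 : a * (b * e) ∈ I2 := by
        have := Ideal.sub_mem _ hd (Ideal.mul_mem_left _ b he)
        convert this using 1; ring
      have h5 := (h1 e).2 (hl1.1 e ((h1 _).1 h4))
      have := Ideal.add_mem _ he h5
      convert this using 1; ring
    · apply ih (I1 ⊔ Ideal.span {b}) _ (I3 ⊔ Ideal.span {b}) _ _ hl1.2 hl3.2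
      · rw [h3]; ac_rfl
      · intro e
        constructor
        · intro h
          obtain ⟨f, hf⟩ := mem_sup_span_singleton.1 h
          have hf3 : f ∈ I3 := by
            apply hl3.1
            rw [h3, mem_sup_span_singleton]
            refine ⟨e, ?_⟩
            have := I2.neg_mem hf
            convert this using 1; ring
          rw [h3, mem_sup_span_singleton] at hf3
          obtain ⟨f', hf'⟩ := hf3
          rw [mem_sup_span_singleton]
          refine ⟨f', (h1 _).1 ?_⟩
          have := Ideal.add_mem _ hf (Ideal.mul_mem_left _ b hf')
          convert this using 1; ring
        · intro h
          obtain ⟨f, hf⟩ := mem_sup_span_singleton.1 h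
          rw [mem_sup_span_singleton]
          refine ⟨a * f, ?_⟩
          have := (h1 _).2 hf
          convert this using 1; ring

theorem WReg.pow_head (a : D) (l : List D) (I : Ideal D) (h : WReg I (a :: l)) (n : ℕ) :
    WReg I (a ^ n :: l) := by
  have hreg : ∀ n d, a ^ n * d ∈ I → d ∈ I := by
    intro n
    induction n with
    | zero => intro d hd; simpa using hd
    | succ n ih => intro d hd; exact ih d (h.1 _ (by convert hd using 1; ring))
  refine ⟨hreg n, ?_⟩
  induction n with
  | zero =>
    have : I ⊔ Ideal.span {a ^ 0} = ⊤ := by simp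
    rw [this]
    clear this hreg h
    induction l with
    | nil => trivial
    | cons b l ih => exact ⟨fun d _ => trivial, by simpa using ih⟩
  | succ n ih =>
    apply WReg.ext a l (I ⊔ Ideal.span {a ^ n}) _ (I ⊔ Ideal.span {a}) _ _ ih h.2
    · apply le_antisymm
      · exact sup_le (le_sup_of_le_left le_sup_left) le_sup_right
      · refine sup_le (sup_le le_sup_left ?_) le_sup_right
        refine le_sup_of_le_right ?_
        rw [Ideal.span_singleton_le_span_singleton]
        exact ⟨a ^ n, by ring⟩
    · intro e
      rw [mem_sup_span_singleton, mem_sup_span_singleton]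
      constructor
      · rintro ⟨f, hf⟩
        exact ⟨f, h.1 _ (by convert hf using 1; ring)⟩
      · rintro ⟨f, hf⟩
        exact ⟨f, by convert Ideal.mul_mem_left _ a hf using 1; ring⟩

theorem WReg.pow (n : ℕ) (l : List D) : ∀ (I : Ideal D), WReg I l → WReg I (l.map (· ^ n)) := by
  induction l with
  | nil => intros; trivial
  | cons a l ih =>
    intro I h
    have := WReg.pow_head a l I h n
    exact ⟨this.1, ih _ this.2⟩

/-- unfolded form -/
theorem WReg.iff (l : List D) : ∀ (I : Ideal D), WReg I l ↔
    ∀ l1 a l2, l = l1 ++ a :: l2 → ∀ d, a * d ∈ I ⊔ Ideal.ofList l1 → d ∈ I ⊔ Ideal.ofList l1 := by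
  induction l with
  | nil =>
    intro I
    simp [WReg.nil]
  | cons b l ih =>
    intro I
    rw [WReg.cons_iff, ih]
    constructor
    · rintro ⟨h1, h2⟩ l1 a l2 h
      cases l1 with
      | nil =>
        simp only [List.nil_append, List.cons.injEq] at h
        obtain ⟨rfl, rfl⟩ := h
        simpa using h1
      | cons c l1 =>
        simp only [List.cons_append, List.cons.injEq] at h
        obtain ⟨rfl, rfl⟩ := h
        have := h2 l1 a l2 rfl
        rwa [sup_assoc, ← Ideal.ofList_cons] at this
    · intro h
      refine ⟨?_, ?_⟩
      · have := h [] b l rfl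
        simpa using this
      · intro l1 a l2 hl
        have := h (b :: l1) a l2 (by rw [hl]; rfl)
        rwa [Ideal.ofList_cons, ← sup_assoc] at this

/-- Transfer along surjections. -/
theorem WReg.of_surjective {K : Type*} [CommRing K] (f : D →+* K) (hf : Function.Surjective f)
    (l : List D) : ∀ (J : Ideal K), WReg (J.comap f) l → WReg J (l.map f) := by
  induction l with
  | nil => intros; trivial
  | cons a l ih =>
    intro J h
    refine ⟨fun d hd => ?_, ih _ ?_⟩
    · obtain ⟨d, rfl⟩ := hf d
      exact h.1 d (by rw [Ideal.mem_comap, map_mul]; exact hd)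
    · convert h.2 using 1
      ext d
      rw [Ideal.mem_comap, mem_sup_span_singleton, mem_sup_span_singleton]
      constructor
      · rintro ⟨e, he⟩
        obtain ⟨e, rfl⟩ := hf e
        exact ⟨e, by rw [Ideal.mem_comap, map_sub, map_mul]; exact he⟩
      · rintro ⟨e, he⟩
        exact ⟨f e, by rw [Ideal.mem_comap, map_sub, map_mul] at he; exact he⟩

open Polynomial in
theorem WReg.polyC (l : List D) : ∀ (I : Ideal D), WReg I l →
    WReg (I.map (C : D →+* D[X])) (l.map C) := by
  induction l with
  | nil => intros; trivial
  | cons a l ih =>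
    intro I h
    refine ⟨fun d hd => ?_, ?_⟩
    · rw [Ideal.mem_map_C_iff] at hd ⊢
      exact fun n => h.1 _ (by simpa using hd n)
    · have := ih _ h.2
      rwa [Ideal.map_sup, Ideal.map_span, Set.image_singleton] at this

theorem WReg.mvC {σ : Type*} (l : List D) : ∀ (I : Ideal D), WReg I l →
    WReg (I.map (MvPolynomial.C : D →+* MvPolynomial σ D)) (l.map MvPolynomial.C) := by
  induction l with
  | nil => intros; trivial
  | cons a l ih =>
    intro I h
    refine ⟨fun d hd => ?_, ?_⟩
    · rw [MvPolynomial.mem_map_C_iff] at hd ⊢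
      exact fun n => h.1 _ (by simpa using hd n)
    · have := ih _ h.2
      rwa [Ideal.map_sup, Ideal.map_span, Set.image_singleton] at this

open Polynomial in
theorem mem_map_C_iff_map_eq_zero (I : Ideal D) (q : D[X]) :
    q ∈ I.map (C : D →+* D[X]) ↔ q.map (Ideal.Quotient.mk I) = 0 := by
  rw [Ideal.mem_map_C_iff, Polynomial.ext_iff]
  simp [Ideal.Quotient.eq_zero_iff_mem]

open Polynomial in
theorem mem_map_C_sup_monic (f : D[X]) (hf : f.Monic) (I : Ideal D) (q : D[X]) :
    q ∈ I.map (C : D →+* D[X]) ⊔ Ideal.span {f} ↔ q %ₘ f ∈ I.map (C : D →+* D[X]) := by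
  constructor
  · intro h
    obtain ⟨e, he⟩ := mem_sup_span_singleton.1 h
    have h1 : q %ₘ f = (q - f * e) %ₘ f := by
      rw [sub_modByMonic, self_mul_modByMonic hf, sub_zero]
    rw [h1]
    rw [mem_map_C_iff_map_eq_zero] at he ⊢
    rw [map_modByMonic _ hf, he, zero_modByMonic]
  · intro h
    rw [mem_sup_span_singleton]
    refine ⟨q /ₘ f, ?_⟩
    have := modByMonic_add_div q f
    have h2 : q - f * (q /ₘ f) = q %ₘ f := by linear_combination -this
    rwa [h2]

open Polynomial in
/-- A monic polynomial followed by a weakly regular sequence of constants. -/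
theorem WReg.monic (f : D[X]) (hf : f.Monic) (l : List D) (I : Ideal D) (h : WReg I l) :
    WReg (I.map (C : D →+* D[X])) (f :: l.map C) := by
  refine ⟨?_, ?_⟩
  · intro q hq
    rw [mem_map_C_iff_map_eq_zero] at hq ⊢
    rw [Polynomial.map_mul] at hq
    have hm := hf.map (Ideal.Quotient.mk I)
    by_contra hne
    exact hm.mul_right_ne_zero hne (by rw [mul_comm] at hq ⊢; exact hq)
  · induction l generalizing I with
    | nil => trivial
    | cons a l ih =>
      refine ⟨fun q hq => ?_, ?_⟩
      · rw [mem_map_C_sup_monic f hf] at hq ⊢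
        have h1 : (C a * q) %ₘ f = C a * (q %ₘ f) := by
          rw [← smul_eq_C_mul, smul_modByMonic, smul_eq_C_mul]
        rw [h1] at hq
        rw [Ideal.mem_map_C_iff] at hq ⊢
        exact fun n => h.1 _ (by simpa using hq n)
      · have := ih _ h.2
        rw [Ideal.map_sup, Ideal.map_span, Set.image_singleton] at this
        convert this using 1
        ac_rfl

open Polynomial in
/-- Regularity on the affine blowup chart `D[v]/(tv-φ)`. -/
theorem WReg.blowup (t φ : D) (l : List D) (h : WReg ⊥ (t :: φ :: l)) (l' : List D[X])
    (h' : WReg ((Ideal.span {t} ⊔ Ideal.span {φ}).map (C : D →+* D[X])) l') :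
    WReg (Ideal.span {C t * X - C φ}) (C t :: l') := by
  refine ⟨?_, ?_⟩
  · intro q hq
    obtain ⟨w, hw⟩ := Ideal.mem_span_singleton'.1 hq
    have h1 : w ∈ (Ideal.span {t}).map (C : D →+* D[X]) := by
      rw [Ideal.mem_map_C_iff]
      intro n
      have h2 := h.2.1 (w.coeff n)
      rw [bot_sup_eq] at h2
      apply h2
      have h3 : C φ * w ∈ (Ideal.span {t}).map (C : D →+* D[X]) := by
        rw [Ideal.map_span, Set.image_singleton, Ideal.mem_span_singleton]
        exact ⟨X * w - q, by linear_combination -hw⟩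
      rw [Ideal.mem_map_C_iff] at h3
      simpa using h3 n
    rw [Ideal.map_span, Set.image_singleton] at h1
    obtain ⟨w', rfl⟩ := Ideal.mem_span_singleton'.1 h1
    have h4 : q - w' * (C t * X - C φ) = 0 := by
      have h5 : C t * (q - w' * (C t * X - C φ)) = 0 := by linear_combination -hw
      ext n
      have h6 := congrArg (fun r : D[X] => r.coeff n) h5
      simp only [coeff_C_mul, coeff_zero] at h6
      have h7 := h.1 _ (by rw [h6]; exact Ideal.zero_mem _)
      exact h7
    rw [sub_eq_zero.1 h4]
    exact Ideal.mul_mem_left _ _ (Ideal.mem_span_singleton_self _)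
  · convert h' using 1
    rw [Ideal.map_sup, Ideal.map_span, Ideal.map_span, Set.image_singleton, Set.image_singleton]
    apply le_antisymm
    · refine sup_le ?_ le_sup_left
      rw [Ideal.span_singleton_le_iff_mem]
      exact Ideal.sub_mem _ (Ideal.mem_sup_left (Ideal.mul_mem_right _ _ (Ideal.mem_span_singleton_self _)))
        (Ideal.mem_sup_right (Ideal.mem_span_singleton_self _))
    · refine sup_le le_sup_right ?_
      rw [Ideal.span_singleton_le_iff_mem]
      have : C φ = C t * X - (C t * X - C φ) := by ring
      have h9 := Ideal.sub_mem (Ideal.span {C t * X - C φ} ⊔ Ideal.span {C t}) (Ideal.mem_sup_right (Ideal.mul_mem_right _ _ (Ideal.mem_span_singleton_self _)) : C t * X ∈ _)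
        (Ideal.mem_sup_left (Ideal.mem_span_singleton_self _))
      rwa [← this] at h9

theorem mem_ofList_map {K : Type*} [CommRing K] (f : D → K) (l : List D) (y : K) :
    y ∈ Ideal.ofList (l.map f) ↔ ∃ c : Fin l.length → K, y = ∑ i, f (l.get i) * c i := by
  induction l generalizing y with
  | nil => simp [Ideal.ofList]
  | cons a l ih =>
    rw [List.map_cons, Ideal.ofList_cons, sup_comm, mem_sup_span_singleton]
    constructor
    · rintro ⟨e, he⟩
      obtain ⟨c, hc⟩ := (ih _).1 he
      refine ⟨Fin.cons e c, ?_⟩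
      erw [Fin.sum_univ_succ]
      simp only [List.get_cons_zero, Fin.cons_zero, List.get_cons_succ', Fin.cons_succ]
      linear_combination hc
    · rintro ⟨c, hc⟩
      refine ⟨c ⟨0, by simp⟩, (ih _).2 ⟨fun i => c i.succ, ?_⟩⟩
      rw [hc]
      erw [Fin.sum_univ_succ]
      simp only [List.get_cons_zero, List.get_cons_succ']
      rw [add_comm, add_sub_assoc]
      simp

/-- Weak regularity passes to the perfect closure. -/
theorem WReg.perfectClosure {K L : Type*} [CommRing K] [CommRing L] (p : ℕ) [Fact p.Prime]
    [CharP K p] [CharP L p] [PerfectRing L p] (f : K →+* L) [IsPRadical f p]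
    (l : List K) (h : WReg ⊥ l) : WReg ⊥ (l.map f) := by
  have : ExpChar K p := ExpChar.prime Fact.out
  have : ExpChar L p := ExpChar.prime Fact.out
  rw [WReg.iff]
  intro m1 b m2 hm d hd
  obtain ⟨l1, l2', rfl, rfl, hm'⟩ := List.map_eq_append_iff.1 hm
  obtain ⟨a, l2, rfl, rfl, rfl⟩ := List.map_eq_cons_iff.1 hm'
  rw [bot_sup_eq, mem_ofList_map] at hd ⊢
  obtain ⟨c, hc⟩ := hd
  -- common exponent
  have hex : ∀ y : L, ∃ m, ∀ m' ≥ m, ∃ x : K, f x = y ^ p ^ m' := by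
    intro y
    obtain ⟨n, x, hx⟩ := IsPRadical.pow_mem f p y
    refine ⟨n, fun m' hm' => ⟨x ^ p ^ (m' - n), ?_⟩⟩
    rw [map_pow, hx, ← pow_mul, ← pow_add, Nat.add_sub_cancel' hm']
  obtain ⟨m0, hm0⟩ := hex d
  choose mc hmc using fun i => hex (c i)
  set m := m0 + ∑ i, mc i
  obtain ⟨x, hx⟩ := hm0 m (by simp [m])
  have : ∀ i, mc i ≤ m := fun i => by
    have := Finset.single_le_sum (f := mc) (fun i _ => Nat.zero_le _) (Finset.mem_univ i)
    omega
  choose y hy using fun i => hmc i m (this i)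
  have h1 : f (a ^ p ^ m * x - ∑ i, (l1.get i) ^ p ^ m * y i) = 0 := by
    rw [map_sub, map_mul, map_pow, map_sum, hx, ← mul_pow, hc, sum_pow_char_pow, sub_eq_zero]
    exact Finset.sum_congr rfl fun i _ => by rw [map_mul, map_pow, hy, mul_pow]
  have h2 := IsPRadical.ker_le f p ((RingHom.mem_ker).2 h1)
  obtain ⟨k, hk⟩ := (mem_pNilradical).1 h2
  rw [sub_pow_char_pow, sum_pow_char_pow, sub_eq_zero, mul_pow] at hk
  have hq := WReg.pow (p ^ (m + k)) _ _ h
  rw [WReg.iff] at hq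
  have h3 := hq (l1.map (· ^ (p ^ (m + k)))) (a ^ (p ^ (m + k))) (l2.map (· ^ (p ^ (m + k))))
    (by simp) (x ^ p ^ k)
  rw [bot_sup_eq, mem_ofList_map, mem_ofList_map] at h3
  obtain ⟨e, he⟩ := h3 ⟨fun i => y i ^ p ^ k, by
    rw [pow_add, pow_mul, hk]
    exact Finset.sum_congr rfl fun i _ => by rw [mul_pow, ← pow_mul]⟩
  choose e' he' using fun i => (iterateFrobeniusEquiv L p (m + k)).surjective (f (e i))
  refine ⟨e', ?_⟩
  apply (iterateFrobeniusEquiv L p (m + k)).injective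
  rw [map_sum]
  simp only [map_mul, he']
  simp only [iterateFrobeniusEquiv_apply, iterateFrobenius_def]
  have h4 := congrArg f he
  rw [map_pow, hx, ← pow_mul, ← pow_add, map_sum] at h4
  rw [h4]
  exact Finset.sum_congr rfl fun i _ => by rw [map_mul, map_pow]

theorem WReg.congr_bot {I : Ideal D} (l : List D) (h : WReg I l) (hI : I = ⊥) : WReg ⊥ l := hI ▸ h

end WReg
end Part_REG1

section Part_KEY1
set_option maxHeartbeats 1000000
set_option synthInstance.maxHeartbeats 400000
set_option linter.unusedSectionVars false
universe u

section Key
variable (p : ℕ) [Fact p.Prime]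

theorem charP_of_hom {D Q : Type*} [CommRing D] [CommRing Q] [CharP D p] [Nontrivial Q]
    (f : D →+* Q) : CharP Q p := by
  obtain ⟨q, hq⟩ := CharP.exists Q
  have h1 : q ∣ p := by
    rw [← CharP.cast_eq_zero_iff Q q, ← map_natCast f, CharP.cast_eq_zero, map_zero]
  rcases (Nat.dvd_prime Fact.out).1 h1 with rfl | rfl
  · have h2 := CharP.cast_eq_zero Q 1
    rw [Nat.cast_one] at h2
    exact absurd h2 one_ne_zero
  · exact hq

open Polynomial in
theorem blow_step {D : Type u} [CommRing D] [CharP D p] [PerfectRing D p] (t : D)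
    {E : Type u} [CommRing E] [CharP E p] [PerfectRing E p] (tE : E)
    (ψ : D →+* E) (hψ : ψ t = tE) (φ : D) (h : SS p D t)
    (hφ : SS.res p D t h = Ideal.Quotient.mk _ φ)
    (hE : (p : SS p E tE) ∣ SS.map p t tE ψ hψ h)
    {κ : Type*} (L : κ → List D) (hL : ∀ k, WReg ⊥ (t :: φ :: L k)) :
    ∃ (D' : Type u) (_ : CommRing D') (_ : CharP D' p) (_ : PerfectRing D' p)
      (i : D →+* D') (ψ' : D' →+* E) (_ : ψ'.comp i = ψ) (φ' : D') (h' : SS p D' (i t)),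
      SS.map p t (i t) i rfl h = p * h' ∧ SS.res p D' (i t) h' = Ideal.Quotient.mk _ φ' ∧
      (∀ k, WReg ⊥ (i t :: φ' :: (L k).map i)) ∧ (∀ k, WReg ⊥ (i t :: (L k).map i)) := by
  have : Nontrivial E := CharP.nontrivial_of_char_ne_one (v := p) (Fact.out : p.Prime).ne_one
  obtain ⟨vE, hvE⟩ : ∃ vE, vE * tE = ψ φ := by
    have h1 := (SS.res_eq_zero p E tE _).2 hE
    rw [SS.res_map p t tE ψ hψ h φ hφ, Ideal.Quotient.eq_zero_iff_mem] at h1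
    exact Ideal.mem_span_singleton'.1 h1
  obtain ⟨c0, hc0⟩ : ∃ c0, h - SS.sharp p D t φ = p * c0 := by
    refine (SS.res_eq_zero p D t _).1 ?_
    rw [map_sub, hφ, SS.res_sharp, sub_self]
  obtain ⟨cb, hcb⟩ := Ideal.Quotient.mk_surjective (SS.res p D t c0)
  set I : Ideal D[X] := Ideal.span {C t * X - C φ} with hI
  let Q := D[X] ⧸ I
  let ψQ : Q →+* E := Ideal.Quotient.lift I (Polynomial.eval₂RingHom ψ vE) (by
    intro a ha
    obtain ⟨b, rfl⟩ := Ideal.mem_span_singleton'.1 ha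
    rw [map_mul]
    have : (eval₂RingHom ψ vE) (C t * X - C φ) = 0 := by
      rw [map_sub, map_mul, coe_eval₂RingHom, eval₂_C, eval₂_X, eval₂_C, hψ, ← hvE]
      ring
    rw [this, mul_zero])
  have : Nontrivial Q := ψQ.domain_nontrivial
  let iQ : D →+* Q := (Ideal.Quotient.mk I).comp C
  have : CharP Q p := charP_of_hom p iQ
  let D' := PerfectClosure Q p
  let f : Q →+* D' := PerfectClosure.of Q p
  let i : D →+* D' := f.comp iQ
  let ψ' : D' →+* E := PerfectClosure.lift Q p E ψQ
  have hψ' : ∀ q, ψ' (f q) = ψQ q := fun q => by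
    have := (PerfectClosure.lift Q p E).symm_apply_apply ψQ
    exact RingHom.congr_fun this q
  have : IsPRadical f p := PerfectClosure.isPRadical Q p
  have hcomp : ψ'.comp i = ψ := by
    ext d
    simp only [RingHom.comp_apply, i, hψ', iQ]
    change eval₂ ψ vE (C d) = ψ d
    rw [eval₂_C]
  let v : D' := f (Ideal.Quotient.mk I X)
  have htv : i φ = i t * v := by
    simp only [i, v, RingHom.comp_apply, iQ]
    rw [← map_mul, ← map_mul]
    congr 1
    rw [eq_comm, Ideal.Quotient.eq]
    exact Ideal.mem_span_singleton_self _
  let φ' : D' := f (Ideal.Quotient.mk I (X + C cb))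
  refine ⟨D', inferInstance, inferInstance, inferInstance, i, ψ', hcomp, φ',
    SS.sharp p D' (i t) v + SS.map p t (i t) i rfl c0, ?_, ?_, ?_, ?_⟩
  · have h1 := congrArg (SS.map p t (i t) i rfl) hc0
    rw [map_sub, map_mul, map_natCast, SS.map_sharp, htv, map_mul, SS.sharp_t] at h1
    linear_combination h1
  · rw [map_add, SS.res_sharp, SS.res_map p t (i t) i rfl c0 cb hcb.symm, ← map_add]
    simp only [φ', v, i, iQ, RingHom.comp_apply, map_add]
  · intro k
    have h2 := (hL k).2.2
    rw [bot_sup_eq] at h2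
    have h3 := WReg.blowup t φ (L k) (hL k) _ (WReg.monic (X + C cb) (monic_X_add_C cb) _ _ h2)
    have h4 := WReg.of_surjective (Ideal.Quotient.mk I) Ideal.Quotient.mk_surjective _ ⊥
      (by rw [← RingHom.ker_eq_comap_bot, Ideal.mk_ker]; exact h3)
    have h5 := WReg.perfectClosure p f _ h4
    simpa [i, iQ, φ', Function.comp_def] using h5
  · intro k
    have h2 := (hL k).2.2
    rw [bot_sup_eq] at h2
    have h3 := WReg.blowup t φ (L k) (hL k) _ (WReg.polyC _ _ h2)
    have h4 := WReg.of_surjective (Ideal.Quotient.mk I) Ideal.Quotient.mk_surjective _ ⊥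
      (by rw [← RingHom.ker_eq_comap_bot, Ideal.mk_ker]; exact h3)
    have h5 := WReg.perfectClosure p f _ h4
    simpa [i, iQ, φ', Function.comp_def] using h5

theorem key_lemma {E : Type u} [CommRing E] [CharP E p] [PerfectRing E p] (tE : E)
    (htE : ∀ d : E, tE * d = 0 → d = 0) {κ : Type*} (N : ℕ) :
    ∀ {D : Type u} [CommRing D] [CharP D p] [PerfectRing D p] (t : D)
    (ψ : D →+* E) (hψ : ψ t = tE) (φ : D) (h : SS p D t)
    (_ : SS.res p D t h = Ideal.Quotient.mk _ φ)
    (_ : (p : SS p E tE) ^ N ∣ SS.map p t tE ψ hψ h)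
    (L : κ → List D) (_ : ∀ k, WReg ⊥ (t :: φ :: L k)) (_ : ∀ k, WReg ⊥ (t :: L k)),
    ∃ (D' : Type u) (_ : CommRing D') (_ : CharP D' p) (_ : PerfectRing D' p)
      (i : D →+* D') (ψ' : D' →+* E), ψ'.comp i = ψ ∧
      (p : SS p D' (i t)) ^ N ∣ SS.map p t (i t) i rfl h ∧
      (∀ k, WReg ⊥ (i t :: (L k).map i)) := by
  induction N with
  | zero =>
    intro D _ _ _ t ψ hψ φ h hφ hE L hL hL'
    refine ⟨D, inferInstance, inferInstance, inferInstance, RingHom.id D, ψ, by simp, by simp, ?_⟩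
    simpa using hL'
  | succ N ih =>
    intro D _ _ _ t ψ hψ φ h hφ hE L hL hL'
    obtain ⟨D', _, _, _, i, ψ', hc, φ', h', hh', hφ', hL1, hL2⟩ := blow_step p t tE ψ hψ φ h hφ
      ((dvd_pow_self _ (Nat.succ_ne_zero N)).trans hE) L hL
    have hψ' : ψ' (i t) = tE := by rw [← RingHom.comp_apply, hc, hψ]
    subst hc
    obtain ⟨w, hw⟩ := hE
    obtain ⟨D'', _, _, _, j, ψ'', hc2, hd, hL3⟩ := ih (i t) ψ' hψ' φ' h' hφ' (by
      refine ⟨w, ?_⟩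
      apply sub_eq_zero.1
      apply SS.p_reg p E tE htE
      have h1 := SS.map_comp p t (i t) tE i rfl ψ' hψ' h
      rw [hw, hh', map_mul, map_natCast] at h1
      linear_combination h1) (fun k => (L k).map i) hL1 hL2
    refine ⟨D'', inferInstance, inferInstance, inferInstance, j.comp i, ψ'', ?_, ?_, ?_⟩
    · rw [← RingHom.comp_assoc, hc2]
    · have h1 := SS.map_comp p t (i t) (j (i t)) i rfl j rfl h
      rw [hh', map_mul, map_natCast] at h1
      change _ ∣ SS.map p t (j (i t)) (j.comp i) rfl h
      rw [← h1, pow_succ']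
      exact mul_dvd_mul_left _ hd
    · simpa using hL3

end Key
end Part_KEY1

section Part_PN1
set_option maxHeartbeats 1000000
set_option synthInstance.maxHeartbeats 400000
set_option linter.unusedSectionVars false
universe u

section PN
variable (p : ℕ) [Fact p.Prime]

/-- `S(D)/p^N`. -/
abbrev SN (D : Type u) [CommRing D] (t : D) (N : ℕ) : Type u :=
  SS p D t ⧸ Ideal.span {(p : SS p D t) ^ N}

variable {D D' E : Type u} [CommRing D] [CharP D p] [PerfectRing D p]
  [CommRing D'] [CharP D' p] [PerfectRing D' p] [CommRing E] [CharP E p] [PerfectRing E p]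

noncomputable def SN.map (t : D) (t' : D') (f : D →+* D') (hf : f t = t') (N : ℕ) :
    SN p D t N →+* SN p D' t' N :=
  Ideal.quotientMap _ (SS.map p t t' f hf) (by
    rw [Ideal.span_singleton_le_iff_mem, Ideal.mem_comap, map_pow, map_natCast]
    exact Ideal.mem_span_singleton_self _)

theorem SN.map_mk (t : D) (t' : D') (f : D →+* D') (hf : f t = t') (N : ℕ) (s : SS p D t) :
    SN.map p t t' f hf N (Ideal.Quotient.mk _ s) = Ideal.Quotient.mk _ (SS.map p t t' f hf s) := rfl

theorem SN.mk_eq_zero (t : D) (N : ℕ) (s : SS p D t) :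
    (Ideal.Quotient.mk _ s : SN p D t N) = 0 ↔ (p : SS p D t) ^ N ∣ s := by
  rw [Ideal.Quotient.eq_zero_iff_mem, Ideal.mem_span_singleton]

theorem SN.map_comp (t : D) (t' : D') (tE : E) (f : D →+* D') (hf : f t = t') (g : D' →+* E)
    (hg : g t' = tE) (N : ℕ) (s : SN p D t N) (hgf) :
    SN.map p t' tE g hg N (SN.map p t t' f hf N s) = SN.map p t tE (g.comp f) hgf N s := by
  obtain ⟨s, rfl⟩ := Ideal.Quotient.mk_surjective s
  rw [SN.map_mk, SN.map_mk, SN.map_mk, SS.map_comp]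

/-- The lifting predicate (without root of `g`). -/
def PN0 (N : ℕ) (tE : E) {B : Type u} [CommRing B] (ι : B →+* SN p E tE N) (g : B)
    {m : ℕ} (x : Fin m → B) : Prop :=
  ∃ (D : Type u) (_ : CommRing D) (_ : CharP D p) (_ : PerfectRing D p) (t : D) (ψ : D →+* E)
    (hψ : ψ t = tE) (β : B →+* SN p D t N),
    (∀ b, SN.map p t tE ψ hψ N (β b) = ι b) ∧
    (∃ s γ, β g = Ideal.Quotient.mk _ s ∧ SS.res p D t s = Ideal.Quotient.mk _ γ ∧ WReg ⊥ [t, γ]) ∧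
    ∃ ξ : Fin m → D, (∀ k, ∃ s, β (x k) = Ideal.Quotient.mk _ s ∧
      SS.res p D t s = Ideal.Quotient.mk _ (ξ k)) ∧ WReg ⊥ (t :: List.ofFn ξ)

/-- The lifting predicate. -/
def PN (N : ℕ) (tE γE : E) {B : Type u} [CommRing B] (ι : B →+* SN p E tE N) (g : B)
    {m : ℕ} (x : Fin m → B) : Prop :=
  ∃ (D : Type u) (_ : CommRing D) (_ : CharP D p) (_ : PerfectRing D p) (t : D) (ψ : D →+* E)
    (hψ : ψ t = tE) (β : B →+* SN p D t N),
    (∀ b, SN.map p t tE ψ hψ N (β b) = ι b) ∧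
    (∃ γ, ψ γ = γE ∧ β g = Ideal.Quotient.mk _ (SS.sharp p D t γ) ∧ WReg ⊥ [t, γ]) ∧
    ∃ ξ : Fin m → D, (∀ k, ∃ s, β (x k) = Ideal.Quotient.mk _ s ∧
      SS.res p D t s = Ideal.Quotient.mk _ (ξ k)) ∧ WReg ⊥ (t :: List.ofFn ξ)

open Polynomial in
theorem PN.of_PN0 (N : ℕ) (tE γE : E) (htE : ∀ d : E, tE * d = 0 → d = 0)
    {B : Type u} [CommRing B] (ι : B →+* SN p E tE N) (g : B)
    {m : ℕ} (x : Fin m → B) (h : PN0 p N tE ι g x)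
    (hg : ι g = Ideal.Quotient.mk _ (SS.sharp p E tE γE)) : PN p N tE γE ι g x := by
  obtain ⟨D, _, _, _, t, ψ, hψ, β, hβ, ⟨sg, gb, hsg, hgb, hreg⟩, ξ, hξ, hξr⟩ := h
  have : Nontrivial D := CharP.nontrivial_of_char_ne_one (v := p) (Fact.out : p.Prime).ne_one
  have : CharP D[X] p := charP_of_hom p C
  let f := PerfectClosure.of D[X] p
  have : IsPRadical f p := PerfectClosure.isPRadical _ p
  let j : D →+* PerfectClosure D[X] p := f.comp C
  let ψ0 := PerfectClosure.lift D[X] p E (eval₂RingHom ψ γE)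
  have hψ0 : ∀ q, ψ0 (f q) = eval₂ ψ γE q := fun q => by
    have := (PerfectClosure.lift D[X] p E).symm_apply_apply (eval₂RingHom ψ γE)
    exact RingHom.congr_fun this q
  have hpsiJ : ψ0.comp j = ψ := by
    ext d
    rw [RingHom.comp_apply, RingHom.comp_apply, hψ0, eval₂_C]
  have hpsiT : ψ0 (j t) = tE := by rw [← RingHom.comp_apply, hpsiJ, hψ]
  let L : Bool → List D[X] := fun b => cond b (X :: []) (List.ofFn (fun k => C (ξ k)))
  have hX : WReg ⊥ (C t :: (X - C gb) :: X :: []) := by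
    refine ⟨?_, ?_⟩
    · have := (WReg.polyC _ _ hreg).1
      rwa [Ideal.map_bot] at this
    · have h1 : (⊥ ⊔ Ideal.span {C t} : Ideal D[X]) = (Ideal.span {t}).map C := by
        rw [Ideal.map_span, Set.image_singleton, bot_sup_eq]
      rw [h1]
      refine ⟨(WReg.monic (X - C gb) (monic_X_sub_C gb) [] (Ideal.span {t}) trivial).1, ?_, trivial⟩
      intro q hq
      rw [mem_map_C_sup_monic _ (monic_X_sub_C gb)] at hq ⊢
      rw [modByMonic_X_sub_C_eq_C_eval] at hq ⊢
      rw [Ideal.mem_map_C_iff] at hq ⊢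
      have h2 := hq 0
      rw [coeff_C_zero, eval_mul, eval_X] at h2
      have h3 := hreg.2.1 _ (by rw [bot_sup_eq]; exact h2)
      rw [bot_sup_eq] at h3
      intro n
      rw [coeff_C]
      split_ifs
      · exact h3
      · exact Ideal.zero_mem _
  have hX' : WReg ⊥ (C t :: X :: []) := by
    refine ⟨hX.1, ?_⟩
    have h1 : (⊥ ⊔ Ideal.span {C t} : Ideal D[X]) = (Ideal.span {t}).map C := by
        rw [Ideal.map_span, Set.image_singleton, bot_sup_eq]
    rw [h1]
    exact WReg.monic X monic_X [] _ trivial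
  have hξ1 : WReg ⊥ (C t :: (X - C gb) :: List.ofFn (fun k => C (ξ k))) := by
    refine ⟨hX.1, ?_⟩
    have h1 : (⊥ ⊔ Ideal.span {C t} : Ideal D[X]) = (Ideal.span {t}).map C := by
        rw [Ideal.map_span, Set.image_singleton, bot_sup_eq]
    rw [h1]
    have h2 := hξr.2
    rw [bot_sup_eq] at h2
    have h3 := WReg.monic (X - C gb) (monic_X_sub_C gb) _ _ h2
    rw [List.map_ofFn] at h3
    exact h3
  have hξ2 : WReg ⊥ (C t :: List.ofFn (fun k => C (ξ k))) := by
    have h3 := WReg.polyC _ _ hξr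
    rw [Ideal.map_bot, List.map_cons, List.map_ofFn] at h3
    exact h3
  obtain ⟨D', _, _, _, i, ψ', hc, hd, hL⟩ := key_lemma p tE htE N (j t) ψ0 hpsiT
    (f (X - C gb)) (SS.sharp p _ (j t) (f X) - SS.map p t (j t) j rfl sg) (by
      rw [map_sub, SS.res_sharp, SS.res_map p t (j t) j rfl sg gb hgb, ← map_sub, map_sub f]; rfl)
    (by
      rw [map_sub, SS.map_sharp, SS.map_comp, hψ0, eval₂_X, ← SN.mk_eq_zero, map_sub, ← hg, ← hβ,
        hsg, SN.map_mk, sub_eq_zero]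
      simp only [hpsiJ])
    (fun b => (L b).map f) (by
      intro k
      cases k
      · exact WReg.perfectClosure p f _ hξ1
      · exact WReg.perfectClosure p f _ hX) (by
      intro k
      cases k
      · exact WReg.perfectClosure p f _ hξ2
      · exact WReg.perfectClosure p f _ hX')
  have hψ't : ψ' (i (j t)) = tE := by rw [← hpsiT, ← hc]; rfl
  refine ⟨D', inferInstance, inferInstance, inferInstance, i (j t), ψ', hψ't,
    (SN.map p t (i (j t)) (i.comp j) rfl N).comp β, ?_, ⟨i (f X), ?_, ?_, ?_⟩,
    fun k => i (j (ξ k)), ?_, ?_⟩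
  · intro b
    change SN.map p (i (j t)) tE ψ' hψ't N (SN.map p t (i (j t)) (i.comp j) rfl N (β b)) = _
    rw [SN.map_comp p _ _ _ _ _ _ _ _ _ (by
      rw [← RingHom.comp_assoc, hc, hpsiJ, hψ]), ← hβ]
    simp only [← RingHom.comp_assoc, hc, hpsiJ]
  · rw [← RingHom.comp_apply, hc, hψ0, eval₂_X]
  · rw [← SN.mk_eq_zero] at hd
    rw [map_sub, map_sub, SS.map_sharp, SS.map_comp, sub_eq_zero] at hd
    rw [hd]
    change SN.map p t (i (j t)) (i.comp j) rfl N (β g) = _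
    rw [hsg]
    rfl
  · exact hL true
  · intro k
    obtain ⟨s, hs, hs'⟩ := hξ k
    refine ⟨SS.map p t (i (j t)) (i.comp j) rfl s, ?_, ?_⟩
    · change SN.map p t (i (j t)) (i.comp j) rfl N (β (x k)) = _
      rw [hs]; rfl
    · exact SS.res_map p t (i (j t)) (i.comp j) rfl s (ξ k) hs'
  · have := hL false
    simp only [L, cond_false, List.map_ofFn] at this
    exact this

end PN
end Part_PN1

section Part_PN2
set_option maxHeartbeats 1000000
set_option synthInstance.maxHeartbeats 400000
set_option linter.unusedSectionVars false
universe u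

section PN
variable (p : ℕ) [Fact p.Prime]

open Polynomial in
theorem PN.adjoinRoot {E : Type u} [CommRing E] [CharP E p] [PerfectRing E p]
    (N : ℕ) (tE γE : E) (htE : ∀ d : E, tE * d = 0 → d = 0)
    {B : Type u} [CommRing B] (g : B) {m : ℕ} (x : Fin m → B) (F : B[X]) (hF : F.Monic)
    (ι' : AdjoinRoot F →+* SN p E tE N)
    (h : PN p N tE γE (ι'.comp (AdjoinRoot.of F)) g x) :
    PN p N tE γE ι' (AdjoinRoot.of F g) (fun k => AdjoinRoot.of F (x k)) := by
  obtain ⟨D, _, _, _, t, ψ, hψ, β, hβ, ⟨γ, hγ, hβγ, hreg⟩, ξ, hξ, hξr⟩ := h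
  have : Nontrivial D := CharP.nontrivial_of_char_ne_one (v := p) (Fact.out : p.Prime).ne_one
  have : CharP (MvPolynomial ℕ D[X]) p :=
    charP_of_hom p ((MvPolynomial.C : D[X] →+* MvPolynomial ℕ D[X]).comp C)
  let f := PerfectClosure.of (MvPolynomial ℕ D[X]) p
  have : IsPRadical f p := PerfectClosure.isPRadical _ p
  let D0 := PerfectClosure (MvPolynomial ℕ D[X]) p
  let f1 : D[X] →+* D0 := f.comp MvPolynomial.C
  let j : D →+* D0 := f1.comp C
  -- the element z
  obtain ⟨zs, hzs⟩ := Ideal.Quotient.mk_surjective (ι' (AdjoinRoot.root F))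
  obtain ⟨w, hw⟩ := Ideal.Quotient.mk_surjective zs
  let ψ2 : MvPolynomial ℕ D[X] →+* E :=
    MvPolynomial.eval₂Hom (eval₂RingHom ψ (w.coeff 0)) (fun n => w.coeff n)
  let ψ0 : D0 →+* E := PerfectClosure.lift (MvPolynomial ℕ D[X]) p E ψ2
  have hψ0 : ∀ q, ψ0 (f q) = ψ2 q := fun q => by
    have := (PerfectClosure.lift (MvPolynomial ℕ D[X]) p E).symm_apply_apply ψ2
    exact RingHom.congr_fun this q
  have hψ01 : ∀ q, ψ0 (f1 q) = eval₂ ψ (w.coeff 0) q := fun q => by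
    change ψ0 (f _) = _
    rw [hψ0]
    simp [ψ2]
  have hpsiJ : ψ0.comp j = ψ := by
    ext d
    change ψ0 (f1 (C d)) = _
    rw [hψ01, eval₂_C]
  have hpsiT : ψ0 (j t) = tE := by rw [← RingHom.comp_apply, hpsiJ, hψ]
  let ω : WittVector p D0 := WittVector.mk p (fun n => if n = 0 then f1 X else f (MvPolynomial.X n))
  have hω0 : ω.coeff 0 = f1 X := by simp [ω]
  have hω : WittVector.map ψ0 ω = w := by
    ext n
    rw [WittVector.map_coeff]
    by_cases hn : n = 0
    · subst hn; rw [hω0, hψ01, eval₂_X]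
    · simp only [ω, WittVector.coeff_mk, if_neg hn]
      rw [hψ0]; simp [ψ2]
  -- lifts of F
  obtain ⟨Ft, hFt, -, hFtm⟩ := lifts_and_natDegree_eq_and_monic (f := Ideal.Quotient.mk _)
    (p := F.map β) ((mem_lifts _).2 (map_surjective _ Ideal.Quotient.mk_surjective _)) (hF.map β)
  obtain ⟨Fb, hFb, -, hFbm⟩ := lifts_and_natDegree_eq_and_monic
    (f := Ideal.Quotient.mk (Ideal.span {t}))
    (p := Ft.map (SS.res p D t)) ((mem_lifts _).2 (map_surjective _ Ideal.Quotient.mk_surjective _))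
    (hFtm.map _)
  let mω : SS p D0 (j t) := Ideal.Quotient.mk _ ω
  let h0 : SS p D0 (j t) := Ft.eval₂ (SS.map p t (j t) j rfl) mω
  have hres : SS.res p D0 (j t) h0 = Ideal.Quotient.mk _ (f1 Fb) := by
    let q : D ⧸ Ideal.span {t} →+* D0 ⧸ Ideal.span {j t} := Ideal.quotientMap _ j (by
      rw [Ideal.span_singleton_le_iff_mem]
      exact Ideal.mem_span_singleton_self _)
    have hq : (SS.res p D0 (j t)).comp (SS.map p t (j t) j rfl) = q.comp (SS.res p D t) := by
      refine RingHom.ext fun s => ?_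
      obtain ⟨d, hd⟩ := Ideal.Quotient.mk_surjective (SS.res p D t s)
      change SS.res p D0 (j t) (SS.map p t (j t) j rfl s) = q (SS.res p D t s)
      rw [SS.res_map p t (j t) j rfl s d hd.symm, ← hd]
      rfl
    rw [show SS.res p D0 (j t) h0 = _ from Polynomial.hom_eval₂ _ _ _ _, hq, ← eval₂_map, ← hFb,
      eval₂_map]
    have : q.comp (Ideal.Quotient.mk (Ideal.span {t})) = (Ideal.Quotient.mk (Ideal.span {j t})).comp j := rfl
    rw [this]
    have h2 : SS.res p D0 (j t) mω = Ideal.Quotient.mk (Ideal.span {j t}) (f1 X) := by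
      rw [← hω0]; rfl
    rw [h2, ← Polynomial.hom_eval₂]
    congr 1
    have h3 : j = f1.comp C := rfl
    rw [h3, ← Polynomial.hom_eval₂, eval₂_C_X]
  have hred : ∀ (D' : Type u) [CommRing D'] [CharP D' p] [PerfectRing D' p] (t' : D') (i : D →+* D')
      (hi : i t = t') (y : SS p D' t'),
      (Ideal.Quotient.mk _ (Ft.eval₂ (SS.map p t t' i hi) y) : SN p D' t' N) =
        F.eval₂ ((SN.map p t t' i hi N).comp β) (Ideal.Quotient.mk _ y) := by
    intro D' _ _ _ t' i hi y
    rw [Polynomial.hom_eval₂]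
    have h5 : (Ideal.Quotient.mk (Ideal.span {(p : SS p D' t') ^ N})).comp (SS.map p t t' i hi) =
      (SN.map p t t' i hi N).comp (Ideal.Quotient.mk (Ideal.span {(p : SS p D t) ^ N})) := rfl
    rw [h5, ← eval₂_map, hFt, eval₂_map]
  have hdvd : (p : SS p E tE) ^ N ∣ SS.map p (j t) tE ψ0 hpsiT h0 := by
    rw [← SN.mk_eq_zero]
    have h1 : SS.map p (j t) tE ψ0 hpsiT h0 = Ft.eval₂ (SS.map p t tE ψ hψ) zs := by
      rw [show SS.map p (j t) tE ψ0 hpsiT h0 = _ from Polynomial.hom_eval₂ _ _ _ _]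
      have h2 : (SS.map p (j t) tE ψ0 hpsiT).comp (SS.map p t (j t) j rfl) = SS.map p t tE ψ hψ := by
        refine RingHom.ext fun s => ?_
        change SS.map p (j t) tE ψ0 hpsiT (SS.map p t (j t) j rfl s) = _
        rw [SS.map_comp]
        simp only [hpsiJ]
      have h3 : SS.map p (j t) tE ψ0 hpsiT mω = zs := by
        rw [← hw, ← hω]; rfl
      rw [h2, h3]
    rw [h1, hred, hzs]
    have h4 : (SN.map p t tE ψ hψ N).comp β = ι'.comp (AdjoinRoot.of F) := by
      ext b; exact hβ b
    rw [h4, ← Polynomial.hom_eval₂, AdjoinRoot.eval₂_root, map_zero]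
  -- regularity
  let L : Bool → List D := fun b => cond b (γ :: []) (List.ofFn ξ)
  have hL0 : ∀ b, WReg ⊥ (t :: L b) := by
    intro b
    cases b
    · exact hξr
    · exact hreg
  have hL2 : ∀ b, WReg ⊥ (j t :: (L b).map j) := by
    intro b
    have h1 := WReg.polyC _ _ (hL0 b)
    have h2 := WReg.mvC (σ := ℕ) _ _ h1
    rw [Ideal.map_bot, Ideal.map_bot] at h2
    have h3 := WReg.perfectClosure p f _ h2
    simpa [j, f1, Function.comp_def] using h3
  have hL1 : ∀ b, WReg ⊥ (j t :: f1 Fb :: (L b).map j) := by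
    intro b
    have h1 : WReg ⊥ (C t :: Fb :: (L b).map C) := by
      refine ⟨?_, ?_⟩
      · have := (WReg.polyC _ _ (hL0 b)).1
        rwa [Ideal.map_bot] at this
      · have h1 : (⊥ ⊔ Ideal.span {C t} : Ideal D[X]) = (Ideal.span {t}).map C := by
          rw [Ideal.map_span, Set.image_singleton, bot_sup_eq]
        rw [h1]
        have h2 := (hL0 b).2
        rw [bot_sup_eq] at h2
        exact WReg.monic Fb hFbm _ _ h2
    have h2 := WReg.mvC (σ := ℕ) _ _ h1
    rw [Ideal.map_bot] at h2
    have h3 := WReg.perfectClosure p f _ h2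
    simpa [j, f1, Function.comp_def] using h3
  obtain ⟨D', _, _, _, i, ψ', hc, hd, hL⟩ := key_lemma p tE htE N (j t) ψ0 hpsiT
    (f1 Fb) h0 hres hdvd (fun b => (L b).map j) hL1 hL2
  have hψ't : ψ' (i (j t)) = tE := by rw [← hpsiT, ← hc]; rfl
  let y : SS p D' (i (j t)) := SS.map p (j t) (i (j t)) i rfl mω
  let b1 : B →+* SN p D' (i (j t)) N := (SN.map p t (i (j t)) (i.comp j) rfl N).comp β
  have hy : F.eval₂ b1 (Ideal.Quotient.mk _ y) = 0 := by
    rw [← hred, SN.mk_eq_zero]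
    convert hd using 1
    rw [show SS.map p (j t) (i (j t)) i rfl h0 = _ from Polynomial.hom_eval₂ _ _ _ _]
    congr 1
    refine RingHom.ext fun s => ?_
    change _ = SS.map p (j t) (i (j t)) i rfl (SS.map p t (j t) j rfl s)
    rw [SS.map_comp]
  have hlift : ∀ b, AdjoinRoot.lift b1 (Ideal.Quotient.mk _ y) hy (AdjoinRoot.of F b) =
      SN.map p t (i (j t)) (i.comp j) rfl N (β b) := fun b => by
    rw [AdjoinRoot.lift_of]; rfl
  refine ⟨D', inferInstance, inferInstance, inferInstance, i (j t), ψ', hψ't,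
    AdjoinRoot.lift b1 (Ideal.Quotient.mk _ y) hy, ?_, ⟨i (j γ), ?_, ?_, ?_⟩,
    fun k => i (j (ξ k)), ?_, ?_⟩
  · intro b
    have : (SN.map p (i (j t)) tE ψ' hψ't N).comp (AdjoinRoot.lift b1 (Ideal.Quotient.mk _ y) hy) = ι' := by
      apply AdjoinRoot.ringHom_ext
      · ext b
        rw [RingHom.comp_apply, RingHom.comp_apply, hlift, SN.map_comp p _ _ _ _ _ _ _ _ _ (by
          rw [← RingHom.comp_assoc, hc, hpsiJ, hψ]), ← hβ]
        simp only [← RingHom.comp_assoc, hc, hpsiJ]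
      · rw [RingHom.comp_apply, AdjoinRoot.lift_root, SN.map_mk, ← hzs]
        congr 1
        change SS.map p _ _ ψ' _ (SS.map p (j t) (i (j t)) i rfl mω) = _
        rw [SS.map_comp, ← hw, ← hω]
        simp only [hc]
        rfl
    exact RingHom.congr_fun this b
  · rw [← hγ, ← hpsiJ, ← hc]; rfl
  · rw [hlift, hβγ, SN.map_mk, SS.map_sharp]; rfl
  · have := hL true
    exact this
  · intro k
    obtain ⟨s, hs, hs'⟩ := hξ k
    refine ⟨SS.map p t (i (j t)) (i.comp j) rfl s, ?_, ?_⟩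
    · rw [hlift, hs]; rfl
    · exact SS.res_map p t (i (j t)) (i.comp j) rfl s (ξ k) hs'
  · have := hL false
    simp only [L, cond_false, List.map_ofFn] at this
    exact this

end PN
end Part_PN2

section Part_GH1
set_option maxHeartbeats 1000000
set_option synthInstance.maxHeartbeats 400000
set_option linter.unusedSectionVars false
universe u

section GH
variable (p : ℕ) [Fact p.Prime]
variable {T : Type u} [CommRing T] (I : Ideal T) (hpI : (p : T) ∈ I)

include hpI in
theorem ghost_mem_pow (w : WittVector p T) (hw : ∀ i, w.coeff i ∈ I) (n : ℕ) :
    WittVector.ghostComponent n w ∈ I ^ n := by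
  rw [WittVector.ghostComponent_apply, aeval_wittPolynomial]
  refine Ideal.sum_mem _ fun i hi => ?_
  have hi' : i ≤ n := by simpa [Nat.lt_succ_iff] using hi
  have h1 : (p : T) ^ i ∈ I ^ i := Ideal.pow_mem_pow hpI _
  have h2 : (w.coeff i) ^ p ^ (n - i) ∈ I ^ (n - i) :=
    Ideal.pow_le_pow_right (Nat.lt_pow_self (Fact.out : p.Prime).one_lt).le (Ideal.pow_mem_pow (hw i) _)
  have := Ideal.mul_mem_mul h1 h2
  rwa [← pow_add, Nat.add_sub_cancel' hi'] at this

/-- ghost component modulo `I^n`. -/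
noncomputable def GHM (n : ℕ) : WittVector p (T ⧸ I) →+* T ⧸ I ^ n :=
  RingHom.liftOfSurjective (WittVector.map (Ideal.Quotient.mk I))
    (WittVector.map_surjective _ Ideal.Quotient.mk_surjective)
    ⟨(Ideal.Quotient.mk (I ^ n)).comp (WittVector.ghostComponent n), by
      intro w hw
      rw [RingHom.mem_ker] at hw ⊢
      rw [RingHom.comp_apply, Ideal.Quotient.eq_zero_iff_mem]
      refine ghost_mem_pow p I hpI w (fun i => ?_) n
      have := congrArg (fun z => WittVector.coeff z i) hw
      simpa [WittVector.map_coeff, Ideal.Quotient.eq_zero_iff_mem] using this⟩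

theorem GHM_map_mk (n : ℕ) (w : WittVector p T) :
    GHM p I hpI n (WittVector.map (Ideal.Quotient.mk I) w) =
      Ideal.Quotient.mk _ (WittVector.ghostComponent n w) :=
  RingHom.liftOfSurjective_comp_apply ..

theorem GHM_teich (n : ℕ) (a : T) :
    GHM p I hpI n (WittVector.teichmuller p (Ideal.Quotient.mk I a)) =
      Ideal.Quotient.mk _ (a ^ p ^ n) := by
  rw [← WittVector.map_teichmuller, GHM_map_mk, WittVector.ghostComponent_teichmuller]

end GH
end Part_GH1

section Part_TILT1
set_option maxHeartbeats 1000000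
set_option synthInstance.maxHeartbeats 400000
set_option linter.unusedSectionVars false
universe u

section TILT
variable (p : ℕ) [Fact p.Prime]

theorem WReg.of_map_surjective {D K : Type*} [CommRing D] [CommRing K] (f : D →+* K)
    (hf : Function.Surjective f)
    (l : List D) : ∀ (J : Ideal K), WReg J (l.map f) → WReg (J.comap f) l := by
  induction l with
  | nil => intros; trivial
  | cons a l ih =>
    intro J h
    refine ⟨fun d hd => ?_, ?_⟩
    · rw [Ideal.mem_comap, map_mul] at hd
      exact h.1 _ hd
    · convert ih _ h.2 using 1
      ext d
      rw [Ideal.mem_comap, mem_sup_span_singleton, mem_sup_span_singleton]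
      constructor
      · rintro ⟨e, he⟩
        exact ⟨f e, by rw [Ideal.mem_comap, map_sub, map_mul] at he; exact he⟩
      · rintro ⟨e, he⟩
        obtain ⟨e, rfl⟩ := hf e
        exact ⟨e, by rw [Ideal.mem_comap, map_sub, map_mul]; exact he⟩

/-- Hypotheses for tilting. -/
structure Tiltable (T : Type u) [CommRing T] (pr : ℕ → T) : Prop where
  nu : ¬ IsUnit (p : T)
  ne : (p : T) ≠ 0
  pr0 : pr 0 = p
  prs : ∀ n, pr (n + 1) ^ p = pr n
  frob : ∀ a : T, ∃ b c : T, a - b ^ p = p * c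
  hroot : ∀ (a : T) k, pr k ∣ a ^ p → pr (k + 1) ∣ a

variable (T : Type u) [CommRing T] [Fact (¬ IsUnit (p : T))]

/-- The tilt. -/
abbrev Tl : Type u := Perfection (ModP T p) p

variable {T}

/-- the element of the tilt given by a compatible system. -/
noncomputable def Tl.el (c : ℕ → T) (hc : ∀ n, c (n + 1) ^ p = c n) : Tl p T :=
  ⟨fun n => Ideal.Quotient.mk _ (c n), fun n => by rw [← map_pow, hc]⟩

theorem Tl.coeff_el (c : ℕ → T) (hc) (n : ℕ) :
    Perfection.coeff (ModP T p) p n (Tl.el p c hc) = Ideal.Quotient.mk _ (c n) := rfl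

theorem pow_roots (c : ℕ → T) (hc : ∀ n, c (n + 1) ^ p = c n) (k n : ℕ) :
    c (k + n) ^ p ^ n = c k := by
  induction n with
  | zero => simp
  | succ n ih => rw [← add_assoc, pow_succ', pow_mul, hc, ih]

noncomputable def Tl.th (N : ℕ) : WittVector p (Tl p T) →+* T ⧸ (Ideal.span {(p : T)}) ^ N :=
  (GHM p _ (Ideal.mem_span_singleton_self _) N).comp
    (WittVector.map (Perfection.coeff (ModP T p) p N))

theorem Tl.th_teich (N : ℕ) (a : Tl p T) (u : T)
    (hu : Perfection.coeff (ModP T p) p N a = Ideal.Quotient.mk _ u) :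
    Tl.th p N (WittVector.teichmuller p a) = Ideal.Quotient.mk _ (u ^ p ^ N) := by
  unfold Tl.th
  rw [RingHom.comp_apply, WittVector.map_teichmuller, hu, GHM_teich]

theorem p_nilp (N : ℕ) : IsNilpotent ((p : ℕ) : T ⧸ (Ideal.span {(p : T)}) ^ N) := by
  refine ⟨N, ?_⟩
  rw [← map_natCast (Ideal.Quotient.mk _), ← map_pow, Ideal.Quotient.eq_zero_iff_mem]
  exact Ideal.pow_mem_pow (Ideal.mem_span_singleton_self _) _

theorem mod_pow_of_dvd {a b : T} (h : (p : T) ∣ a - b) (N : ℕ) : 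
    (Ideal.Quotient.mk ((Ideal.span {(p : T)}) ^ N)) (a ^ p ^ N) = Ideal.Quotient.mk _ (b ^ p ^ N) := by
  rw [Ideal.Quotient.eq, Ideal.span_singleton_pow, Ideal.mem_span_singleton]
  exact (pow_dvd_pow _ (Nat.le_succ N)).trans (dvd_sub_pow_of_dvd_sub h N)

theorem Tl.th_succ (N : ℕ) (w : WittVector p (Tl p T)) :
    Ideal.Quotient.factorPow (Ideal.span {(p : T)}) (Nat.le_succ N) (Tl.th p (N + 1) w) = Tl.th p N w := by
  have : ((Ideal.Quotient.factorPow (Ideal.span {(p : T)}) (Nat.le_succ N)).comp (Tl.th p (N + 1))) =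
      Tl.th p N := by
    refine WittVector.eq_of_apply_teichmuller_eq _ _ (p_nilp p N) fun a => ?_
    obtain ⟨u, hu⟩ := Ideal.Quotient.mk_surjective (Perfection.coeff (ModP T p) p (N + 1) a)
    rw [RingHom.comp_apply, Tl.th_teich p (N + 1) a u hu.symm, Tl.th_teich p N a (u ^ p) (by
      rw [map_pow, hu, Perfection.coeff_pow_p'])]
    rw [← pow_mul, ← pow_succ' p N]; rfl
  exact RingHom.congr_fun this w

section
variable (pr : ℕ → T) (h : Tiltable p T pr)

noncomputable def Tl.Th (N : ℕ) :
    SS p (Tl p T) (Tl.el p pr h.prs) →+* T ⧸ (Ideal.span {(p : T)}) ^ N :=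
  Ideal.Quotient.lift _ (Tl.th p N) (by
    intro a ha
    obtain ⟨b, rfl⟩ := Ideal.mem_span_singleton'.1 ha
    rw [map_mul, map_sub, map_natCast, Tl.th_teich p N _ (pr N) rfl]
    have := pow_roots p pr h.prs 0 N
    rw [zero_add] at this
    rw [this, h.pr0, map_natCast, sub_self, mul_zero])

theorem Tl.Th_sharp (N : ℕ) (a : Tl p T) (u : T)
    (hu : Perfection.coeff (ModP T p) p N a = Ideal.Quotient.mk _ u) :
    Tl.Th p pr h N (SS.sharp p _ _ a) = Ideal.Quotient.mk _ (u ^ p ^ N) := Tl.th_teich p N a u hu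

theorem Tl.Th_sharp_el (N : ℕ) (c : ℕ → T) (hc : ∀ n, c (n + 1) ^ p = c n) :
    Tl.Th p pr h N (SS.sharp p _ _ (Tl.el p c hc)) = Ideal.Quotient.mk _ (c 0) := by
  rw [Tl.Th_sharp p pr h N _ _ rfl]
  have := pow_roots p c hc 0 N
  rw [zero_add] at this
  rw [this]

theorem Tl.Th_succ (N : ℕ) (s) :
    Ideal.Quotient.factorPow (Ideal.span {(p : T)}) (Nat.le_succ N) (Tl.Th p pr h (N + 1) s) =
      Tl.Th p pr h N s := by
  obtain ⟨w, rfl⟩ := Ideal.Quotient.mk_surjective s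
  exact Tl.th_succ p N w

theorem Tl.coeff0_surj (h : Tiltable p T pr) (a : T) : ∃ d : Tl p T,
    Perfection.coeff (ModP T p) p 0 d = Ideal.Quotient.mk _ a := by
  refine Perfection.coeff_surjective (fun y => ?_) 0 _
  obtain ⟨y, rfl⟩ := Ideal.Quotient.mk_surjective y
  obtain ⟨b, c, hbc⟩ := h.frob y
  refine ⟨Ideal.Quotient.mk _ b, ?_⟩
  rw [frobenius_def, ← map_pow, eq_comm, Ideal.Quotient.eq, hbc]
  exact Ideal.mem_span_singleton.2 (dvd_mul_right _ _)

variable [IsDomain T]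

include h in
theorem Tiltable.pr_ne (n : ℕ) : pr n ≠ 0 := by
  intro hn
  have := pow_roots p pr h.prs 0 n
  rw [zero_add, hn, h.pr0, zero_pow (pow_ne_zero _ (Fact.out : p.Prime).ne_zero)] at this
  exact h.ne this.symm

include h in
theorem Tiltable.hroot' (n k : ℕ) : ∀ a : T, pr k ∣ a ^ p ^ n → pr (k + n) ∣ a := by
  induction n generalizing k with
  | zero => intro a ha; simpa using ha
  | succ n ih =>
    intro a ha
    rw [pow_succ, pow_mul] at ha
    have := ih (k + 1) a (h.hroot _ _ ha)
    convert this using 2; ring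

include h in
theorem Tiltable.pr_pow (n : ℕ) : pr n ^ p ^ n = p := by
  have := pow_roots p pr h.prs 0 n
  rwa [zero_add, h.pr0] at this

include h in
theorem Tl.t_reg (d : Tl p T) (hd : Tl.el p pr h.prs * d = 0) : d = 0 := by
  have hp := (Fact.out : p.Prime)
  refine Perfection.ext fun n => ?_
  obtain ⟨b, hb⟩ := Ideal.Quotient.mk_surjective (Perfection.coeff (ModP T p) p (n + 1) d)
  have h1 := congrArg (Perfection.coeff (ModP T p) p (n + 1)) hd
  rw [map_mul, Tl.coeff_el, ← hb, map_zero, ← map_mul, Ideal.Quotient.eq_zero_iff_mem,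
    Ideal.mem_span_singleton] at h1
  have h3 : p ^ (n + 1) = (p ^ (n + 1) - 1) + 1 := by
    have : 0 < p ^ (n + 1) := pow_pos hp.pos _
    omega
  have h2 : (p : T) = pr (n + 1) * pr (n + 1) ^ (p ^ (n + 1) - 1) := by
    rw [← pow_succ', ← h3, h.pr_pow]
  rw [h2] at h1
  have h4 := (mul_dvd_mul_iff_left (h.pr_ne p pr (n + 1))).1 h1
  rw [map_zero, ← Perfection.coeff_pow_p', ← hb, ← map_pow, Ideal.Quotient.eq_zero_iff_mem,
    Ideal.mem_span_singleton]
  refine dvd_trans ?_ (pow_dvd_pow_of_dvd h4 p)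
  rw [← pow_mul]
  conv_lhs => rw [← h.pr_pow p pr (n + 1)]
  refine pow_dvd_pow _ ?_
  have h5 := hp.two_le
  have h6 : 0 < p ^ n := pow_pos hp.pos _
  have h7 : p ≤ p ^ (n + 1) := Nat.le_self_pow (by omega) p
  have h8 : p ^ (n + 1) * 2 ≤ p ^ (n + 1) * p := Nat.mul_le_mul_left _ h5
  rw [Nat.sub_mul, one_mul]
  omega

include h in
theorem Tl.ker_coeff0 (d : Tl p T) (hd : Perfection.coeff (ModP T p) p 0 d = 0) :
    ∃ e, d = Tl.el p pr h.prs * e := by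
  have hp := (Fact.out : p.Prime)
  have h0 : ∀ n, ∃ b, Perfection.coeff (ModP T p) p n d = Ideal.Quotient.mk _ (pr n * b) := by
    intro n
    obtain ⟨b, hb⟩ := Ideal.Quotient.mk_surjective (Perfection.coeff (ModP T p) p n d)
    have h1 : pr 0 ∣ b ^ p ^ n := by
      rw [h.pr0, ← Ideal.mem_span_singleton, ← Ideal.Quotient.eq_zero_iff_mem, map_pow, hb, ← hd]
      have := Perfection.coeffMonoidHom_pow_p_pow' (M := ModP T p) (p := p) d 0 n
      rw [zero_add] at this
      exact this
    have h2 := h.hroot' p pr n 0 b h1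
    rw [zero_add] at h2
    obtain ⟨c, rfl⟩ := h2
    exact ⟨c, hb.symm⟩
  choose b hb using h0
  have h1 : ∀ n, (p : T) ∣ pr n * b n - pr n * b (n + 1) ^ p := by
    intro n
    rw [← Ideal.mem_span_singleton, ← Ideal.Quotient.eq, ← hb n, ← Perfection.coeff_pow_p', hb (n + 1),
      ← map_pow, mul_pow, h.prs]
  have h2 : ∀ n, ∃ c, b n = b (n + 1) ^ p + pr n ^ (p ^ n - 1) * c := by
    intro n
    have h3 : p ^ n = (p ^ n - 1) + 1 := by
      have : 0 < p ^ n := pow_pos hp.pos _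
      omega
    have h4 : (p : T) = pr n * pr n ^ (p ^ n - 1) := by
      rw [← pow_succ', ← h3, h.pr_pow]
    have h5 := h1 n
    rw [h4, ← mul_sub] at h5
    obtain ⟨c, hc⟩ := (mul_dvd_mul_iff_left (h.pr_ne p pr n)).1 h5
    exact ⟨c, by rw [← hc]; ring⟩
  have h6 : ∀ n, (Ideal.Quotient.mk (Ideal.span {(p : T)}) (b (n + 1 + 1) ^ p)) ^ p =
      Ideal.Quotient.mk (Ideal.span {(p : T)}) (b (n + 1) ^ p) := by
    intro n
    obtain ⟨c, hc⟩ := h2 (n + 1)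
    conv_rhs => rw [hc, map_pow, map_add]
    rw [add_pow_char, ← map_pow _ (_ * c), mul_pow, ← pow_mul]
    have h7 : (Ideal.Quotient.mk (Ideal.span {(p : T)})) (pr (n + 1) ^ ((p ^ (n + 1) - 1) * p) * c ^ p) = 0 := by
      rw [Ideal.Quotient.eq_zero_iff_mem, Ideal.mem_span_singleton]
      refine Dvd.dvd.mul_right ?_ _
      conv_lhs => rw [← h.pr_pow p pr (n + 1)]
      refine pow_dvd_pow _ ?_
      have h5 := hp.two_le
      have h6 : 0 < p ^ n := pow_pos hp.pos _
      have h7 : p ≤ p ^ (n + 1) := Nat.le_self_pow (by omega) p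
      have h8 : p ^ (n + 1) * 2 ≤ p ^ (n + 1) * p := Nat.mul_le_mul_left _ h5
      rw [Nat.sub_mul, one_mul]
      omega
    rw [h7, add_zero]
  let e0 : Tl p T := ⟨fun n => Ideal.Quotient.mk _ (b (n + 1) ^ p), h6⟩
  refine ⟨e0, Perfection.ext fun n => ?_⟩
  rw [map_mul, Tl.coeff_el, ← Perfection.coeff_pow_p', hb (n + 1)]
  change _ = _ * Ideal.Quotient.mk _ (b (n + 1) ^ p)
  rw [← map_pow, mul_pow, h.prs, map_mul]

theorem Tl.Th_ker (N : ℕ) : ∀ s, Tl.Th p pr h N s = 0 → (p : SS p (Tl p T) (Tl.el p pr h.prs)) ^ N ∣ s := by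
  induction N with
  | zero => intro s _; simp
  | succ N ih =>
    intro s hs
    have h1 : (p : SS p (Tl p T) (Tl.el p pr h.prs)) ∣ s := by
      obtain ⟨d, s', rfl⟩ := SS.exists_sharp p _ _ s
      obtain ⟨u, hu⟩ := Ideal.Quotient.mk_surjective (Perfection.coeff (ModP T p) p (N + 1) d)
      obtain ⟨v, hv⟩ := Ideal.Quotient.mk_surjective (Tl.Th p pr h (N + 1) s')
      rw [map_add, Tl.Th_sharp p pr h _ _ u hu.symm, map_mul, map_natCast, ← hv,
        ← map_natCast (Ideal.Quotient.mk _), ← map_mul, ← map_add, Ideal.Quotient.eq_zero_iff_mem,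
        Ideal.span_singleton_pow, Ideal.mem_span_singleton] at hs
      have h3 : (p : T) ∣ u ^ p ^ (N + 1) := by
        have := (dvd_pow_self (p : T) (Nat.succ_ne_zero N)).trans hs
        exact (dvd_add_left (dvd_mul_right _ _)).1 this
      have h4 : Perfection.coeff (ModP T p) p 0 d = 0 := by
        have := Perfection.coeffMonoidHom_pow_p_pow' (M := ModP T p) (p := p) d 0 (N + 1)
        rw [zero_add] at this
        refine this.symm.trans ?_
        change (Perfection.coeff (ModP T p) p (N + 1) d) ^ p ^ (N + 1) = 0
        rw [← hu, ← map_pow, Ideal.Quotient.eq_zero_iff_mem, Ideal.mem_span_singleton]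
        exact h3
      obtain ⟨e, he⟩ := Tl.ker_coeff0 p pr h d h4
      rw [he, map_mul, SS.sharp_t]
      exact dvd_add (dvd_mul_right _ _) (dvd_mul_right _ _)
    obtain ⟨s1, rfl⟩ := h1
    rw [pow_succ']
    refine mul_dvd_mul_left _ (ih s1 ?_)
    rw [← Tl.Th_succ]
    obtain ⟨v, hv⟩ := Ideal.Quotient.mk_surjective (Tl.Th p pr h (N + 1) s1)
    rw [map_mul, map_natCast, ← hv, ← map_natCast (Ideal.Quotient.mk _), ← map_mul,
      Ideal.Quotient.eq_zero_iff_mem, Ideal.span_singleton_pow, Ideal.mem_span_singleton, pow_succ'] at hs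
    rw [← hv]
    change Ideal.Quotient.mk _ v = 0
    rw [Ideal.Quotient.eq_zero_iff_mem, Ideal.span_singleton_pow, Ideal.mem_span_singleton]
    exact (mul_dvd_mul_iff_left h.ne).1 hs

theorem Tl.Th_surj (N : ℕ) (τ : T) : ∃ s, Tl.Th p pr h N s = Ideal.Quotient.mk _ τ := by
  have key : ∀ k (τ : T), ∃ s τ', Ideal.Quotient.mk _ τ = Tl.Th p pr h N s + Ideal.Quotient.mk _ ((p : T) ^ k * τ') := by
    intro k
    induction k with
    | zero => intro τ; exact ⟨0, τ, by simp⟩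
    | succ k ih =>
      intro τ
      obtain ⟨d, hd⟩ := Tl.coeff0_surj p pr h τ
      obtain ⟨u, hu⟩ := Ideal.Quotient.mk_surjective (Perfection.coeff (ModP T p) p N d)
      have h1 : (p : T) ∣ τ - u ^ p ^ N := by
        rw [← Ideal.mem_span_singleton, ← Ideal.Quotient.eq, ← hd, map_pow, hu]
        have := Perfection.coeffMonoidHom_pow_p_pow' (M := ModP T p) (p := p) d 0 N
        rw [zero_add] at this
        exact this.symm
      obtain ⟨c, hc⟩ := h1
      obtain ⟨s, τ', hs⟩ := ih c
      refine ⟨SS.sharp p _ _ d + (p : SS p (Tl p T) (Tl.el p pr h.prs)) * s, τ', ?_⟩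
      rw [map_add, Tl.Th_sharp p pr h N d u hu.symm, map_mul, map_natCast,
        show τ = u ^ p ^ N + p * c by rw [← hc]; ring, map_add, map_mul, map_natCast, hs, pow_succ']
      push_cast [map_mul]
      simp only [map_natCast]
      ring
  obtain ⟨s, τ', hs⟩ := key N τ
  refine ⟨s, ?_⟩
  rw [hs, eq_comm, add_eq_left, Ideal.Quotient.eq_zero_iff_mem, Ideal.span_singleton_pow, Ideal.mem_span_singleton]
  exact dvd_mul_right _ _

theorem Tl.Th_pN (N : ℕ) (s) (hs : (p : SS p (Tl p T) (Tl.el p pr h.prs)) ^ N ∣ s) : Tl.Th p pr h N s = 0 := by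
  obtain ⟨s, rfl⟩ := hs
  rw [map_mul, map_pow, map_natCast, ← map_natCast (Ideal.Quotient.mk _), ← map_pow,
    Ideal.Quotient.eq_zero_iff_mem.2, zero_mul]
  exact Ideal.pow_mem_pow (Ideal.mem_span_singleton_self _) _

noncomputable def Tl.equiv (N : ℕ) :
    SN p (Tl p T) (Tl.el p pr h.prs) N ≃+* T ⧸ (Ideal.span {(p : T)}) ^ N :=
  RingEquiv.ofBijective (Ideal.Quotient.lift _ (Tl.Th p pr h N) (by
    intro s hs
    exact Tl.Th_pN p pr h N s (Ideal.mem_span_singleton.1 hs))) (by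
    constructor
    · rw [injective_iff_map_eq_zero]
      intro s hs
      obtain ⟨s, rfl⟩ := Ideal.Quotient.mk_surjective s
      rw [Ideal.Quotient.lift_mk] at hs
      rw [SN.mk_eq_zero]
      exact Tl.Th_ker p pr h N s hs
    · intro y
      obtain ⟨τ, rfl⟩ := Ideal.Quotient.mk_surjective y
      obtain ⟨s, hs⟩ := Tl.Th_surj p pr h N τ
      exact ⟨Ideal.Quotient.mk _ s, hs⟩)

noncomputable def Tl.lam (N : ℕ) : T →+* SN p (Tl p T) (Tl.el p pr h.prs) N :=
  ((Tl.equiv p pr h N).symm.toRingHom).comp (Ideal.Quotient.mk _)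

theorem Tl.lam_eq (N : ℕ) (τ : T) (s) : Tl.lam p pr h N τ = Ideal.Quotient.mk _ s ↔
    Tl.Th p pr h N s = Ideal.Quotient.mk _ τ := by
  change (Tl.equiv p pr h N).symm (Ideal.Quotient.mk _ τ) = _ ↔ _
  rw [RingEquiv.symm_apply_eq, eq_comm]; rfl

theorem Tl.lam_el (N : ℕ) (c : ℕ → T) (hc : ∀ n, c (n + 1) ^ p = c n) :
    Tl.lam p pr h N (c 0) = Ideal.Quotient.mk _ (SS.sharp p _ _ (Tl.el p c hc)) := by
  rw [Tl.lam_eq, Tl.Th_sharp_el]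

theorem Tl.lam_eq_zero (N : ℕ) (τ : T) : Tl.lam p pr h N τ = 0 ↔ (p : T) ^ N ∣ τ := by
  rw [← map_zero (Ideal.Quotient.mk _), Tl.lam_eq, map_zero, eq_comm, Ideal.Quotient.eq_zero_iff_mem,
    Ideal.span_singleton_pow, Ideal.mem_span_singleton]

theorem Tl.lam_surj (N : ℕ) : Function.Surjective (Tl.lam p pr h N) := by
  intro y
  obtain ⟨τ, hτ⟩ := Ideal.Quotient.mk_surjective (Tl.equiv p pr h N y)
  exact ⟨τ, by change (Tl.equiv p pr h N).symm (Ideal.Quotient.mk _ τ) = _; rw [hτ, RingEquiv.symm_apply_apply]⟩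

/-- residues. -/
theorem Tl.lam_res (N : ℕ) (hN : 0 < N) (τ : T) (s) (hs : Tl.lam p pr h N τ = Ideal.Quotient.mk _ s) :
    ∃ γ, SS.res p _ _ s = Ideal.Quotient.mk _ γ ∧ Perfection.coeff (ModP T p) p 0 γ = Ideal.Quotient.mk _ τ := by
  rw [Tl.lam_eq] at hs
  obtain ⟨d, s', rfl⟩ := SS.exists_sharp p _ _ s
  refine ⟨d, ?_, ?_⟩
  · rw [map_add, map_mul, SS.res_p, zero_mul, add_zero, SS.res_sharp]
  · obtain ⟨u, hu⟩ := Ideal.Quotient.mk_surjective (Perfection.coeff (ModP T p) p N d)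
    obtain ⟨v, hv⟩ := Ideal.Quotient.mk_surjective (Tl.Th p pr h N s')
    rw [map_add, Tl.Th_sharp p pr h _ _ u hu.symm, map_mul, map_natCast, ← hv,
        ← map_natCast (Ideal.Quotient.mk _), ← map_mul, ← map_add, Ideal.Quotient.eq,
        Ideal.span_singleton_pow, Ideal.mem_span_singleton] at hs
    have := Perfection.coeffMonoidHom_pow_p_pow' (M := ModP T p) (p := p) d 0 N
    rw [zero_add] at this
    refine this.symm.trans ?_
    change (Perfection.coeff (ModP T p) p N d) ^ p ^ N = _
    rw [← hu, ← map_pow, Ideal.Quotient.eq, Ideal.mem_span_singleton]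
    have h2 := (dvd_pow_self (p : T) hN.ne').trans hs
    rw [show u ^ p ^ N + p * v - τ = (u ^ p ^ N - τ) + p * v by ring] at h2
    exact (dvd_add_left (dvd_mul_right _ _)).1 h2

/-- weakly regular sequences on the tilt. -/
theorem Tl.WReg_of (l : List (Tl p T)) (hl : WReg ⊥ (l.map (Perfection.coeff (ModP T p) p 0))) :
    WReg ⊥ (Tl.el p pr h.prs :: l) := by
  refine ⟨fun d hd => ?_, ?_⟩
  · rw [Ideal.mem_bot] at hd ⊢
    exact Tl.t_reg p pr h d hd
  · have := WReg.of_map_surjective (Perfection.coeff (ModP T p) p 0) (fun y => by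
      obtain ⟨y, rfl⟩ := Ideal.Quotient.mk_surjective y
      exact Tl.coeff0_surj p pr h y) l ⊥ hl
    convert this using 1
    ext d
    rw [mem_sup_span_singleton, Ideal.mem_comap, Ideal.mem_bot]
    constructor
    · rintro ⟨e, he⟩
      rw [Ideal.mem_bot, sub_eq_zero] at he
      rw [he, map_mul, Tl.coeff_el, h.pr0, Ideal.Quotient.eq_zero_iff_mem.2 (Ideal.mem_span_singleton_self _), zero_mul]
    · intro hd
      obtain ⟨e, he⟩ := Tl.ker_coeff0 p pr h d hd
      exact ⟨e, by rw [he, sub_self]; exact Ideal.zero_mem _⟩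
end

end TILT
end Part_TILT1

section Part_TILT2
set_option maxHeartbeats 1000000
set_option synthInstance.maxHeartbeats 400000
set_option linter.unusedSectionVars false
universe u

section TILT
variable (p : ℕ) [Fact p.Prime]
variable {A T : Type u} [CommRing A] [Fact (¬ IsUnit (p : A))] [CommRing T] [Fact (¬ IsUnit (p : T))]

noncomputable def modMap (f : A →+* T) : ModP A p →+* ModP T p :=
  Ideal.quotientMap _ f (by
    rw [Ideal.span_singleton_le_iff_mem, Ideal.mem_comap, map_natCast]
    exact Ideal.mem_span_singleton_self _)

theorem modMap_mk (f : A →+* T) (a : A) : modMap p f (Ideal.Quotient.mk _ a) = Ideal.Quotient.mk _ (f a) := rfl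

noncomputable def Tl.map (f : A →+* T) : Tl p A →+* Tl p T := Perfection.map p (modMap p f)

theorem Tl.map_el (f : A →+* T) (c : ℕ → A) (hc) (c' : ℕ → T) (hc') (h : ∀ n, f (c n) = c' n) :
    Tl.map p f (Tl.el p c hc) = Tl.el p c' hc' := by
  refine Perfection.ext fun n => ?_
  rw [Tl.map, Perfection.coeff_map, Tl.coeff_el, Tl.coeff_el, modMap_mk, h]

theorem Tl.th_map (f : A →+* T) (N : ℕ) (w : WittVector p (Tl p A)) (a : A)
    (h : Tl.th p N w = Ideal.Quotient.mk _ a) :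
    Tl.th p N (WittVector.map (Tl.map p f) w) = Ideal.Quotient.mk _ (f a) := by
  let fN : A ⧸ (Ideal.span {(p : A)}) ^ N →+* T ⧸ (Ideal.span {(p : T)}) ^ N :=
    Ideal.quotientMap _ f (by
      rw [Ideal.span_singleton_pow, Ideal.span_singleton_pow, Ideal.span_singleton_le_iff_mem,
        Ideal.mem_comap, map_pow, map_natCast]
      exact Ideal.mem_span_singleton_self _)
  have : fN.comp (Tl.th p N) = (Tl.th p N).comp (WittVector.map (Tl.map p f)) := by
    refine WittVector.eq_of_apply_teichmuller_eq _ _ (p_nilp p N) fun a => ?_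
    obtain ⟨u, hu⟩ := Ideal.Quotient.mk_surjective (Perfection.coeff (ModP A p) p N a)
    rw [RingHom.comp_apply, Tl.th_teich p N a u hu.symm, RingHom.comp_apply, WittVector.map_teichmuller,
      Tl.th_teich p N _ (f u) (by rw [Tl.map, Perfection.coeff_map, ← hu]; rfl), ← map_pow f]
    rfl
  rw [← RingHom.comp_apply, ← this, RingHom.comp_apply, h]
  rfl

variable [IsDomain A] [IsDomain T] (prA : ℕ → A) (hA : Tiltable p A prA) (prT : ℕ → T) (hT : Tiltable p T prT)

theorem Tl.lam_map (f : A →+* T) (hf : Tl.map p f (Tl.el p prA hA.prs) = Tl.el p prT hT.prs) (N : ℕ) (a : A) :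
    SN.map p _ _ (Tl.map p f) hf N (Tl.lam p prA hA N a) = Tl.lam p prT hT N (f a) := by
  obtain ⟨s, hs⟩ := Ideal.Quotient.mk_surjective (Tl.lam p prA hA N a)
  have h1 := (Tl.lam_eq p prA hA N a s).1 hs.symm
  rw [← hs, SN.map_mk, eq_comm, Tl.lam_eq]
  obtain ⟨w, rfl⟩ := Ideal.Quotient.mk_surjective s
  exact Tl.th_map p f N w a h1

include hA in
theorem PN0_tilt (f : A →+* T) (hf : ∀ n, f (prA n) = prT n) (N : ℕ) (hN : 0 < N)
    {B : Type u} [CommRing B] (j : B →+* A) (g : B) {m : ℕ} (x : Fin m → B)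
    (hg : WReg (⊥ : Ideal (ModP A p)) (Ideal.Quotient.mk _ (j g) :: []))
    (hx : WReg (⊥ : Ideal (ModP A p)) (List.ofFn fun k => Ideal.Quotient.mk _ (j (x k)))) :
    PN0 p N (Tl.el p prT hT.prs) ((Tl.lam p prT hT N).comp (f.comp j)) g x := by
  have hψ := Tl.map_el p f prA hA.prs prT hT.prs hf
  have hex : ∀ b : B, ∃ s γ, Tl.lam p prA hA N (j b) = Ideal.Quotient.mk _ s ∧
      SS.res p _ _ s = Ideal.Quotient.mk _ γ ∧ 
      Perfection.coeff (ModP A p) p 0 γ = Ideal.Quotient.mk _ (j b) := by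
    intro b
    obtain ⟨s, hs⟩ := Ideal.Quotient.mk_surjective (Tl.lam p prA hA N (j b))
    obtain ⟨γ, h1, h2⟩ := Tl.lam_res p prA hA N hN _ s hs.symm
    exact ⟨s, γ, hs.symm, h1, h2⟩
  choose s γ h1 h2 h3 using hex
  refine ⟨Tl p A, inferInstance, inferInstance, inferInstance, Tl.el p prA hA.prs, Tl.map p f, hψ,
    (Tl.lam p prA hA N).comp j, fun b => ?_, ⟨s g, γ g, h1 g, h2 g, ?_⟩, fun k => γ (x k),
    fun k => ⟨s (x k), h1 _, h2 _⟩, ?_⟩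
  · rw [RingHom.comp_apply, Tl.lam_map]; rfl
  · refine Tl.WReg_of p prA hA _ ?_
    rw [List.map_cons, List.map_nil, h3]
    exact hg
  · refine Tl.WReg_of p prA hA _ ?_
    rw [List.map_ofFn]
    convert hx using 3
    exact h3 _
end TILT
end Part_TILT2

section Part_CORE1
set_option maxHeartbeats 1000000
set_option synthInstance.maxHeartbeats 400000
set_option linter.unusedSectionVars false
universe u

section CORE
variable (p : ℕ) [Fact p.Prime]

theorem pow_dvd_of_integral {S : Type*} [CommRing S] (q u : S) (e : ℕ) (a : ℕ → S)
    (h : u ^ e = ∑ i ∈ Finset.range e, a i * q ^ (e - i) * u ^ i) (m : ℕ) : q ^ m ∣ q ^ e * u ^ m := by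
  induction m using Nat.strong_induction_on with
  | _ m ih =>
    by_cases hm : m < e
    · exact (pow_dvd_pow _ hm.le).mul_right _
    · have h1 : u ^ m = u ^ (m - e) * u ^ e := by rw [← pow_add]; congr 1; omega
      rw [h1, h, Finset.mul_sum, Finset.mul_sum]
      refine Finset.dvd_sum fun i hi => ?_
      rw [Finset.mem_range] at hi
      have h2 := mul_dvd_mul_left (q ^ (e - i)) (ih (m - e + i) (by omega))
      rw [← pow_add, show e - i + (m - e + i) = m by omega] at h2
      refine h2.trans ⟨a i, ?_⟩
      rw [pow_add]; ring

/-- iterated `p`-power roots. -/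
noncomputable def rt {D : Type*} [CommRing D] [CharP D p] [PerfectRing D p] (n : ℕ) : D ≃+* D :=
  (iterateFrobeniusEquiv D p n).symm

section
variable {D : Type*} [CommRing D] [CharP D p] [PerfectRing D p]
theorem rt_pow (n : ℕ) (d : D) : (rt p n d) ^ p ^ n = d := by
  rw [rt, ← iterateFrobenius_def, ← iterateFrobeniusEquiv_apply, RingEquiv.apply_symm_apply]

theorem pow_inj' (n : ℕ) {a b : D} (h : a ^ p ^ n = b ^ p ^ n) : a = b := by
  rw [← iterateFrobenius_def, ← iterateFrobenius_def, ← iterateFrobeniusEquiv_apply, ← iterateFrobeniusEquiv_apply] at h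
  exact (iterateFrobeniusEquiv D p n).injective h

theorem rt_unique (n : ℕ) {a b : D} (h : a ^ p ^ n = b) : a = rt p n b :=
  pow_inj' p n (by rw [h, rt_pow])

theorem map_rt {D' : Type*} [CommRing D'] [CharP D' p] [PerfectRing D' p] (f : D →+* D') (n : ℕ) (d : D) :
    f (rt p n d) = rt p n (f d) := rt_unique p n (by rw [← map_pow, rt_pow])
end

section
variable {C : Type u} [CommRing C] [CharP C p] [PerfectRing C p] (t : C)

theorem root_closed1 (ht : ∀ d : C, t * d = 0 → d = 0) (j : ℕ) : ∀ y : SS p C t, (p : SS p C t) ^ j ∣ y ^ p →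
    (SS.sharp p C t (rt p 1 t)) ^ j ∣ y := by
  have hp : (SS.sharp p C t (rt p 1 t)) ^ p = p := by
    rw [← map_pow]
    have := rt_pow p 1 t
    rw [pow_one] at this
    rw [this, SS.sharp_t]
  induction j with
  | zero => intro y _; simp
  | succ j ih =>
    intro y hy
    have h1 : SS.sharp p C t (rt p 1 t) ∣ y := by
      obtain ⟨d, s, rfl⟩ := SS.exists_sharp p _ _ y
      have h2 := (dvd_pow_self (p : SS p C t) (Nat.succ_ne_zero j)).trans hy
      rw [← SS.res_eq_zero, map_pow, map_add, map_mul, SS.res_p, zero_mul, add_zero, SS.res_sharp, ← map_pow,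
        Ideal.Quotient.eq_zero_iff_mem, Ideal.mem_span_singleton] at h2
      obtain ⟨c, hc⟩ := h2
      have h3 : d = rt p 1 t * rt p 1 c := by
        rw [← map_mul]
        refine rt_unique p 1 ?_
        rw [pow_one, hc]
      rw [h3, map_mul]
      refine dvd_add (dvd_mul_right _ _) ?_
      rw [← hp]
      exact (dvd_pow_self _ (Fact.out : p.Prime).ne_zero).mul_right _
    obtain ⟨y1, rfl⟩ := h1
    rw [pow_succ']
    refine mul_dvd_mul_left _ (ih y1 ?_)
    rw [mul_pow, hp, pow_succ'] at hy
    obtain ⟨c, hc⟩ := hy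
    refine ⟨c, sub_eq_zero.1 (SS.p_reg p C t ht _ ?_)⟩
    linear_combination hc

theorem root_closed (ht : ∀ d : C, t * d = 0 → d = 0) (K l : ℕ) : ∀ y : SS p C t,
    ((p : SS p C t) ^ K) ^ p ^ l ∣ y ^ p ^ l → (p : SS p C t) ^ K ∣ y := by
  have hp : (SS.sharp p C t (rt p 1 t)) ^ p = p := by
    rw [← map_pow]
    have := rt_pow p 1 t
    rw [pow_one] at this
    rw [this, SS.sharp_t]
  induction l with
  | zero => intro y; simp
  | succ l ih =>
    intro y hy
    refine ih y ?_
    rw [pow_succ, pow_mul y, ← pow_mul] at hy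
    have := root_closed1 p t ht _ _ hy
    rwa [← mul_assoc, mul_comm _ p, pow_mul, hp, pow_mul] at this

theorem p_pow_reg (ht : ∀ d : C, t * d = 0 → d = 0) (k : ℕ) : ∀ s : SS p C t, (p : SS p C t) ^ k * s = 0 → s = 0 := by
  induction k with
  | zero => intro s; simp
  | succ k ih =>
    intro s hs
    refine SS.p_reg p C t ht s (ih _ ?_)
    rw [← hs]; ring

/-- The key integrality argument in `S(C)`. -/
theorem riemann_C (ht : ∀ d : C, t * d = 0 → d = 0) (γ ω : C) (n' : ℕ) (hω : γ * ω = t ^ n') (n k e N : ℕ)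
    (b : SS p C t) (a : ℕ → SS p C t) (hN : k * (n' + 1) * e ≤ N) (he : 0 < e)
    (hb : (p : SS p C t) ^ N ∣ b ^ e - ∑ i ∈ Finset.range e, a i * ((p : SS p C t) * SS.sharp p C t γ) ^ (k * (e - i)) * b ^ i) :
    ∃ s, SS.sharp p C t (rt p n t) * b = (p : SS p C t) ^ k * SS.sharp p C t γ ^ k * s := by
  set P : SS p C t := ((p : ℕ) : SS p C t) with hP
  have hω' : SS.sharp p C t γ * SS.sharp p C t ω = P ^ n' := by
    rw [← map_mul, hω, map_pow, SS.sharp_t]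
  set G := SS.sharp p C t γ
  set W := SS.sharp p C t ω
  set K := k * (n' + 1) with hK
  set u := b * W ^ k with hu
  obtain ⟨v, hv⟩ := hb
  have hGW : (P * G) ^ k * W ^ k = P ^ K := by
    rw [← mul_pow, mul_assoc, hω', ← pow_succ', ← pow_mul, hK, mul_comm k]
  have h1 : u ^ e = ∑ i ∈ Finset.range e, (if i = 0 then a 0 + P ^ (N - K * e) * W ^ (k * e) * v else a i) * (P ^ K) ^ (e - i) * u ^ i := by
    have h2 : u ^ e = W ^ (k * e) * b ^ e := by rw [hu, mul_pow, ← pow_mul]; ring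
    have h3 : b ^ e = P ^ N * v + ∑ i ∈ Finset.range e, a i * (P * G) ^ (k * (e - i)) * b ^ i := by
      rw [← hv]; ring
    rw [h2, h3, mul_add, Finset.mul_sum]
    have h4 : ∀ i ∈ Finset.range e, W ^ (k * e) * (a i * (P * G) ^ (k * (e - i)) * b ^ i) =
        a i * (P ^ K) ^ (e - i) * u ^ i := by
      intro i hi
      rw [Finset.mem_range] at hi
      rw [← hGW, hu, mul_pow b, mul_pow _ (W ^ k), ← pow_mul W, ← pow_mul W, ← pow_mul (P * G)]
      have : k * e = k * (e - i) + k * i := by rw [← mul_add]; congr 1; omega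
      rw [this, pow_add]; ring
    rw [Finset.sum_congr rfl h4]
    obtain ⟨e', rfl⟩ : ∃ e', e = e' + 1 := ⟨e - 1, by omega⟩
    rw [Finset.sum_range_succ', Finset.sum_range_succ']
    simp only [Nat.succ_ne_zero, if_false, if_true, Nat.sub_zero, pow_zero, mul_one]
    have h5 : P ^ N = P ^ (N - K * (e' + 1)) * (P ^ K) ^ (e' + 1) := by
      rw [← pow_mul, ← pow_add]; congr 1; omega
    rw [h5]; ring
  -- choose exponent
  have hp1 := (Fact.out : p.Prime).one_lt
  set l := K * e
  have hl : K * e ≤ p ^ l := (Nat.lt_pow_self hp1).le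
  have h6 : (P ^ K) ^ p ^ (n + l) ∣ (SS.sharp p C t (rt p n t) * u) ^ p ^ (n + l) := by
    refine (pow_dvd_of_integral (P ^ K) u e _ h1 _).trans ?_
    rw [mul_pow (SS.sharp p C t (rt p n t))]
    refine mul_dvd_mul (α := SS p C t) ?_ dvd_rfl
    rw [pow_add, pow_mul (SS.sharp p C t (rt p n t)), ← map_pow, rt_pow, SS.sharp_t, ← pow_mul]
    exact pow_dvd_pow _ hl
  obtain ⟨s, hs⟩ := root_closed p t ht _ _ _ h6
  refine ⟨s, sub_eq_zero.1 (p_pow_reg p t ht (k * n') _ ?_)⟩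
  have h7 : (P ^ n') ^ k = (G * W) ^ k := by rw [hω']
  have h8 : P ^ K = P ^ (k * n') * P ^ k := by rw [← pow_add, hK]; ring
  rw [h8] at hs
  rw [mul_pow, ← pow_mul, mul_comm n'] at h7
  change P ^ (k * n') * _ = 0
  rw [mul_sub]
  rw [hu] at hs
  linear_combination G ^ k * hs + SS.sharp p C t (rt p n t) * b * h7
end

end CORE
end Part_CORE1

section Part_CORE2
set_option maxHeartbeats 1000000
set_option synthInstance.maxHeartbeats 400000
set_option linter.unusedSectionVars false
universe u

section CORE2
variable (p : ℕ) [Fact p.Prime]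

theorem SS.inj_mod {D D' : Type u} [CommRing D] [CharP D p] [PerfectRing D p]
    [CommRing D'] [CharP D' p] [PerfectRing D' p] (t : D) (t' : D') (f : D →+* D') (hf : f t = t')
    (ht' : ∀ d : D', t' * d = 0 → d = 0) (hinj : ∀ d, t' ∣ f d → t ∣ d) (j : ℕ) :
    ∀ z : SS p D t, (p : SS p D' t') ^ j ∣ SS.map p t t' f hf z → (p : SS p D t) ^ j ∣ z := by
  induction j with
  | zero => intro z _; simp
  | succ j ih =>
    intro z hz
    have h1 : (p : SS p D t) ∣ z := by
      obtain ⟨d, s, rfl⟩ := SS.exists_sharp p D t z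
      have h2 := (dvd_pow_self (p : SS p D' t') (Nat.succ_ne_zero j)).trans hz
      rw [← SS.res_eq_zero, map_add, map_add, map_mul, map_mul, map_natCast, SS.res_p, zero_mul, add_zero,
        SS.map_sharp, SS.res_sharp, Ideal.Quotient.eq_zero_iff_mem, Ideal.mem_span_singleton] at h2
      obtain ⟨c, rfl⟩ := hinj d h2
      rw [map_mul, SS.sharp_t]
      exact dvd_add (dvd_mul_right _ _) (dvd_mul_right _ _)
    obtain ⟨y1, rfl⟩ := h1
    rw [pow_succ']
    refine mul_dvd_mul_left _ (ih y1 ?_)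
    obtain ⟨c, hc⟩ := hz
    rw [map_mul, map_natCast] at hc
    refine ⟨c, sub_eq_zero.1 (SS.p_reg p D' t' ht' _ ?_)⟩
    linear_combination hc

theorem perfectRing_away {D : Type u} [CommRing D] [CharP D p] [PerfectRing D p] (γ : D)
    [CharP (Localization.Away γ) p] : PerfectRing (Localization.Away γ) p := by
  have hinj : Function.Injective (frobenius (Localization.Away γ) p) := by
    rw [injective_iff_map_eq_zero]
    intro a ha
    obtain ⟨d, s, rfl⟩ := IsLocalization.exists_mk'_eq (Submonoid.powers γ) a
    rw [frobenius_def, ← IsLocalization.mk'_pow, IsLocalization.mk'_eq_zero_iff] at ha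
    obtain ⟨⟨_, m, rfl⟩, hm⟩ := ha
    rw [IsLocalization.mk'_eq_zero_iff]
    refine ⟨⟨_, m, rfl⟩, ?_⟩
    refine pow_inj' p 1 ?_
    rw [pow_one, zero_pow (Fact.out : p.Prime).ne_zero, mul_pow]
    obtain ⟨q, hq⟩ : ∃ q, p = q + 1 := ⟨p - 1, by have := (Fact.out : p.Prime).pos; omega⟩
    have : (γ ^ m) ^ p * d ^ p = (γ ^ m) ^ q * (γ ^ m * d ^ p) := by rw [hq]; ring
    change (γ ^ m) ^ p * d ^ p = 0
    change γ ^ m * d ^ p = 0 at hm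
    rw [this, hm, mul_zero]
  refine ⟨hinj, ?_⟩
  intro a
  obtain ⟨d, s, rfl⟩ := IsLocalization.exists_mk'_eq (Submonoid.powers γ) a
  obtain ⟨_, m, rfl⟩ := s
  refine ⟨IsLocalization.mk' _ (rt p 1 (d * (γ ^ m) ^ (p - 1))) (⟨γ ^ m, m, rfl⟩ : Submonoid.powers γ), ?_⟩
  have h1 := rt_pow p 1 (d * (γ ^ m) ^ (p - 1))
  rw [pow_one] at h1
  change (IsLocalization.mk' (Localization.Away γ) (rt p 1 (d * (γ ^ m) ^ (p - 1))) (⟨γ ^ m, m, rfl⟩ : Submonoid.powers γ)) ^ p = _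
  rw [← IsLocalization.mk'_pow, h1, IsLocalization.mk'_eq_iff_eq]
  congr 1
  change γ ^ m * (d * (γ ^ m) ^ (p - 1)) = (γ ^ m) ^ p * d
  obtain ⟨q, hq⟩ : ∃ q, p = q + 1 := ⟨p - 1, by have := (Fact.out : p.Prime).pos; omega⟩
  rw [hq, Nat.add_sub_cancel]; ring

/-- Combination step: Claim R. -/
theorem claimR {D : Type u} [CommRing D] [CharP D p] [PerfectRing D p] (t γ : D) (hreg : WReg ⊥ [t, γ])
    (n k e N : ℕ) (b : SS p D t) (a : ℕ → SS p D t) (hN : k * (p ^ n + 1) * e ≤ N) (he : 0 < e)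
    (hb : (p : SS p D t) ^ N ∣ b ^ e - ∑ i ∈ Finset.range e, a i * ((p : SS p D t) * SS.sharp p D t γ) ^ (k * (e - i)) * b ^ i) :
    ∃ s c, SS.sharp p D t (rt p n t) * SS.sharp p D t (rt p n γ) * b =
      (p : SS p D t) ^ k * SS.sharp p D t γ ^ k * s + (p : SS p D t) ^ (k + 1) * c := by
  have ht : ∀ d : D, t * d = 0 → d = 0 := fun d hd => by simpa using hreg.1 d (by simpa using hd)
  have hγ : ∀ d : D, t ∣ γ * d → t ∣ d := fun d hd => by
    have := hreg.2.1 d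
    rw [bot_sup_eq, Ideal.mem_span_singleton, Ideal.mem_span_singleton] at this
    exact this hd
  have hγm : ∀ m, ∀ d : D, t ∣ γ ^ m * d → t ∣ d := by
    intro m
    induction m with
    | zero => intro d; simp
    | succ m ih => intro d hd; rw [pow_succ', mul_assoc] at hd; exact ih _ (hγ _ hd)
  rcases subsingleton_or_nontrivial (Localization.Away γ) with hsub | hnt
  · have h0 : algebraMap D (Localization.Away γ) 1 = 0 := Subsingleton.elim _ _
    rw [IsLocalization.map_eq_zero_iff (Submonoid.powers γ)] at h0
    obtain ⟨⟨_, m, rfl⟩, hm⟩ := h0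
    obtain ⟨v, hv⟩ := hγm m 1 (by change γ ^ m * 1 = 0 at hm; rw [hm]; exact dvd_zero _)
    have hpu : (p : SS p D t) * SS.sharp p D t v = 1 := by
      rw [← SS.sharp_t, ← map_mul, ← hv, map_one]
    refine ⟨0, SS.sharp p D t v ^ (k + 1) * (SS.sharp p D t (rt p n t) * SS.sharp p D t (rt p n γ) * b), ?_⟩
    have hpk : (p : SS p D t) ^ (k + 1) * SS.sharp p D t v ^ (k + 1) = 1 := by rw [← mul_pow, hpu, one_pow]
    linear_combination -(SS.sharp p D t (rt p n t) * SS.sharp p D t (rt p n γ) * b) * hpk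
  let Dγ := Localization.Away γ
  let f : D →+* Dγ := algebraMap D Dγ
  have : CharP Dγ p := charP_of_hom p f
  have : PerfectRing Dγ p := perfectRing_away p γ
  have htγ : ∀ y : Dγ, f t * y = 0 → y = 0 := by
    intro y hy
    obtain ⟨d, s, rfl⟩ := IsLocalization.exists_mk'_eq (Submonoid.powers γ) y
    rw [← IsLocalization.mk'_one (M := Submonoid.powers γ), ← IsLocalization.mk'_mul, IsLocalization.mk'_eq_zero_iff] at hy
    obtain ⟨m, hm⟩ := hy
    rw [IsLocalization.mk'_eq_zero_iff]
    exact ⟨m, ht _ (by rw [← hm]; ring)⟩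
  have hinj : ∀ d, f t ∣ f d → t ∣ d := by
    rintro d ⟨y, hy⟩
    obtain ⟨d', s, rfl⟩ := IsLocalization.exists_mk'_eq (Submonoid.powers γ) y
    rw [← IsLocalization.mk'_one (M := Submonoid.powers γ), ← IsLocalization.mk'_one (M := Submonoid.powers γ), ← IsLocalization.mk'_mul, IsLocalization.mk'_eq_iff_eq, one_mul,
      IsLocalization.eq_iff_exists (Submonoid.powers γ)] at hy
    obtain ⟨⟨_, m, rfl⟩, hm⟩ := hy
    obtain ⟨_, l, rfl⟩ := s
    refine hγm (m + l) d ⟨γ ^ m * d', ?_⟩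
    change γ ^ m * (γ ^ l * d) = γ ^ m * ((1 : D) * (t * d')) at hm
    rw [pow_add, mul_assoc, hm]; ring
  obtain ⟨γi, hγi⟩ := isUnit_iff_exists_inv.1 (IsLocalization.Away.algebraMap_isUnit (S := Dγ) γ)
  obtain ⟨ω, hω⟩ : ∃ ω : Dγ, f γ * ω = f t ^ p ^ n := by
    refine ⟨f t ^ p ^ n * γi, ?_⟩
    change f γ * γi = 1 at hγi
    linear_combination f t ^ p ^ n * hγi
  let Cs : Subalgebra D Dγ := Algebra.adjoin D (Set.range fun l => rt p l ω)
  have hrt : ∀ l m, rt p l ω = rt p (l + m) ω ^ p ^ m := by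
    intro l m
    symm
    refine rt_unique p l ?_
    rw [← pow_mul, ← pow_add, add_comm m, rt_pow]
  have hΩ : ∀ y ∈ Submonoid.closure (Set.range fun l => rt p l ω), ∃ l j, n ≤ l ∧ y = rt p l ω ^ j := by
    intro y hy
    induction hy using Submonoid.closure_induction with
    | mem y hy => obtain ⟨l, rfl⟩ := hy; exact ⟨l + n, p ^ n, by omega, hrt _ _⟩
    | one => exact ⟨n, 0, le_rfl, by simp⟩
    | mul y z _ _ h1 h2 =>
      obtain ⟨l, j, h1, rfl⟩ := h1
      obtain ⟨l', j', h2, rfl⟩ := h2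
      refine ⟨l + l', p ^ l' * j + p ^ l * j', by omega, ?_⟩
      rw [hrt l l', hrt l' l, add_comm l' l, ← pow_mul, ← pow_mul, ← pow_add]
  have hC : ∀ y ∈ Cs, ∃ d e, rt p n (f γ) * y = f d + f t * e := by
    intro y hy
    rw [← Subalgebra.mem_toSubmodule, Algebra.adjoin_eq_span] at hy
    induction hy using Submodule.span_induction with
    | zero => exact ⟨0, 0, by simp⟩
    | add y z _ _ h1 h2 =>
      obtain ⟨d, e, h1⟩ := h1
      obtain ⟨d', e', h2⟩ := h2
      exact ⟨d + d', e + e', by rw [map_add]; linear_combination h1 + h2⟩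
    | smul c y _ h1 =>
      obtain ⟨d, e, h1⟩ := h1
      refine ⟨c * d, f c * e, ?_⟩
      rw [Algebra.smul_def, map_mul]
      change _ * (f c * y) = _
      linear_combination f c * h1
    | mem y hy =>
      obtain ⟨l, j, hl, rfl⟩ := hΩ y hy
      obtain ⟨m, rfl⟩ := Nat.exists_eq_add_of_le hl
      have h1 : rt p n (f γ) = rt p (n + m) (f γ) ^ p ^ m := by
        symm
        refine rt_unique p n ?_
        rw [← pow_mul, ← pow_add, add_comm m, rt_pow]
      have h2 : rt p (n + m) (f γ) * rt p (n + m) ω = f (rt p (n + m) (t ^ p ^ n)) := by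
        rw [map_rt, ← map_mul, hω, map_pow f]
      rcases le_total j (p ^ m) with hj | hj
      · obtain ⟨i, hi⟩ := Nat.exists_eq_add_of_le hj
        refine ⟨rt p (n + m) (t ^ p ^ n) ^ j * rt p (n + m) γ ^ i, 0, ?_⟩
        rw [map_mul, map_pow, ← h2, map_pow, map_rt, h1, hi]; ring
      · obtain ⟨i, rfl⟩ := Nat.exists_eq_add_of_le hj
        refine ⟨0, rt p (n + m) ω ^ i, ?_⟩
        have h3 : rt p (n + m) (f γ) ^ p ^ m * rt p (n + m) ω ^ p ^ m = f t := by
          rw [← mul_pow, h2, ← map_pow]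
          congr 1
          refine pow_inj' p n ?_
          rw [← pow_mul, ← pow_add, add_comm m, rt_pow]
        rw [h1, map_zero, zero_add, pow_add, ← mul_assoc, h3]
  have : Nontrivial Cs := inferInstance
  let fC : D →+* Cs := algebraMap D Cs
  have : CharP Cs p := charP_of_hom p fC
  let q : Cs →+* Dγ := Cs.val.toRingHom
  have hq : Function.Injective q := Subtype.val_injective
  have : PerfectRing Cs p := by
    refine ⟨?_, ?_⟩
    · intro y z hyz
      refine hq (pow_inj' p 1 ?_)
      rw [pow_one, ← map_pow, ← map_pow]
      exact congrArg q hyz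
    · rintro ⟨y, hy⟩
      have : ∃ z ∈ Cs, z ^ p = y := by
        induction hy using Algebra.adjoin_induction with
        | mem y hy =>
          obtain ⟨l, rfl⟩ := hy
          refine ⟨rt p (l + 1) ω, Algebra.subset_adjoin ⟨l + 1, rfl⟩, ?_⟩
          have := hrt l 1
          rw [pow_one] at this
          exact this.symm
        | algebraMap d =>
          refine ⟨f (rt p 1 d), Subalgebra.algebraMap_mem _ _, ?_⟩
          rw [← map_pow]
          congr 1
          simpa using rt_pow p 1 d
        | add y z _ _ h1 h2 =>
          obtain ⟨y', h1, rfl⟩ := h1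
          obtain ⟨z', h2, rfl⟩ := h2
          exact ⟨y' + z', add_mem h1 h2, by rw [add_pow_char]⟩
        | mul y z _ _ h1 h2 =>
          obtain ⟨y', h1, rfl⟩ := h1
          obtain ⟨z', h2, rfl⟩ := h2
          exact ⟨y' * z', mul_mem h1 h2, by rw [mul_pow]⟩
      obtain ⟨z, hz, hzp⟩ := this
      exact ⟨⟨z, hz⟩, Subtype.ext hzp⟩
  have htC : ∀ d : Cs, fC t * d = 0 → d = 0 := by
    intro d hd
    refine hq ?_
    rw [map_zero]
    refine htγ _ ?_
    have := congrArg q hd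
    rwa [map_mul, map_zero] at this
  let ωC : Cs := ⟨ω, Algebra.subset_adjoin ⟨0, (rt_unique p 0 (by simp)).symm⟩⟩
  have hωC : fC γ * ωC = fC t ^ p ^ n := Subtype.ext hω
  obtain ⟨s, hs⟩ := riemann_C p (fC t) htC (fC γ) ωC (p ^ n) hωC n k e N (SS.map p t (fC t) fC rfl b)
    (fun i => SS.map p t (fC t) fC rfl (a i)) hN he (by
      have := map_dvd (SS.map p t (fC t) fC rfl) hb
      simpa only [map_pow, map_sub, map_sum, map_mul, map_natCast, SS.map_sharp] using this)
  obtain ⟨δ, s1, rfl⟩ := SS.exists_sharp p _ _ s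
  obtain ⟨d, y, hd⟩ := hC (q δ) δ.2
  have hsd : ∃ s2, SS.sharp p Dγ (f t) (rt p n (f γ)) * SS.sharp p Dγ (f t) (q δ) = SS.sharp p Dγ (f t) (f d) + p * s2 := by
    rw [← map_mul, hd]
    have h1 : SS.res p Dγ (f t) (SS.sharp p Dγ (f t) (f d + f t * y) - SS.sharp p Dγ (f t) (f d)) = 0 := by
      rw [map_sub, SS.res_sharp, SS.res_sharp, ← map_sub, Ideal.Quotient.eq_zero_iff_mem, Ideal.mem_span_singleton]
      exact ⟨y, by ring⟩
    obtain ⟨s2, h2⟩ := (SS.res_eq_zero p _ _ _).1 h1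
    exact ⟨s2, by linear_combination h2⟩
  obtain ⟨s2, hs2⟩ := hsd
  obtain ⟨M, hM1, hM2⟩ : ∃ M : SS p Cs (fC t) →+* SS p Dγ (f t),
      (∀ c, M (SS.sharp p Cs (fC t) c) = SS.sharp p Dγ (f t) (q c)) ∧
      M (SS.map p t (fC t) fC rfl b) = SS.map p t (f t) f rfl b :=
    ⟨SS.map p (fC t) (f t) q rfl, SS.map_sharp p (fC t) (f t) q rfl,
      SS.map_comp p t (fC t) (f t) fC rfl q rfl b⟩
  have hs' := congrArg M hs
  have hq1 : q (fC t) = f t := rfl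
  have hq2 : q (fC γ) = f γ := rfl
  rw [map_mul, hM2, hM1, map_rt, map_mul, map_add, map_mul, map_mul, map_pow, map_pow, map_natCast, hM1, hM1, hq1, hq2] at hs'
  have key : (p : SS p Dγ (f t)) ^ (k + 1) ∣ SS.map p t (f t) f rfl (SS.sharp p D t (rt p n t) * SS.sharp p D t (rt p n γ) * b -
      (p : SS p D t) ^ k * SS.sharp p D t γ ^ k * SS.sharp p D t d) := by
    refine ⟨SS.sharp p Dγ (f t) (f γ) ^ k * (SS.sharp p Dγ (f t) (rt p n (f γ)) * M s1 + s2), ?_⟩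
    simp only [map_mul, map_sub, map_pow, map_natCast, SS.map_sharp, map_rt]
    linear_combination SS.sharp p Dγ (f t) (rt p n (f γ)) * hs' + (p : SS p Dγ (f t)) ^ k * SS.sharp p Dγ (f t) (f γ) ^ k * hs2
  obtain ⟨c, hc⟩ := SS.inj_mod p t (f t) f rfl htγ hinj _ _ key
  exact ⟨SS.sharp p D t d, c, by linear_combination hc⟩
end CORE2
end Part_CORE2

section Part_CORE3
set_option maxHeartbeats 1000000
set_option synthInstance.maxHeartbeats 400000
set_option linter.unusedSectionVars false
universe u

section CORE3
variable (p : ℕ) [Fact p.Prime]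

theorem WReg.fin {A : Type*} [CommRing A] (I : Ideal A) {m : ℕ} (y : Fin m → A) (h : WReg I (List.ofFn y))
    (i : Fin m) (d : A) (hd : y i * d ∈ I ⊔ Ideal.span (y '' Set.Iio i)) :
    d ∈ I ⊔ Ideal.span (y '' Set.Iio i) := by
  have h1 : Ideal.ofList ((List.ofFn y).take i) = Ideal.span (y '' Set.Iio i) := by
    unfold Ideal.ofList
    congr 1
    ext z
    simp only [Set.mem_ofPred_eq, List.mem_take_iff_getElem, Set.mem_image, Set.mem_Iio]
    constructor
    · rintro ⟨l, hl, rfl⟩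
      simp only [List.length_ofFn] at hl
      exact ⟨⟨l, by omega⟩, by rw [Fin.lt_def]; simp; omega, by simp⟩
    · rintro ⟨l, hl, rfl⟩
      exact ⟨l, by simp; exact hl, by simp⟩
  rw [← h1] at hd ⊢
  refine (WReg.iff _ _).1 h ((List.ofFn y).take i) (y i) ((List.ofFn y).drop (i + 1)) ?_ d hd
  rw [← List.getElem_ofFn (f := y) (h := by simp), List.getElem_cons_drop]
  exact (List.take_append_drop _ _).symm

variable {T : Type u} [CommRing T] [Fact (¬ IsUnit (p : T))] [IsDomain T]

theorem Tl.rt_el (c : ℕ → T) (hc : ∀ n, c (n + 1) ^ p = c n) (n : ℕ) :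
    rt p n (Tl.el p c hc) = Tl.el p (fun m => c (m + n)) (fun m => by rw [← hc (m + n)]; congr 2; omega) := by
  symm
  refine rt_unique p n (Perfection.ext fun k => ?_)
  rw [map_pow, Tl.coeff_el, Tl.coeff_el, ← map_pow, pow_roots p c hc]

/-- integrality data -/
def IntData {B : Type u} [CommRing B] (j : B →+* T) (gB : B) (k : ℕ) (r : T) (e : ℕ) : Prop :=
  0 < e ∧ ∃ (b : B) (a : ℕ → B), j b = (p * j gB) ^ k * r ∧
    b ^ e = ∑ i ∈ Finset.range e, a i * (p * gB) ^ (k * (e - i)) * b ^ i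

theorem IntData.lift {B : Type u} [CommRing B] (j : B →+* T) (gB : B) (k : ℕ) (r : T) (e : ℕ)
    (hr : IntData p j gB k r e) {D : Type u} [CommRing D] [CharP D p] [PerfectRing D p] (t γ : D)
    (hreg : WReg ⊥ [t, γ]) (n N : ℕ) (hN : k * (p ^ n + 1) * e ≤ N) (β : B →+* SN p D t N)
    (hβ : β gB = Ideal.Quotient.mk _ (SS.sharp p D t γ)) :
    ∃ b bh, j b = (p * j gB) ^ k * r ∧ β b = Ideal.Quotient.mk _ bh ∧
      ∃ s c, SS.sharp p D t (rt p n t) * SS.sharp p D t (rt p n γ) * bh =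
      (p : SS p D t) ^ k * SS.sharp p D t γ ^ k * s + (p : SS p D t) ^ (k + 1) * c := by
  obtain ⟨he, b, a, hb, hbe⟩ := hr
  obtain ⟨bh, hbh⟩ := Ideal.Quotient.mk_surjective (β b)
  choose ah hah using fun i => Ideal.Quotient.mk_surjective (β (a i))
  refine ⟨b, bh, hb, hbh.symm, claimR p t γ hreg n k e N bh ah hN he ?_⟩
  rw [← SN.mk_eq_zero, map_sub, map_pow, map_sum, sub_eq_zero, hbh, ← map_pow, hbe, map_sum]
  refine Finset.sum_congr rfl fun i _ => ?_
  simp only [map_mul, map_pow, hbh, hah, ← hβ, map_natCast]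

theorem colon (pr gr : ℕ → T) (h : Tiltable p T pr) (hgr : ∀ n, gr (n + 1) ^ p = gr n)
    {B : Type u} [CommRing B] (j : B →+* T) (hj : Function.Injective j) (gB : B) (hgB : j gB = gr 0) {m : ℕ} (x : Fin m → B)
    (hPN : ∀ N > 0, PN p N (Tl.el p pr h.prs) (Tl.el p gr hgr) ((Tl.lam p pr h N).comp j) gB x)
    (hg : ∀ y, (p : T) ∣ gr 0 * y → (p : T) ∣ y) (k : ℕ) (i : Fin m)
    (r r0 : T) (rl : Fin m → T) (er e0 : ℕ) (el : Fin m → ℕ)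
    (hr : IntData p j gB k r er) (hr0 : IntData p j gB k r0 e0) (hrl : ∀ l, IntData p j gB k (rl l) (el l))
    (hrel : j (x i) * r = p * r0 + ∑ l ∈ Finset.Iio i, j (x l) * rl l) (n : ℕ) :
    pr n * gr n * r ∈ Ideal.span {(p : T)} ⊔ Ideal.span ((fun l => j (x l)) '' Set.Iio i) := by
  set N := k * (p ^ n + 1) * (er + e0 + ∑ l, el l) + k + 1 with hN
  obtain ⟨D, _, _, _, t, ψ, hψ, β, hβ, ⟨γ, hγE, hγ, hreg⟩, ξ, hξ, hξr⟩ := hPN N (by omega)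
  have hle : ∀ e, e ≤ er + e0 + ∑ l, el l → k * (p ^ n + 1) * e ≤ N := fun e he => by
    have := Nat.mul_le_mul_left (k * (p ^ n + 1)) he
    omega
  obtain ⟨b, bh, hb, hbh, s, c, hs⟩ := hr.lift p j gB k r er t γ hreg n N (hle _ (by omega)) β hγ
  obtain ⟨b0, bh0, hb0, hbh0, s0, c0, hs0⟩ := hr0.lift p j gB k r0 e0 t γ hreg n N (hle _ (by omega)) β hγ
  choose bl bhl hbl hbhl sl cl hsl using fun l => (hrl l).lift p j gB k (rl l) (el l) t γ hreg n N (hle _ (by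
    have := Finset.single_le_sum (fun i _ => Nat.zero_le (el i)) (Finset.mem_univ l)
    omega)) β hγ
  choose y hy hyξ using hξ
  have ht : ∀ d : D, t * d = 0 → d = 0 := fun d hd => by simpa using hreg.1 d (by simpa using hd)
  have hres := SS.res_surjective p D t
  have hker : Ideal.comap (SS.res p D t) ⊥ = Ideal.span {(p : SS p D t)} := by
    ext z
    rw [Ideal.mem_comap, Ideal.mem_bot, SS.res_eq_zero, Ideal.mem_span_singleton]
  have hyreg : WReg (Ideal.span {(p : SS p D t)}) (List.ofFn y) := by
    rw [← hker]
    refine WReg.of_map_surjective _ hres _ _ ?_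
    have : (List.ofFn y).map (SS.res p D t) = (List.ofFn ξ).map (Ideal.Quotient.mk (Ideal.span {t})) := by
      rw [List.map_ofFn, List.map_ofFn]
      congr 1
      exact funext hyξ
    rw [this]
    refine WReg.of_surjective _ Ideal.Quotient.mk_surjective _ _ ?_
    have h2 := hξr.2
    rw [bot_sup_eq] at h2
    convert h2
    exact Ideal.mk_ker
  have hγreg : ∀ k, ∀ z : SS p D t, (p : SS p D t) ∣ SS.sharp p D t γ ^ k * z → (p : SS p D t) ∣ z := by
    intro k
    induction k with
    | zero => intro z; simp
    | succ k ih =>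
      intro z hz
      rw [pow_succ', mul_assoc] at hz
      refine ih z ?_
      rw [← SS.res_eq_zero, map_mul, SS.res_sharp] at hz
      rw [← SS.res_eq_zero]
      obtain ⟨d, hd⟩ := Ideal.Quotient.mk_surjective (SS.res p D t (SS.sharp p D t γ ^ k * z))
      rw [← hd] at hz ⊢
      rw [← map_mul, Ideal.Quotient.eq_zero_iff_mem] at hz
      rw [Ideal.Quotient.eq_zero_iff_mem]
      have := hreg.2.1 d
      rw [bot_sup_eq] at this
      exact this hz
  -- relation in B
  have hrelB : x i * b = p * b0 + ∑ l ∈ Finset.Iio i, x l * bl l := by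
    refine hj ?_
    rw [map_mul, map_add, map_mul, map_sum, map_natCast, hb, hb0, ]
    have : ∀ l ∈ Finset.Iio i, j (x l * bl l) = (p * j gB) ^ k * (j (x l) * rl l) := fun l _ => by
      rw [map_mul, hbl]; ring
    rw [Finset.sum_congr rfl this, ← Finset.mul_sum]
    linear_combination (p * j gB) ^ k * hrel
  have hrelS : ∃ v, y i * bh = p * bh0 + ∑ l ∈ Finset.Iio i, y l * bhl l + (p : SS p D t) ^ N * v := by
    have h1 := congrArg β hrelB
    simp only [map_mul, map_add, map_sum, map_natCast, hy, hbh, hbh0, hbhl] at h1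
    have h2 : (Ideal.Quotient.mk _ (y i * bh - (p * bh0 + ∑ l ∈ Finset.Iio i, y l * bhl l)) : SN p D t N) = 0 := by
      simp only [map_mul, map_add, map_sub, map_sum, map_natCast, sub_eq_zero]
      exact h1
    rw [SN.mk_eq_zero] at h2
    obtain ⟨v, hv⟩ := h2
    exact ⟨v, by linear_combination hv⟩
  obtain ⟨v, hv⟩ := hrelS
  set P : SS p D t := ((p : ℕ) : SS p D t) with hP
  set ε := SS.sharp p D t (rt p n t) * SS.sharp p D t (rt p n γ) with hε
  have hsum : ε * ∑ l ∈ Finset.Iio i, y l * bhl l = P ^ k * (SS.sharp p D t γ ^ k * ∑ l ∈ Finset.Iio i, y l * sl l) +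
      P ^ (k + 1) * ∑ l ∈ Finset.Iio i, y l * cl l := by
    simp only [Finset.mul_sum, ← Finset.sum_add_distrib]
    refine Finset.sum_congr rfl fun l _ => ?_
    linear_combination y l * hsl l
  have hNk : P ^ N = P ^ (k + 1) * P ^ (k * (p ^ n + 1) * (er + e0 + ∑ l, el l)) := by
    rw [← pow_add, hN]; congr 1; omega
  have hdiv : P ^ k * (SS.sharp p D t γ ^ k * (y i * s - ∑ l ∈ Finset.Iio i, y l * sl l)
     - P * (SS.sharp p D t γ ^ k * s0 + P * c0 - y i * c + ∑ l ∈ Finset.Iio i, y l * cl l +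
       ε * P ^ (k * (p ^ n + 1) * (er + e0 + ∑ l, el l)) * v)) = 0 := by
    rw [hNk] at hv
    linear_combination ε * hv + hsum + P * hs0 - y i * hs
  have h3 := p_pow_reg p t ht k _ hdiv
  have h4 : P ∣ y i * s - ∑ l ∈ Finset.Iio i, y l * sl l := by
    refine hγreg k _ ?_
    rw [sub_eq_zero] at h3
    rw [h3]
    exact dvd_mul_right _ _
  set Q : Ideal (SS p D t) := Ideal.span {P} ⊔ Ideal.span (y '' Set.Iio i) with hQ
  have hPQ : P ∈ Q := (le_sup_left : Ideal.span {P} ≤ Q) (Ideal.mem_span_singleton_self _)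
  have hyQ : ∀ l, l < i → y l ∈ Q := fun l hl => (le_sup_right : Ideal.span (y '' Set.Iio i) ≤ Q) (Ideal.subset_span ⟨l, hl, rfl⟩)
  have hsQ : s ∈ Q := by
    refine WReg.fin _ y hyreg i s ?_
    have : y i * s = (y i * s - ∑ l ∈ Finset.Iio i, y l * sl l) + ∑ l ∈ Finset.Iio i, y l * sl l := by ring
    rw [this]
    refine Ideal.add_mem _ (Ideal.mem_of_dvd _ h4 hPQ) (Ideal.sum_mem _ fun l hl => ?_)
    exact Ideal.mul_mem_right _ _ (hyQ l (Finset.mem_Iio.1 hl))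
  -- transfer to T
  set QT : Ideal T := Ideal.span {(p : T)} ⊔ Ideal.span ((fun l => j (x l)) '' Set.Iio i) with hQT
  let lam := Tl.lam p pr h N
  have hlam : Function.Surjective lam := Tl.lam_surj p pr h N
  let Ψ : SS p D t →+* SN p (Tl p T) (Tl.el p pr h.prs) N :=
    (SN.map p t (Tl.el p pr h.prs) ψ hψ N).comp (Ideal.Quotient.mk _)
  have hΨβ : ∀ b' z, β b' = Ideal.Quotient.mk _ z → Ψ z = lam (j b') := fun b' z hz => by
    change SN.map p t (Tl.el p pr h.prs) ψ hψ N (Ideal.Quotient.mk _ z) = _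
    rw [← hz, hβ]; rfl
  have hQle : Q ≤ (QT.map lam).comap Ψ := by
    refine sup_le ?_ ?_
    · rw [Ideal.span_singleton_le_iff_mem, Ideal.mem_comap, hP, map_natCast, ← map_natCast lam]
      exact Ideal.mem_map_of_mem _ ((le_sup_left : Ideal.span {(p : T)} ≤ QT) (Ideal.mem_span_singleton_self _))
    · rw [Ideal.span_le]
      rintro _ ⟨l, hl, rfl⟩
      change Ψ (y l) ∈ QT.map lam
      rw [hΨβ _ _ (hy l)]
      exact Ideal.mem_map_of_mem _ ((le_sup_right : _ ≤ QT) (Ideal.subset_span ⟨l, hl, rfl⟩))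
  obtain ⟨τ, hτ, hτs⟩ := (Ideal.mem_map_iff_of_surjective lam hlam).1 (hQle hsQ)
  obtain ⟨τc, hτc⟩ := hlam (Ψ c)
  have hΨt : Ψ (SS.sharp p D t (rt p n t)) = lam (pr n) := by
    have h5 := Tl.lam_el p pr h N (fun m => pr (m + n)) (fun m => by rw [← h.prs (m + n)]; congr 2; omega)
    change SN.map p t (Tl.el p pr h.prs) ψ hψ N (Ideal.Quotient.mk _ _) = _
    rw [SN.map_mk, SS.map_sharp, map_rt, hψ, Tl.rt_el, ← h5, zero_add]
  have hΨγ' : ∀ n, Ψ (SS.sharp p D t (rt p n γ)) = lam (gr n) := fun n => by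
    have h5 := Tl.lam_el p pr h N (fun m => gr (m + n)) (fun m => by rw [← hgr (m + n)]; congr 2; omega)
    change SN.map p t (Tl.el p pr h.prs) ψ hψ N (Ideal.Quotient.mk _ _) = _
    rw [SN.map_mk, SS.map_sharp, map_rt, hγE, Tl.rt_el, ← h5, zero_add]
  have hΨγ : Ψ (SS.sharp p D t γ) = lam (gr 0) := by
    rw [← hΨγ', ← rt_unique p 0 (a := γ) (by simp)]
  have hfin := congrArg Ψ hs
  rw [hε] at hfin
  simp only [map_mul, map_add, map_pow, hΨt, hΨγ, hΨγ', hP, map_natCast, ← hτs, ← hτc, hΨβ _ _ hbh] at hfin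
  simp only [← map_natCast lam, ← map_mul, ← map_pow, ← map_add] at hfin
  have h6 : lam (pr n * gr n * j b - (p ^ k * gr 0 ^ k * τ + p ^ (k + 1) * τc)) = 0 := by
    rw [map_sub, hfin, sub_self]
  obtain ⟨w, hw⟩ := (Tl.lam_eq_zero p pr h N _).1 h6
  have hNk' : (p : T) ^ N = p ^ (k + 1) * p ^ (k * (p ^ n + 1) * (er + e0 + ∑ l, el l)) := by
    rw [← pow_add, hN]; congr 1; omega
  have h7 : gr 0 ^ k * (pr n * gr n * r - τ) = p * (τc + p ^ (k * (p ^ n + 1) * (er + e0 + ∑ l, el l)) * w) := by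
    refine mul_left_cancel₀ (pow_ne_zero k h.ne) ?_
    rw [hNk', hb, hgB] at hw
    linear_combination hw
  have hgk : ∀ k, ∀ y, (p : T) ∣ gr 0 ^ k * y → (p : T) ∣ y := by
    intro k
    induction k with
    | zero => intro y; simp
    | succ k ih => intro y hy; rw [pow_succ', mul_assoc] at hy; exact ih _ (hg _ hy)
  have h8 := hgk k _ ⟨_, h7⟩
  have h9 : pr n * gr n * r = (pr n * gr n * r - τ) + τ := by ring
  rw [h9]
  refine Ideal.add_mem _ (Ideal.mem_of_dvd _ h8 ?_) hτ
  exact (le_sup_left : Ideal.span {(p : T)} ≤ QT) (Ideal.mem_span_singleton_self _)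
end CORE3
end Part_CORE3

section Part_RL1
set_option maxHeartbeats 1000000
set_option synthInstance.maxHeartbeats 400000
set_option linter.unusedSectionVars false
universe u

/-! Regular local rings are completely integrally closed domains. -/

section RegLoc

/-- complete integral closedness, elementwise -/
def CIC (A : Type*) [CommRing A] : Prop :=
  ∀ c h f : A, c ≠ 0 → h ≠ 0 → (∀ n : ℕ, h ^ n ∣ c * f ^ n) → h ∣ f

theorem strip {A : Type*} [CommRing A] [IsDomain A] [IsNoetherianRing A]
    (x : A) (hx : Prime x) (c : A) (hc : c ≠ 0) : ∃ a c', c = x ^ a * c' ∧ ¬ x ∣ c' := by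
  obtain ⟨b, hb, hb'⟩ :=
    (FiniteMultiplicity.of_not_isUnit hx.not_isUnit hc).exists_eq_pow_mul_and_not_dvd
  exact ⟨_, b, hb, hb'⟩

theorem CIC.core {A : Type*} [CommRing A] [IsDomain A] [IsNoetherianRing A] [IsLocalRing A]
    (x : A) (hx : Prime x) (hbar : CIC (A ⧸ Ideal.span {x})) (c h f : A) (hc : c ≠ 0)
    (hh : ¬ x ∣ h) (H : ∀ n : ℕ, h ^ n ∣ c * f ^ n) : h ∣ f := by
  obtain ⟨a, c', rfl, hc'⟩ := strip x hx c hc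
  have key : ∀ (k n : ℕ) (y : A), h ^ n ∣ x ^ k * y → h ^ n ∣ y := by
    rintro k n y ⟨z, hz⟩
    have h1 : x ^ k ∣ h ^ n * z := ⟨y, hz.symm⟩
    have h2 : x ^ k ∣ z := hx.pow_dvd_of_dvd_mul_left k (fun h3 => hh (hx.dvd_of_dvd_pow h3)) h1
    obtain ⟨w, rfl⟩ := h2
    refine ⟨w, ?_⟩
    apply mul_left_cancel₀ (pow_ne_zero k hx.ne_zero)
    rw [hz]; ring
  have H' : ∀ n : ℕ, h ^ n ∣ c' * f ^ n := fun n => key a n _ (by rw [← mul_assoc]; exact H n)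
  have step : ∀ f : A, (∀ n : ℕ, h ^ n ∣ c' * f ^ n) →
      ∃ b f1, f = h * b + x * f1 ∧ ∀ n : ℕ, h ^ n ∣ c' * f1 ^ n := by
    intro f Hf
    have h1 : Ideal.Quotient.mk (Ideal.span {x}) h ∣ Ideal.Quotient.mk (Ideal.span {x}) f := by
      refine hbar (Ideal.Quotient.mk _ c') _ _ ?_ ?_ ?_
      · rwa [Ne, Ideal.Quotient.eq_zero_iff_mem, Ideal.mem_span_singleton]
      · rwa [Ne, Ideal.Quotient.eq_zero_iff_mem, Ideal.mem_span_singleton]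
      · intro n
        rw [← map_pow, ← map_pow, ← map_mul]
        exact map_dvd _ (Hf n)
    obtain ⟨b, hb⟩ := h1
    obtain ⟨b, rfl⟩ := Ideal.Quotient.mk_surjective b
    rw [← map_mul, Ideal.Quotient.eq, Ideal.mem_span_singleton] at hb
    obtain ⟨f1, hf1⟩ := hb
    refine ⟨b, f1, by rw [← hf1]; ring, fun n => ?_⟩
    apply key n n
    have : x ^ n * (c' * f1 ^ n) = c' * (f + -(h * b)) ^ n := by
      rw [← sub_eq_add_neg, hf1]; ring
    rw [this, add_pow, Finset.mul_sum]
    refine Finset.dvd_sum fun i hi => ?_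
    have hi' : i ≤ n := Nat.lt_succ_iff.1 (Finset.mem_range.1 hi)
    have : h ^ n = h ^ i * h ^ (n - i) := by rw [← pow_add]; congr 1; omega
    rw [this]
    have e : c' * (f ^ i * (-(h * b)) ^ (n - i) * (n.choose i : A)) =
        (c' * f ^ i) * h ^ (n - i) * ((- b) ^ (n - i) * (n.choose i : A)) := by
      rw [show -(h * b) = h * (-b) by ring, mul_pow]; ring
    rw [e]
    exact Dvd.dvd.mul_right (mul_dvd_mul (Hf i) dvd_rfl) _
  have all : ∀ n : ℕ, ∃ b f1, f = h * b + x ^ n * f1 ∧ ∀ n : ℕ, h ^ n ∣ c' * f1 ^ n := by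
    intro n
    induction n with
    | zero => exact ⟨0, f, by simp, H'⟩
    | succ n ih =>
      obtain ⟨b, f1, h1, h2⟩ := ih
      obtain ⟨b', f2, h3, h4⟩ := step f1 h2
      refine ⟨b + x ^ n * b', f2, ?_, h4⟩
      rw [h1, h3]; ring
  by_cases hu : IsUnit h
  · exact hu.dvd
  have hm : h ∈ IsLocalRing.maximalIdeal A := hu
  have hne : Nontrivial (A ⧸ Ideal.span {h}) := Ideal.Quotient.nontrivial_iff.2 fun h0 => by
    have : IsUnit h := Ideal.span_singleton_eq_top.1 h0
    exact hu this
  have hloc : IsLocalRing (A ⧸ Ideal.span {h}) :=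
    IsLocalRing.of_surjective' (Ideal.Quotient.mk _) Ideal.Quotient.mk_surjective
  have hI : (Ideal.span {Ideal.Quotient.mk (Ideal.span {h}) x}) ≠ ⊤ := by
    intro h0
    rw [Ideal.span_singleton_eq_top] at h0
    obtain ⟨w, hw⟩ := h0.exists_right_inv
    obtain ⟨w, rfl⟩ := Ideal.Quotient.mk_surjective w
    rw [← map_mul, ← map_one (Ideal.Quotient.mk (Ideal.span {h})), Ideal.Quotient.eq,
      Ideal.mem_span_singleton] at hw
    obtain ⟨v, hv⟩ := hw
    have h1 : (1 : A) ∈ IsLocalRing.maximalIdeal A := by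
      have : (1 : A) = x * w - h * v := by rw [← hv]; ring
      rw [this]
      exact Ideal.sub_mem _ (Ideal.mul_mem_right _ _ hx.not_isUnit) (Ideal.mul_mem_right _ _ hm)
    exact h1 isUnit_one
  have hK := Ideal.iInf_pow_eq_bot_of_isLocalRing _ hI
  have : Ideal.Quotient.mk (Ideal.span {h}) f ∈ (⊥ : Ideal (A ⧸ Ideal.span {h})) := by
    rw [← hK, Submodule.mem_iInf]
    intro n
    obtain ⟨b, f1, h1, -⟩ := all n
    rw [Ideal.span_singleton_pow, Ideal.mem_span_singleton]
    refine ⟨Ideal.Quotient.mk _ f1, ?_⟩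
    rw [← map_pow, ← map_mul, Ideal.Quotient.eq, Ideal.mem_span_singleton]
    exact ⟨b, by rw [h1]; ring⟩
  rw [Ideal.mem_bot, Ideal.Quotient.eq_zero_iff_mem, Ideal.mem_span_singleton] at this
  exact this

theorem CIC.of_quotient {A : Type*} [CommRing A] [IsDomain A] [IsNoetherianRing A] [IsLocalRing A]
    (x : A) (hx : Prime x) (hbar : CIC (A ⧸ Ideal.span {x})) : CIC A := by
  intro c h f hc hh H
  obtain ⟨b, h', rfl, hh'⟩ := strip x hx h hh
  obtain ⟨e, rfl⟩ : h' ∣ f := CIC.core x hx hbar c h' f hc hh' fun n =>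
    (Dvd.intro_left _ (mul_pow _ _ n).symm).trans (H n)
  by_cases he : e = 0
  · subst he; simp
  have h'0 : h' ≠ 0 := fun h0 => hh' (h0 ▸ dvd_zero x)
  obtain ⟨a, c', rfl, hc'⟩ := strip x hx c hc
  obtain ⟨s, e', rfl, he'⟩ := strip x hx e he
  have hbs : b ≤ s := by
    by_contra hlt
    push Not at hlt
    have h1 := H (a + 1)
    have h2 : x ^ (b * (a + 1)) ∣ x ^ (a + s * (a + 1)) * (c' * e' ^ (a + 1)) := by
      have h3 : (x ^ b * h') ^ (a + 1) = h' ^ (a + 1) * x ^ (b * (a + 1)) := by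
        rw [mul_pow, ← pow_mul]; ring
      have h4 : x ^ a * c' * (h' * (x ^ s * e')) ^ (a + 1) =
          h' ^ (a + 1) * (x ^ (a + s * (a + 1)) * (c' * e' ^ (a + 1))) := by
        rw [mul_pow, mul_pow, ← pow_mul, pow_add]; ring
      rw [h3, h4] at h1
      exact (mul_dvd_mul_iff_left (pow_ne_zero _ h'0)).1 h1
    have h5 : a + s * (a + 1) < b * (a + 1) := by nlinarith
    obtain ⟨r, hr⟩ := Nat.exists_eq_add_of_lt h5
    rw [hr, add_assoc, pow_add, mul_dvd_mul_iff_left (pow_ne_zero _ hx.ne_zero), pow_succ] at h2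
    have h6 := (Dvd.intro_left _ rfl).trans h2
    rcases hx.dvd_or_dvd h6 with h7 | h7
    · exact hc' h7
    · exact he' (hx.dvd_of_dvd_pow h7)
  obtain ⟨r, rfl⟩ := Nat.exists_eq_add_of_le hbs
  exact ⟨x ^ r * e', by ring⟩

theorem CIC.isIntegrallyClosed {A : Type*} [CommRing A] [IsDomain A] (h : CIC A) :
    IsIntegrallyClosed A := by
  rw [isIntegrallyClosed_iff (FractionRing A)]
  intro z hz
  obtain ⟨r, hr, hrn⟩ := hz.isAlmostIntegral
  obtain ⟨f, s, hs, rfl⟩ := IsFractionRing.div_surjective (A := A) z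
  have hs0 : s ≠ 0 := nonZeroDivisors.ne_zero hs
  have hs1 : algebraMap A (FractionRing A) s ≠ 0 := by
    simpa using hs0
  have : s ∣ f := by
    refine h r s f (nonZeroDivisors.ne_zero hr) hs0 fun n => ?_
    obtain ⟨w, hw⟩ := hrn n
    refine ⟨w, ?_⟩
    apply IsFractionRing.injective A (FractionRing A)
    rw [map_mul, map_mul, map_pow, map_pow, hw, Algebra.smul_def, div_pow]
    field_simp
  obtain ⟨w, rfl⟩ := this
  exact ⟨w, by rw [map_mul]; field_simp⟩

theorem ringKrullDim_le_length {A : Type*} [CommRing A] [IsNoetherianRing A] [IsLocalRing A]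
    (l : List A) (hl : Ideal.ofList l = IsLocalRing.maximalIdeal A) : ringKrullDim A ≤ l.length := by
  classical
  rw [← IsLocalRing.maximalIdeal_height_eq_ringKrullDim]
  refine (WithBot.coe_le_coe.mpr (Ideal.height_le_spanFinrank (IsLocalRing.maximalIdeal A)
      Ideal.IsPrime.ne_top')).trans ?_
  rw [← hl]
  have h := Submodule.spanFinrank_span_le_ncard_of_finite (R := A) (s := {r | r ∈ l}) (List.finite_toSet l)
  have h2 : Set.ncard {r | r ∈ l} ≤ l.length := by
    have : {r | r ∈ l} = (l.toFinset : Set A) := by ext; simp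
    rw [this, Set.ncard_coe_finset]
    exact List.toFinset_card_le l
  exact_mod_cast h.trans h2

theorem exists_prime_dim {A : Type*} [CommRing A] [IsNoetherianRing A] [IsLocalRing A]
    (d : ℕ) (h : (d : WithBot ℕ∞) ≤ ringKrullDim A) :
    ∃ Q : Ideal A, Q.IsPrime ∧ (d : WithBot ℕ∞) ≤ ringKrullDim (A ⧸ Q) := by
  obtain ⟨l, hl⟩ := Order.le_krullDim_iff.1 h
  refine ⟨l.head.asIdeal, l.head.2, ?_⟩
  rw [ringKrullDim_quotient, Order.le_krullDim_iff]
  refine ⟨⟨l.length, fun i => ⟨l i, ?_⟩, fun i => ?_⟩, hl⟩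
  · rw [PrimeSpectrum.mem_zeroLocus]
    exact l.head_le i
  · exact l.step i

theorem regloc : ∀ (d : ℕ) (A : Type u) [CommRing A] [IsLocalRing A] [IsNoetherianRing A]
    (l : List A), l.length = d → ringKrullDim A = d →
    Ideal.ofList l = IsLocalRing.maximalIdeal A → IsDomain A ∧ WReg ⊥ l ∧ CIC A ∧
      ∀ a l', l = a :: l' → Prime a := by
  intro d
  induction d with
  | zero =>
    intro A _ _ _ l hl hdim hm
    rw [List.length_eq_zero_iff] at hl
    subst hl
    rw [Ideal.ofList_nil] at hm
    have hu : ∀ a : A, a ≠ 0 → IsUnit a := fun a ha => by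
      by_contra h
      have : a ∈ IsLocalRing.maximalIdeal A := h
      rw [← hm] at this
      exact ha this
    refine ⟨?_, trivial, fun c h f hc hh H => (hu h hh).dvd, by simp⟩
    have : NoZeroDivisors A := ⟨fun {a b} hab => by
      by_cases ha : a = 0
      · exact Or.inl ha
      · exact Or.inr ((hu a ha).mul_right_eq_zero.1 hab)⟩
    exact NoZeroDivisors.to_isDomain A
  | succ d ih =>
    intro A _ _ _ l hl hdim hm
    obtain ⟨a, l, rfl⟩ : ∃ a l', l = a :: l' := by
      cases l with
      | nil => simp at hl
      | cons a l => exact ⟨a, l, rfl⟩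
    have hl' : l.length = d := by simpa using hl
    -- quotient facts
    have hq : ∀ (I : Ideal A), I ≤ IsLocalRing.maximalIdeal A → ∃ _ : IsLocalRing (A ⧸ I),
        IsLocalRing.maximalIdeal (A ⧸ I) = (IsLocalRing.maximalIdeal A).map (Ideal.Quotient.mk I) := by
      intro I hI
      have : Nontrivial (A ⧸ I) := Ideal.Quotient.nontrivial_iff.2 fun h =>
        (IsLocalRing.maximalIdeal.isMaximal A).ne_top (top_le_iff.1 (h ▸ hI))
      refine ⟨IsLocalRing.of_surjective' (Ideal.Quotient.mk _) Ideal.Quotient.mk_surjective, ?_⟩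
      have : IsLocalRing (A ⧸ I) :=
        IsLocalRing.of_surjective' (Ideal.Quotient.mk _) Ideal.Quotient.mk_surjective
      symm
      apply IsLocalRing.eq_maximalIdeal
      refine (Ideal.map_eq_top_or_isMaximal_of_surjective _ Ideal.Quotient.mk_surjective
        (IsLocalRing.maximalIdeal.isMaximal A)).resolve_left ?_
      intro h
      have h1 := congrArg (Ideal.comap (Ideal.Quotient.mk I)) h
      rw [Ideal.comap_map_of_surjective _ Ideal.Quotient.mk_surjective, Ideal.comap_top] at h1
      apply (IsLocalRing.maximalIdeal.isMaximal A).ne_top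
      rw [← h1]
      symm
      rw [sup_eq_left]
      intro y hy
      exact hI (by simpa [Ideal.Quotient.eq_zero_iff_mem] using hy)
    have ham : a ∈ IsLocalRing.maximalIdeal A := by
      rw [← hm]; exact Ideal.subset_span (by simp)
    obtain ⟨hloc, hmax⟩ := hq (Ideal.span {a}) ((Ideal.span_singleton_le_iff_mem _).2 ham)
    have hml : Ideal.ofList (l.map (Ideal.Quotient.mk (Ideal.span {a}))) =
        IsLocalRing.maximalIdeal (A ⧸ Ideal.span {a}) := by
      rw [hmax, ← hm, Ideal.map_ofList, List.map_cons, Ideal.ofList_cons]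
      have : Ideal.Quotient.mk (Ideal.span {a}) a = 0 := by
        rw [Ideal.Quotient.eq_zero_iff_mem]; exact Ideal.mem_span_singleton_self a
      rw [this]; simp
    have hdd : ((d + 1 : ℕ) : WithBot ℕ∞) = (d : WithBot ℕ∞) + 1 := by push_cast; rfl
    have canc : ∀ x : WithBot ℕ∞, (d : WithBot ℕ∞) + 1 ≤ x + 1 → (d : WithBot ℕ∞) ≤ x := by
      intro x hx
      cases x with
      | bot =>
        rw [WithBot.bot_add, le_bot_iff] at hx
        exact absurd hx (by rw [← hdd]; exact WithBot.coe_ne_bot)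
      | coe x =>
        cases x with
        | top => exact WithBot.coe_le_coe.2 le_top
        | coe x =>
          have : ((d + 1 : ℕ) : WithBot ℕ∞) ≤ ((x + 1 : ℕ) : WithBot ℕ∞) := by
            push_cast; exact hx
          have : d + 1 ≤ x + 1 := by exact_mod_cast this
          have h3 : d ≤ x := by omega
          exact WithBot.coe_le_coe.2 (by exact_mod_cast h3)
    have hge : ∀ (B : Type u) [CommRing B] [IsNoetherianRing B] [IsLocalRing B] (b : B),
        b ∈ IsLocalRing.maximalIdeal B → (d : WithBot ℕ∞) + 1 ≤ ringKrullDim B →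
        (d : WithBot ℕ∞) ≤ ringKrullDim (B ⧸ Ideal.span {b}) := by
      intro B _ _ _ b hb hB
      apply canc
      refine hB.trans ?_
      have := ringKrullDim_le_ringKrullDim_quotient_add_encard {b} (by
        rw [Set.singleton_subset_iff]
        have := IsLocalRing.jacobson_eq_maximalIdeal (⊥ : Ideal B) bot_ne_top
        rw [SetLike.mem_coe, Ring.jacobson_eq_sInf_isMaximal]
        rw [Submodule.mem_sInf]
        intro M hM
        rw [IsLocalRing.eq_maximalIdeal hM]; exact hb)
      simpa using this
    have hdimA : ringKrullDim (A ⧸ Ideal.span {a}) = d := by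
      apply le_antisymm
      · have := ringKrullDim_le_length _ hml
        rwa [List.length_map, hl'] at this
      · exact hge A a ham (by rw [hdim, hdd])
    obtain ⟨hdom, hreg, hcic, -⟩ := ih (A ⧸ Ideal.span {a}) _ (by rw [List.length_map, hl']) hdimA hml
    have haP : (Ideal.span {a}).IsPrime := (Ideal.Quotient.isDomain_iff_prime _).1 hdom
    obtain ⟨Q, hQ, hQd⟩ := exists_prime_dim (A := A) (d + 1) (by rw [hdim])
    have hQm : Q ≤ IsLocalRing.maximalIdeal A := IsLocalRing.le_maximalIdeal hQ.ne_top
    obtain ⟨hQloc, hQmax⟩ := hq Q hQm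
    have haQ : a ∉ Q := by
      intro h
      have h1 : Ideal.ofList (l.map (Ideal.Quotient.mk Q)) = IsLocalRing.maximalIdeal (A ⧸ Q) := by
        rw [hQmax, ← hm, Ideal.map_ofList, List.map_cons, Ideal.ofList_cons,
          Ideal.Quotient.eq_zero_iff_mem.2 h]; simp
      have h2 := hQd.trans (ringKrullDim_le_length _ h1)
      rw [List.length_map, hl'] at h2
      have : d + 1 ≤ d := by exact_mod_cast h2
      omega
    have hd2 : (d : WithBot ℕ∞) ≤ ringKrullDim ((A ⧸ Q) ⧸ Ideal.span {Ideal.Quotient.mk Q a}) := by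
      apply hge
      · rw [hQmax]; exact Ideal.mem_map_of_mem _ ham
      · rw [← hdd]; exact hQd
    have hQa : Q ≤ Ideal.span {a} := by
      intro q hq
      by_contra hqa
      let f : (A ⧸ Ideal.span {a}) →+* ((A ⧸ Q) ⧸ Ideal.span {Ideal.Quotient.mk Q a}) :=
        Ideal.Quotient.lift _ ((Ideal.Quotient.mk (Ideal.span {Ideal.Quotient.mk Q a})).comp
          (Ideal.Quotient.mk Q)) (by
            intro z hz
            obtain ⟨w, rfl⟩ := Ideal.mem_span_singleton.1 hz
            rw [RingHom.comp_apply, Ideal.Quotient.eq_zero_iff_mem, map_mul]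
            exact Ideal.mul_mem_right _ _ (Ideal.mem_span_singleton_self _))
      have hf : Function.Surjective f := Ideal.Quotient.lift_surjective_of_surjective _ _
        (Ideal.Quotient.mk_surjective.comp Ideal.Quotient.mk_surjective)
      have := ringKrullDim_succ_le_of_surjective f hf (r := Ideal.Quotient.mk _ q)
        (mem_nonZeroDivisors_of_ne_zero (by rwa [Ne, Ideal.Quotient.eq_zero_iff_mem]))
        (by
          change Ideal.Quotient.mk _ (Ideal.Quotient.mk Q q) = 0
          rw [Ideal.Quotient.eq_zero_iff_mem.2 hq, map_zero])
      rw [hdimA] at this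
      have h3 : (d : WithBot ℕ∞) + 1 ≤ d := le_trans (by gcongr) this
      rw [← hdd] at h3
      have : d + 1 ≤ d := by exact_mod_cast h3
      omega
    have hQ0 : Q = ⊥ := by
      have h1 : Q ≤ Ideal.span {a} • Q := by
        intro q hq
        obtain ⟨r, rfl⟩ := Ideal.mem_span_singleton.1 (hQa hq)
        have hr : r ∈ Q := (hQ.mem_or_mem hq).resolve_left haQ
        exact Ideal.mul_mem_mul (Ideal.mem_span_singleton_self a) hr
      refine Submodule.eq_bot_of_le_smul_of_le_jacobson_bot (Ideal.span {a}) Q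
        (IsNoetherian.noetherian Q) h1 ?_
      rw [IsLocalRing.jacobson_eq_maximalIdeal ⊥ bot_ne_top]
      exact (Ideal.span_singleton_le_iff_mem _).2 ham
    subst hQ0
    have hA : IsDomain A := by
      have := (IsDomain.of_bot_isPrime A)
      exact this
    have ha0 : a ≠ 0 := fun h => haQ (by simp [h])
    have hap : Prime a := (Ideal.span_singleton_prime ha0).1 haP
    refine ⟨hA, ⟨fun z hz => ?_, ?_⟩, CIC.of_quotient a hap hcic, ?_⟩
    · rw [Ideal.mem_bot] at hz ⊢
      exact (mul_eq_zero.1 hz).resolve_left ha0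
    · have h1 := WReg.of_map_surjective _ Ideal.Quotient.mk_surjective l ⊥ hreg
      rw [bot_sup_eq]
      rwa [← RingHom.ker_eq_comap_bot, Ideal.mk_ker] at h1
    · intro a' l' he
      rw [List.cons.injEq] at he
      rw [← he.1]; exact hap

end RegLoc
end Part_RL1

section Part_CO1
set_option maxHeartbeats 1000000
set_option synthInstance.maxHeartbeats 400000
set_option linter.unusedSectionVars false
universe u

open IsLocalRing

section Cohen
variable (p : ℕ) [Fact p.Prime]

theorem exists_theta (R : Type u) [CommRing R] [IsLocalRing R] [IsAdicComplete (maximalIdeal R) R]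
    [CharP (ResidueField R) p] [PerfectRing (ResidueField R) p] :
    ∃ θ : WittVector p (ResidueField R) →+* R, ∀ c, residue R (θ (WittVector.teichmuller p c)) = c := by
  have hpm : (p : R) ∈ maximalIdeal R := by
    rw [← residue_eq_zero_iff, map_natCast, CharP.cast_eq_zero]
  let f : ∀ n : ℕ, WittVector p (ResidueField R) →+* R ⧸ (maximalIdeal R) ^ n := fun n =>
    (GHM p (maximalIdeal R) hpm n).comp (WittVector.map (rt (D := ResidueField R) p n).toRingHom)
  have hft : ∀ n (c : ResidueField R) (a : R), (residue R a) ^ p ^ n = c →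
      f n (WittVector.teichmuller p c) = Ideal.Quotient.mk _ (a ^ p ^ n) := by
    intro n c a h
    change GHM p (maximalIdeal R) hpm n (WittVector.map (rt (D := ResidueField R) p n).toRingHom
      (WittVector.teichmuller p c)) = _
    rw [WittVector.map_teichmuller]
    have : (rt (D := ResidueField R) p n).toRingHom c = Ideal.Quotient.mk (maximalIdeal R) a :=
      (rt_unique p n h).symm
    rw [this]
    exact GHM_teich p _ hpm n a
  have hlift : ∀ n (c : ResidueField R), ∃ a : R, (residue R a) ^ p ^ n = c := fun n c => by
    obtain ⟨a, ha⟩ := residue_surjective (R := R) (rt (D := ResidueField R) p n c)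
    exact ⟨a, by rw [ha, rt_pow]⟩
  have hcompat : ∀ {m n : ℕ} (hle : m ≤ n),
      (Ideal.Quotient.factorPow (maximalIdeal R) hle).comp (f n) = f m := by
    intro m n hle
    apply WittVector.eq_of_apply_teichmuller_eq
    · refine ⟨m, ?_⟩
      have : ((p : ℕ) : R ⧸ (maximalIdeal R) ^ m) = Ideal.Quotient.mk _ (p : R) := by simp
      rw [this, ← map_pow, Ideal.Quotient.eq_zero_iff_mem]
      exact Ideal.pow_mem_pow hpm m
    · intro c
      obtain ⟨a, ha⟩ := hlift n c
      obtain ⟨r, rfl⟩ := Nat.exists_eq_add_of_le hle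
      rw [RingHom.comp_apply, hft _ c a ha, hft m c (a ^ p ^ r) (by
        rw [map_pow, ← pow_mul, ← pow_add, add_comm, ha])]
      have h2 : (a ^ p ^ r) ^ p ^ m = a ^ p ^ (m + r) := by
        rw [← pow_mul, ← pow_add, add_comm]
      rw [h2]
      rfl
  refine ⟨IsAdicComplete.liftRingHom (maximalIdeal R) f hcompat, fun c => ?_⟩
  have h1 := IsAdicComplete.mk_liftRingHom (maximalIdeal R) f hcompat 1 (WittVector.teichmuller p c)
  obtain ⟨a, ha⟩ := hlift 1 c
  rw [hft 1 c a ha, Ideal.Quotient.eq, pow_one] at h1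
  have h2 := (residue_eq_zero_iff _).2 h1
  rw [map_sub, map_pow, ha] at h2
  exact sub_eq_zero.1 h2

theorem exists_phi {R : Type u} [CommRing R] (m : Ideal R) [IsAdicComplete m R]
    {W : Type u} [CommRing W] (θ : W →+* R) {d : ℕ} (x : Fin d → R) (hx : ∀ i, x i ∈ m) :
    ∃ φ : MvPowerSeries (Fin d) W →+* R, (∀ w, φ (MvPowerSeries.C w) = θ w) ∧
      ∀ i, φ (MvPowerSeries.X i) = x i := by
  let e : MvPolynomial (Fin d) W →+* R := MvPolynomial.eval₂Hom θ x
  have he : (MvPolynomial.idealOfVars (Fin d) W).map e ≤ m := by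
    rw [MvPolynomial.idealOfVars, Ideal.map_span, Ideal.span_le]
    rintro _ ⟨_, ⟨i, rfl⟩, rfl⟩
    simpa [e] using hx i
  have hen : ∀ n, (MvPolynomial.idealOfVars (Fin d) W) ^ n ≤ (m ^ n).comap e := fun n => by
    rw [← Ideal.map_le_iff_le_comap, Ideal.map_pow]
    exact Ideal.pow_right_mono he n
  let f : ∀ n : ℕ, MvPowerSeries (Fin d) W →+* R ⧸ m ^ n := fun n =>
    (Ideal.quotientMap (m ^ n) e (hen n)).comp (MvPowerSeries.truncTotalAlgHom (Fin d) W n).toRingHom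
  have hf : ∀ n F, f n F = Ideal.Quotient.mk _ (e (MvPowerSeries.truncTotal n F)) := fun n F => by
    rfl
  have hcompat : ∀ {k n : ℕ} (hle : k ≤ n), (Ideal.Quotient.factorPow m hle).comp (f n) = f k := by
    intro k n hle
    ext F
    rw [RingHom.comp_apply, hf, hf]
    change Ideal.Quotient.mk _ _ = Ideal.Quotient.mk _ _
    rw [Ideal.Quotient.eq, ← map_sub]
    exact hen k (MvPowerSeries.truncTotal_sub_truncTotal_mem_pow_idealOfVars hle le_rfl F)
  have hpoly : ∀ P : MvPolynomial (Fin d) W,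
      IsAdicComplete.liftRingHom m f hcompat (P : MvPowerSeries (Fin d) W) = e P := by
    intro P
    refine sub_eq_zero.1 (IsHausdorff.haus (I := m) inferInstance _ fun n => ?_)
    rw [SModEq.zero, smul_eq_mul, Ideal.mul_top, ← Ideal.Quotient.eq_zero_iff_mem, map_sub,
      IsAdicComplete.mk_liftRingHom, sub_eq_zero]
    have := (MvPowerSeries.truncTotalAlgHom (Fin d) W n).commutes P
    change Ideal.quotientMap (m ^ n) e (hen n) (MvPowerSeries.truncTotalAlgHom (Fin d) W n
      (algebraMap _ _ P)) = _
    rw [this]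
    rfl
  refine ⟨IsAdicComplete.liftRingHom m f hcompat, fun w => ?_, fun i => ?_⟩
  · have := hpoly (MvPolynomial.C w)
    rw [MvPolynomial.coe_C] at this
    rw [this]; simp [e]
  · have := hpoly (MvPolynomial.X i)
    rw [MvPolynomial.coe_X] at this
    rw [this]; simp [e]

end Cohen
end Part_CO1

section Part_CO2
set_option maxHeartbeats 1000000
set_option synthInstance.maxHeartbeats 400000
set_option linter.unusedSectionVars false
universe u

open IsLocalRing

section CohenFin

theorem pi_mem_smul_top {P : Type*} [CommRing P] (I : Ideal P) {n : ℕ} (v : Fin n → P) :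
    v ∈ (I • ⊤ : Submodule P (Fin n → P)) ↔ ∀ i, v i ∈ I := by
  constructor
  · intro h i
    have h1 : LinearMap.proj (R := P) (φ := fun _ : Fin n => P) i v ∈
        (I • ⊤ : Submodule P (Fin n → P)).map (LinearMap.proj i) := ⟨v, h, rfl⟩
    rw [Submodule.map_smul''] at h1
    have h2 := Submodule.smul_mono (le_refl I) (le_top : Submodule.map (LinearMap.proj i) (⊤ : Submodule P (Fin n → P)) ≤ ⊤) h1
    simpa using h2
  · intro h
    rw [pi_eq_sum_univ' v]
    exact Submodule.sum_mem _ fun i _ => Submodule.smul_mem_smul (h i) trivial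

theorem pi_precomplete {P : Type*} [CommRing P] (I : Ideal P) [IsPrecomplete I P] (n : ℕ) :
    IsPrecomplete I (Fin n → P) := by
  refine ⟨fun f hf => ?_⟩
  have key : ∀ i : Fin n, ∃ L : P, ∀ k, f k i ≡ L [SMOD (I ^ k • ⊤ : Submodule P P)] := by
    intro i
    refine IsPrecomplete.prec ‹_› (f := fun k => f k i) ?_
    intro a b hab
    have := hf hab
    rw [SModEq.sub_mem] at this ⊢
    simpa using (pi_mem_smul_top _ _).1 this i
  choose L hL using key
  refine ⟨L, fun k => ?_⟩
  rw [SModEq.sub_mem, pi_mem_smul_top]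
  intro i
  have := hL i k
  rw [SModEq.sub_mem] at this
  simpa using this

theorem finite_of_adic {P R : Type*} [CommRing P] [CommRing R] [IsLocalRing R] [IsNoetherianRing R]
    [Algebra P R] [IsHausdorff (maximalIdeal R) R] (I : Ideal P) [IsPrecomplete I P]
    (hres : ∀ r : R, ∃ a : P, r - algebraMap P R a ∈ maximalIdeal R)
    (h1 : I.map (algebraMap P R) ≤ maximalIdeal R)
    (h2 : maximalIdeal R ≤ (I.map (algebraMap P R)).radical) : Module.Finite P R := by
  have step : ∀ i : ℕ, ∃ N : Submodule P R, N.FG ∧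
      N ⊔ ((maximalIdeal R) ^ i).restrictScalars P = ⊤ := by
    intro i
    induction i with
    | zero => exact ⟨⊥, Submodule.fg_bot, by simp⟩
    | succ i ih =>
      obtain ⟨N, hN, hN2⟩ := ih
      obtain ⟨S, hS⟩ := (isNoetherianRing_iff_ideal_fg R).1 inferInstance ((maximalIdeal R) ^ i)
      refine ⟨N ⊔ Submodule.span P (S : Set R), hN.sup ⟨S, rfl⟩, ?_⟩
      have h3 : ((maximalIdeal R) ^ i).restrictScalars P ≤
          Submodule.span P (S : Set R) ⊔ ((maximalIdeal R) ^ (i+1)).restrictScalars P := by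
        intro r hr
        have hr' : r ∈ Submodule.span R (S : Set R) := by
          change r ∈ (maximalIdeal R) ^ i at hr
          rw [← hS] at hr; exact hr
        induction hr' using Submodule.span_induction with
        | mem s hs => exact Submodule.mem_sup_left (Submodule.subset_span hs)
        | zero => exact Submodule.zero_mem _
        | add x y hx hy ih1 ih2 =>
          have hx' : x ∈ (maximalIdeal R) ^ i := by rw [← hS]; exact hx
          have hy' : y ∈ (maximalIdeal R) ^ i := by rw [← hS]; exact hy
          exact Submodule.add_mem _ (ih1 hx') (ih2 hy')
        | smul a x hx ih1 =>
          have hx' : x ∈ (maximalIdeal R) ^ i := by rw [← hS]; exact hx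
          obtain ⟨a0, ha0⟩ := hres a
          have : a • x = a0 • x + (a - algebraMap P R a0) * x := by
            rw [Algebra.smul_def a0 x, smul_eq_mul]; ring
          rw [this]
          refine Submodule.add_mem _ (Submodule.smul_mem _ _ (ih1 hx')) (Submodule.mem_sup_right ?_)
          change _ ∈ (maximalIdeal R) ^ (i+1)
          rw [pow_succ']
          exact Ideal.mul_mem_mul ha0 hx'
      rw [eq_top_iff, ← hN2, sup_assoc]
      exact sup_le_sup_left h3 N
  obtain ⟨k, hk⟩ := Ideal.exists_pow_le_of_le_radical_of_fg h2 ((isNoetherianRing_iff_ideal_fg R).1 inferInstance _)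
  obtain ⟨N, hN, hN2⟩ := step k
  obtain ⟨n, f, hf⟩ := (Submodule.fg_iff_exists_fin_linearMap P R).1 hN
  have := pi_precomplete I n
  have hle : ∀ j : ℕ, (I ^ j • ⊤ : Submodule P R) ≤ ((maximalIdeal R) ^ j).restrictScalars P := by
    intro j
    rw [Ideal.smul_top_eq_map, Ideal.map_pow]
    exact Ideal.pow_right_mono h1 j
  have hH : IsHausdorff I R := by
    refine ⟨fun r hr => IsHausdorff.haus (I := maximalIdeal R) inferInstance r fun j => ?_⟩
    have := hr j
    rw [SModEq.zero] at this ⊢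
    have := hle j this
    simpa using this
  refine Module.Finite.of_surjective f (surjective_of_mkQ_comp_surjective (I := I) ?_)
  intro q
  obtain ⟨r, rfl⟩ := Submodule.mkQ_surjective _ q
  have hr : r ∈ N ⊔ ((maximalIdeal R) ^ k).restrictScalars P := by rw [hN2]; trivial
  obtain ⟨a, ha, b, hb, rfl⟩ := Submodule.mem_sup.1 hr
  rw [← hf] at ha
  obtain ⟨v, rfl⟩ := ha
  refine ⟨v, ?_⟩
  rw [LinearMap.comp_apply, ← sub_eq_zero, ← map_sub, Submodule.mkQ_apply, Submodule.Quotient.mk_eq_zero]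
  rw [Ideal.smul_top_eq_map]
  have : b ∈ I.map (algebraMap P R) := hk hb
  have h5 := Ideal.neg_mem_iff _ |>.2 this
  have h6 : f v - (f v + b) = -b := by ring
  rw [h6]; exact h5
end CohenFin
end Part_CO2

section Part_CO3
set_option maxHeartbeats 1000000
set_option synthInstance.maxHeartbeats 400000
set_option linter.unusedSectionVars false
universe u

open IsLocalRing

section Cohen3

theorem mps_mem_span_X {W : Type*} [CommRing W] {d : ℕ} (i0 : Fin d)
    (F : MvPowerSeries (Fin d) W) (hF : MvPowerSeries.constantCoeff F = 0) :
    F ∈ Ideal.span (Set.range (MvPowerSeries.X : Fin d → MvPowerSeries (Fin d) W)) := by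
  classical
  have hsel : ∀ e : Fin d →₀ ℕ, ∃ i, e ≠ 0 → e i ≠ 0 := by
    intro e
    by_cases h : e = 0
    · exact ⟨i0, fun h' => absurd h h'⟩
    · obtain ⟨i, hi⟩ := Finsupp.ne_iff.1 h
      exact ⟨i, fun _ => hi⟩
  choose sel hs using hsel
  let H : Fin d → MvPowerSeries (Fin d) W := fun i e => if e ≠ 0 ∧ sel e = i then MvPowerSeries.coeff e F else 0
  have hH : ∀ i e, MvPowerSeries.coeff e (H i) = if e ≠ 0 ∧ sel e = i then MvPowerSeries.coeff e F else 0 := fun i e => rfl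
  have hsum : F = ∑ i, H i := by
    ext e
    rw [map_sum]
    simp_rw [hH]
    by_cases h : e = 0
    · subst h
      simpa using hF
    · simp [h]
  rw [hsum]
  refine Ideal.sum_mem _ fun i _ => ?_
  have : (MvPowerSeries.X i : MvPowerSeries (Fin d) W) ∣ H i := by
    rw [MvPowerSeries.X_dvd_iff]
    intro m hm
    rw [hH, if_neg]
    rintro ⟨h1, rfl⟩
    exact hs m h1 hm
  exact Ideal.mem_of_dvd _ this (Ideal.subset_span ⟨i, rfl⟩)

theorem mps_coeff_pow (p : ℕ) [Fact p.Prime] {k : Type*} [CommRing k] [CharP k p] {d : ℕ}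
    (G : MvPowerSeries (Fin d) k) (n : Fin d →₀ ℕ) :
    MvPowerSeries.coeff (p • n) (G ^ p) = (MvPowerSeries.coeff n G) ^ p := by
  have : ExpChar k p := ExpChar.prime Fact.out
  rw [← MvPowerSeries.map_frobenius_expand (p := p) (hp := (Fact.out : p.Prime).ne_zero), MvPowerSeries.coeff_map,
    MvPowerSeries.coeff_expand_smul, frobenius_def]

theorem mps_coeff_pow' (p : ℕ) [Fact p.Prime] {k : Type*} [CommRing k] [CharP k p] {d : ℕ}
    (G : MvPowerSeries (Fin d) k) (n : Fin d →₀ ℕ) (i : Fin d) (hi : ¬ p ∣ n i) :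
    MvPowerSeries.coeff n (G ^ p) = 0 := by
  have : ExpChar k p := ExpChar.prime Fact.out
  rw [← MvPowerSeries.map_frobenius_expand (p := p) (hp := (Fact.out : p.Prime).ne_zero), MvPowerSeries.coeff_map,
    MvPowerSeries.coeff_expand_of_not_dvd (h := hi), map_zero]

noncomputable def mexp {d p : ℕ} (m : Fin d → Fin p) : Fin d →₀ ℕ := Finsupp.equivFunOnFinite.symm fun i => (m i : ℕ)

theorem mps_frob (p : ℕ) [Fact p.Prime] {k : Type*} [CommRing k] [CharP k p] [PerfectRing k p] {d : ℕ}
    (F : MvPowerSeries (Fin d) k) : ∃ G : (Fin d → Fin p) → MvPowerSeries (Fin d) k,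
      F = ∑ m, MvPowerSeries.monomial (mexp m) 1 * (G m) ^ p := by
  classical
  have hp : 0 < p := (Fact.out : p.Prime).pos
  let G : (Fin d → Fin p) → MvPowerSeries (Fin d) k := fun m e =>
    rt (D := k) p 1 (MvPowerSeries.coeff (p • e + mexp m) F)
  have hG : ∀ m e, MvPowerSeries.coeff e (G m) ^ p = MvPowerSeries.coeff (p • e + mexp m) F := by
    intro m e
    have := rt_pow (D := k) p 1 (MvPowerSeries.coeff (p • e + mexp m) F)
    rw [pow_one] at this
    exact this
  refine ⟨G, ?_⟩
  ext e
  rw [map_sum]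
  simp_rw [MvPowerSeries.coeff_monomial_mul]
  let m0 : Fin d → Fin p := fun i => ⟨e i % p, Nat.mod_lt _ hp⟩
  let n0 : Fin d →₀ ℕ := Finsupp.equivFunOnFinite.symm fun i => e i / p
  have he : p • n0 + mexp m0 = e := by
    ext i
    simp [n0, mexp, m0, Nat.div_add_mod]
  rw [Finset.sum_eq_single m0]
  · rw [if_pos (by rw [← he]; exact le_add_self)]
    have : e - mexp m0 = p • n0 := by rw [← he]; simp
    rw [this, mps_coeff_pow, hG, he, one_mul]
  · intro m _ hm
    split_ifs with hle
    · have : ∃ i, m i ≠ m0 i := by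
        by_contra! h; exact hm (funext h)
      obtain ⟨i, hi⟩ := this
      rw [mps_coeff_pow' p _ _ i, mul_zero]
      intro hdvd
      apply hi
      have h1 := hle i
      simp only [mexp, Finsupp.equivFunOnFinite_symm_apply_apply] at h1
      have h2 : (e - mexp m) i = e i - (m i : ℕ) := by simp [mexp]
      rw [h2] at hdvd
      apply Fin.ext
      have h3 : (m i : ℕ) ≡ e i [MOD p] := (Nat.modEq_iff_dvd' h1).2 hdvd
      have h4 : (m i : ℕ) % p = e i % p := h3
      rw [Nat.mod_eq_of_lt (m i).2] at h4
      exact h4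
    · rfl
  · simp

theorem mps_frob_witt (p : ℕ) [Fact p.Prime] {k : Type*} [CommRing k] [CharP k p] [PerfectRing k p] {d : ℕ}
    (F : MvPowerSeries (Fin d) (WittVector p k)) : ∃ (G : (Fin d → Fin p) → MvPowerSeries (Fin d) (WittVector p k))
      (H : MvPowerSeries (Fin d) (WittVector p k)),
      F = ∑ m, MvPowerSeries.monomial (mexp m) 1 * (G m) ^ p + p * H := by
  classical
  obtain ⟨G, hG⟩ := mps_frob p (MvPowerSeries.map (WittVector.constantCoeff (p := p)) F)
  have hl : ∀ m, ∃ G' : MvPowerSeries (Fin d) (WittVector p k),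
      MvPowerSeries.map (WittVector.constantCoeff (p := p)) G' = G m := by
    intro m
    obtain ⟨Y, hY⟩ : ∃ Y : MvPowerSeries (Fin d) (WittVector p k), ∀ e, MvPowerSeries.coeff e Y =
      WittVector.teichmuller p (MvPowerSeries.coeff e (G m)) := ⟨fun e => WittVector.teichmuller p (MvPowerSeries.coeff e (G m)), fun _ => rfl⟩
    refine ⟨Y, ?_⟩
    ext e
    rw [MvPowerSeries.coeff_map, hY]
    exact WittVector.teichmuller_coeff_zero p _
  choose G' hG' using hl
  have hz : ∀ e, ∃ h : WittVector p k, MvPowerSeries.coeff e (F - ∑ m, MvPowerSeries.monomial (mexp m) 1 * (G' m) ^ p) = p * h := by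
    intro e
    have : WittVector.constantCoeff (MvPowerSeries.coeff e (F - ∑ m, MvPowerSeries.monomial (mexp m) 1 * (G' m) ^ p)) = 0 := by
      rw [← MvPowerSeries.coeff_map, map_sub, hG, map_sum]
      simp only [map_mul, map_pow, hG', MvPowerSeries.map_monomial, map_one, sub_self, map_zero]
    rw [← RingHom.mem_ker, WittVector.ker_constantCoeff, Ideal.mem_span_singleton] at this
    exact this
  choose h hh using hz
  obtain ⟨Y, hY⟩ : ∃ Y : MvPowerSeries (Fin d) (WittVector p k), ∀ e, MvPowerSeries.coeff e Y = h e := ⟨fun e => h e, fun _ => rfl⟩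
  refine ⟨G', Y, ?_⟩
  rw [← sub_eq_iff_eq_add']
  ext e : 1
  rw [hh]
  have : ((p : ℕ) : MvPowerSeries (Fin d) (WittVector p k)) = MvPowerSeries.C (p : WittVector p k) := by simp
  rw [this, MvPowerSeries.coeff_C_mul, hY]

theorem cohen (p : ℕ) [Fact p.Prime] (R : Type u) [CommRing R] [IsLocalRing R] [IsNoetherianRing R]
    [IsAdicComplete (maximalIdeal R) R]
    [CharP (ResidueField R) p] [PerfectRing (ResidueField R) p]
    (d : ℕ) (x : Fin d → R) (i0 : Fin d) (hi0 : x i0 = p)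
    (h1 : Ideal.span (Set.range x) ≤ maximalIdeal R)
    (h2 : maximalIdeal R ≤ (Ideal.span (Set.range x)).radical) :
    ∃ (A : Subring R) (xA : Fin d → A), (∀ i, (xA i : R) = x i) ∧ IsNoetherianRing A ∧ A.subtype.Finite ∧
      ∃ _ : IsLocalRing A, maximalIdeal A = Ideal.span (Set.range xA) ∧
      ∀ a : A, ∃ (b : (Fin d → Fin p) → A) (c : A), a = ∑ m, (∏ i, xA i ^ (m i : ℕ)) * (b m) ^ p + p * c := by
  classical
  obtain ⟨θ, hθ⟩ := exists_theta p R
  have hxm : ∀ i, x i ∈ maximalIdeal R := fun i => h1 (Ideal.subset_span ⟨i, rfl⟩)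
  obtain ⟨φ, hφC, hφX⟩ := exists_phi (maximalIdeal R) θ x hxm
  have hs := φ.rangeRestrict_surjective
  have hnoe : IsNoetherianRing φ.range := isNoetherianRing_of_surjective _ _ φ.rangeRestrict hs
  have hloc : IsLocalRing φ.range := IsLocalRing.of_surjective' φ.rangeRestrict hs
  have hfin : φ.range.subtype.Finite := by
    refine RingHom.Finite.of_comp_finite (f := φ.rangeRestrict) ?_
    have e : φ.range.subtype.comp φ.rangeRestrict = φ := by ext; rfl
    rw [e]
    algebraize [φ]
    have hmap : Ideal.map (algebraMap (MvPowerSeries (Fin d) (WittVector p (ResidueField R))) R)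
        (Ideal.span (Set.range MvPowerSeries.X)) = Ideal.span (Set.range x) := by
      rw [Ideal.map_span, ← Set.range_comp]
      congr 2
      ext i
      exact hφX i
    change Module.Finite _ _
    refine finite_of_adic (Ideal.span (Set.range (MvPowerSeries.X))) ?_ (by rw [hmap]; exact h1) (by rw [hmap]; exact h2)
    intro r
    refine ⟨MvPowerSeries.C (WittVector.teichmuller p (residue R r)), ?_⟩
    rw [← residue_eq_zero_iff, map_sub, sub_eq_zero]
    change _ = residue R (φ _)
    rw [hφC, hθ]
  let xA : Fin d → φ.range := fun i => φ.rangeRestrict (MvPowerSeries.X i)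
  have hxA : ∀ i, (xA i : R) = x i := fun i => hφX i
  have hcast : ((p : ℕ) : φ.range) = xA i0 := by
    apply Subtype.ext
    rw [hxA, hi0]; simp
  refine ⟨φ.range, xA, hxA, hnoe, hfin, hloc, ?_, ?_⟩
  · apply le_antisymm
    · intro a ha
      obtain ⟨F, rfl⟩ := hs a
      have hF : ¬ IsUnit F := fun h => (mem_maximalIdeal _ |>.1 ha) (h.map _)
      rw [MvPowerSeries.isUnit_iff_constantCoeff] at hF
      have hc : (MvPowerSeries.constantCoeff F).coeff 0 = 0 := by
        by_contra h
        exact hF (WittVector.isUnit_of_coeff_zero_ne_zero _ h)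
      rw [← WittVector.mem_span_p_iff_coeff_zero_eq_zero, Ideal.mem_span_singleton] at hc
      obtain ⟨w, hw⟩ := hc
      have h3 := mps_mem_span_X i0 (F - MvPowerSeries.C (MvPowerSeries.constantCoeff F)) (by simp)
      have h4 := Ideal.mem_map_of_mem φ.rangeRestrict h3
      rw [Ideal.map_span, ← Set.range_comp] at h4
      have h5 : F = (F - MvPowerSeries.C (MvPowerSeries.constantCoeff F)) + ((p : ℕ) : MvPowerSeries (Fin d) (WittVector p (ResidueField R))) * MvPowerSeries.C w := by
        rw [hw]; simp
      rw [h5, map_add, map_mul, map_natCast, hcast]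
      refine Ideal.add_mem _ h4 (Ideal.mul_mem_right _ _ (Ideal.subset_span ⟨i0, rfl⟩))
    · rw [Ideal.span_le]
      rintro _ ⟨i, rfl⟩
      rw [SetLike.mem_coe, mem_maximalIdeal, mem_nonunits_iff]
      intro hu
      have := hu.map φ.range.subtype
      change IsUnit (xA i : R) at this
      rw [hxA] at this
      exact (mem_maximalIdeal _ |>.1 (hxm i)) this
  · intro a
    obtain ⟨F, rfl⟩ := hs a
    obtain ⟨G, H, hF⟩ := mps_frob_witt p F
    refine ⟨fun m => φ.rangeRestrict (G m), φ.rangeRestrict H, ?_⟩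
    conv_lhs => rw [hF]
    rw [map_add, map_mul, map_natCast, map_sum]
    congr 1
    refine Finset.sum_congr rfl fun m _ => ?_
    rw [map_mul, map_pow, MvPowerSeries.monomial_eq']
    simp [mexp, xA, Finsupp.prod_fintype]
end Cohen3
end Part_CO3

section Part_AI1
set_option maxHeartbeats 1000000
set_option synthInstance.maxHeartbeats 400000
set_option linter.unusedSectionVars false
universe u

open IsLocalRing

section AInf

theorem dim_integral {A B : Type*} [CommRing A] [CommRing B] [IsDomain B] [Algebra A B] [Algebra.IsIntegral A B]
    (hinj : Function.Injective (algebraMap A B)) : ringKrullDim B = ringKrullDim A := by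
  apply le_antisymm
  · refine Order.krullDim_le_of_strictMono (PrimeSpectrum.comap (algebraMap A B)) ?_
    intro P Q h
    exact Ideal.IsIntegral.comap_lt_comap (R := A) (I := P.asIdeal) (J := Q.asIdeal) h
  · refine iSup_le fun l => ?_
    have hover := Ideal.exists_ideal_over_prime_of_isIntegral_of_isDomain (S := B) (RelSeries.head l).asIdeal
      (by rw [(RingHom.injective_iff_ker_eq_bot _).1 hinj]; exact bot_le)
    obtain ⟨Q, hQ, hQl⟩ := hover
    have : Q.LiesOver (RelSeries.head l).asIdeal := ⟨hQl.symm⟩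
    obtain ⟨L, hL, -⟩ := Ideal.exists_ltSeries_of_hasGoingUp l Q
    rw [← hL]
    exact Order.LTSeries.length_le_krullDim L

/-- regular local ring with given regular system of parameters. -/
structure RLS {A : Type u} [CommRing A] {d : ℕ} (x : Fin d → A) : Prop where
  noeth : IsNoetherianRing A
  loc : IsLocalRing A
  max : maximalIdeal A = Ideal.span (Set.range x)
  dim : ringKrullDim A = d

theorem RLS.main {A : Type u} [CommRing A] {d : ℕ} {x : Fin d → A} (h : RLS x) :
    IsDomain A ∧ WReg ⊥ (List.ofFn x) ∧ CIC A ∧ ∀ a l', List.ofFn x = a :: l' → Prime a := by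
  have := h.noeth
  have := h.loc
  refine regloc d A (List.ofFn x) (by simp) h.dim ?_
  rw [h.max]
  unfold Ideal.ofList
  congr 1
  ext a
  simp [List.mem_ofFn]

variable {L : Type u} [Field L] (A : Subring L) {d : ℕ} {x : Fin d → A} (q : ℕ) (hq : 0 < q)
  (z : Fin d → L) (hz : ∀ i, z i ^ q = x i)

def Adjs : Subalgebra A L := Algebra.adjoin A (Set.range z)

variable {A z} 

theorem Adjs.mem (i : Fin d) : z i ∈ Adjs A z := Algebra.subset_adjoin ⟨i, rfl⟩

include hq hz in
theorem Adjs.finite : Module.Finite A (Adjs A z) := by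
  have := fg_adjoin_of_finite (R := A) (Set.finite_range z) (by
    rintro _ ⟨i, rfl⟩
    refine IsIntegral.of_pow hq ?_
    rw [hz]
    exact isIntegral_algebraMap (R := A) (x := x i))
  exact Module.Finite.of_fg this

variable (z) in
def Adjs.gen (i : Fin d) : Adjs A z := ⟨z i, Adjs.mem i⟩

include hq hz in
theorem RLS.adjs (h : RLS x) : RLS (Adjs.gen (A := A) z) := by
  have := h.noeth
  have hloc := h.loc
  have hfin := Adjs.finite q hq hz
  have hnoe : IsNoetherianRing (Adjs A z) := 
    IsNoetherianRing.of_finite A (Adjs A z)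
  have hIntg : Algebra.IsIntegral A (Adjs A z) := inferInstance
  have hinj : Function.Injective (algebraMap A (Adjs A z)) := FaithfulSMul.algebraMap_injective _ _
  have hdim : ringKrullDim (Adjs A z) = d := by rw [dim_integral hinj, h.dim]
  obtain ⟨J, hJ⟩ : ∃ J, J = Ideal.span (Set.range (Adjs.gen (A := A) z)) := ⟨_, rfl⟩
  have hgen : ∀ i, Adjs.gen (A := A) z i ∈ J := fun i => by rw [hJ]; exact Ideal.subset_span ⟨i, rfl⟩
  have hgp : ∀ i, Adjs.gen (A := A) z i ^ q = algebraMap A _ (x i) := fun i => Subtype.ext (hz i)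
  have hle : ∀ M : Ideal (Adjs A z), M.IsMaximal → J ≤ M := by
    intro M hM
    have h1 : (M.comap (algebraMap A (Adjs A z))).IsMaximal := Ideal.isMaximal_comap_of_isIntegral_of_isMaximal M
    have h2 := eq_maximalIdeal h1
    rw [hJ, Ideal.span_le]
    rintro _ ⟨i, rfl⟩
    refine hM.isPrime.mem_of_pow_mem q ?_
    rw [hgp]
    have : x i ∈ maximalIdeal A := by rw [h.max]; exact Ideal.subset_span ⟨i, rfl⟩
    rw [← h2] at this; exact this
  have hdec : ∀ w : Adjs A z, ∃ a : A, w - algebraMap A _ a ∈ J := by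
    rintro ⟨w, hw⟩
    refine Algebra.adjoin_induction (p := fun w hw => ∃ a : A, (⟨w, hw⟩ : Adjs A z) - algebraMap A _ a ∈ J)
      ?_ ?_ ?_ ?_ hw
    · rintro _ ⟨i, rfl⟩
      exact ⟨0, by rw [map_zero, sub_zero]; exact hgen i⟩
    · intro a
      refine ⟨a, ?_⟩
      have : (⟨algebraMap A L a, Subalgebra.algebraMap_mem _ a⟩ : Adjs A z) - algebraMap A _ a = 0 := sub_eq_zero.2 rfl
      rw [this]; exact J.zero_mem
    · rintro u v hu hv ⟨a, ha⟩ ⟨b, hb⟩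
      refine ⟨a + b, ?_⟩
      have := J.add_mem ha hb
      rw [map_add]
      convert this using 1
      have e : (⟨u + v, Subalgebra.add_mem _ hu hv⟩ : Adjs A z) = ⟨u, hu⟩ + ⟨v, hv⟩ := rfl
      rw [e]; ring
    · rintro u v hu hv ⟨a, ha⟩ ⟨b, hb⟩
      refine ⟨a * b, ?_⟩
      have := J.add_mem (J.mul_mem_right ⟨v, hv⟩ ha) (J.mul_mem_left (algebraMap A _ a) hb)
      rw [map_mul]
      convert this using 1
      have e : (⟨u * v, Subalgebra.mul_mem _ hu hv⟩ : Adjs A z) = ⟨u, hu⟩ * ⟨v, hv⟩ := rfl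
      rw [e]; ring
  obtain ⟨M0, hM0⟩ := Ideal.exists_maximal (Adjs A z)
  have hJmax : J.IsMaximal := by
    rw [Ideal.isMaximal_iff]
    refine ⟨fun h1 => hM0.ne_top ((Ideal.eq_top_iff_one _).2 (hle M0 hM0 h1)), ?_⟩
    intro K w hJK hwJ hwK
    obtain ⟨a, ha⟩ := hdec w
    have hau : IsUnit a := by
      by_contra hn
      have : a ∈ maximalIdeal A := hn
      apply hwJ
      have h3 : algebraMap A (Adjs A z) a ∈ J := by
        have h4 := Ideal.mem_map_of_mem (algebraMap A (Adjs A z)) this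
        rw [h.max, Ideal.map_span] at h4
        refine Ideal.span_le.2 ?_ h4
        rintro _ ⟨_, ⟨i, rfl⟩, rfl⟩
        rw [SetLike.mem_coe, ← hgp]
        exact J.pow_mem_of_mem (hgen i) q hq
      have := J.add_mem ha h3
      simpa using this
    have h5 : algebraMap A (Adjs A z) a ∈ K := by
      have := K.sub_mem hwK (hJK ha)
      simpa using this
    exact (Ideal.eq_top_iff_one _).1 (Ideal.eq_top_of_isUnit_mem _ h5 (hau.map _))
  have huniq : ∀ M : Ideal (Adjs A z), M.IsMaximal → M = J := fun M hM => (hJmax.eq_of_le hM.ne_top (hle M hM)).symm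
  have hl : IsLocalRing (Adjs A z) := IsLocalRing.of_unique_max_ideal ⟨J, hJmax, huniq⟩
  exact ⟨hnoe, hl, by rw [← hJ]; exact huniq _ (maximalIdeal.isMaximal _), hdim⟩
end AInf
end Part_AI1

section Part_AI2
set_option maxHeartbeats 1000000
set_option synthInstance.maxHeartbeats 400000
set_option linter.unusedSectionVars false
universe u

open IsLocalRing

section AInf2

theorem WReg.union {D : Type*} [CommRing D] (E : ℕ → Type*) [∀ n, CommRing (E n)] (f : ∀ n, E n →+* D)
    (hf : ∀ n, Function.Injective (f n))
    (hc : ∀ d, ∃ n0, ∀ n ≥ n0, ∃ e, f n e = d) (l : List D) :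
    ∀ (J : Ideal D) (Jn : ∀ n, Ideal (E n)) (ln : ∀ n, List (E n)),
      (∀ d ∈ J, ∃ n0, ∀ n ≥ n0, ∃ e ∈ Jn n, f n e = d) → (∀ n, ∀ e ∈ Jn n, f n e ∈ J) →
      (∀ n, (ln n).map (f n) = l) → (∀ n, WReg (Jn n) (ln n)) → WReg J l := by
  induction l with
  | nil => intros; trivial
  | cons a l ih =>
    intro J Jn ln hJ hJ' hl hW
    have h1 : ∀ n, ∃ b l', ln n = b :: l' ∧ f n b = a ∧ l'.map (f n) = l := by
      intro n
      have := hl n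
      cases h : ln n with
      | nil => rw [h] at this; simp at this
      | cons b l' =>
        rw [h, List.map_cons, List.cons.injEq] at this
        exact ⟨b, l', rfl, this⟩
    choose b l' h1 h2 h3 using h1
    have hW' : ∀ n, WReg (Jn n) (b n :: l' n) := fun n => by rw [← h1]; exact hW n
    refine ⟨fun d hd => ?_, ?_⟩
    · obtain ⟨n0, hn0⟩ := hJ _ hd
      obtain ⟨n1, hn1⟩ := hc d
      obtain ⟨e, he, he'⟩ := hn0 (max n0 n1) (le_max_left _ _)
      obtain ⟨c, hc⟩ := hn1 (max n0 n1) (le_max_right _ _)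
      rw [← hc]
      apply hJ'
      apply (hW' _).1
      have : b (max n0 n1) * c = e := hf _ (by rw [map_mul, h2, hc, he'])
      rw [this]; exact he
    · refine ih _ (fun n => Jn n ⊔ Ideal.span {b n}) l' ?_ ?_ h3 (fun n => (hW' n).2)
      · intro d hd
        obtain ⟨e, he⟩ := mem_sup_span_singleton.1 hd
        obtain ⟨n0, hn0⟩ := hJ _ he
        obtain ⟨n1, hn1⟩ := hc e
        refine ⟨max n0 n1, fun n hn => ?_⟩
        obtain ⟨s, hs, hs'⟩ := hn0 n (le_trans (le_max_left _ _) hn)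
        obtain ⟨c, hc⟩ := hn1 n (le_trans (le_max_right _ _) hn)
        refine ⟨s + b n * c, mem_sup_span_singleton.2 ⟨c, by simpa using hs⟩, ?_⟩
        rw [map_add, map_mul, hs', hc, h2]; ring
      · intro n e he
        obtain ⟨c, hc⟩ := mem_sup_span_singleton.1 he
        refine mem_sup_span_singleton.2 ⟨f n c, ?_⟩
        have := hJ' n _ hc
        rwa [map_sub, map_mul, h2] at this

theorem icl_mem {A L : Type*} [CommRing A] [IsDomain A] [IsIntegrallyClosed A] [Field L] [Algebra A L]
    (hinj : Function.Injective (algebraMap A L)) (u : L) (hu : IsIntegral A u) (c a : A) (hc : c ≠ 0)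
    (h : algebraMap A L c * u = algebraMap A L a) : ∃ b, algebraMap A L b = u := by
  have : FaithfulSMul A L := (faithfulSMul_iff_algebraMap_injective A L).2 hinj
  let _ : Algebra (FractionRing A) L := FractionRing.liftAlgebra A L
  have : IsScalarTower A (FractionRing A) L := inferInstance
  have hk : algebraMap (FractionRing A) L (algebraMap A _ a / algebraMap A _ c) = u := by
    rw [map_div₀, ← IsScalarTower.algebraMap_apply, ← IsScalarTower.algebraMap_apply, ← h,
      mul_div_cancel_left₀]
    rwa [Ne, map_eq_zero_iff _ hinj]
  rw [← hk, isIntegral_algebraMap_iff (algebraMap (FractionRing A) L).injective] at hu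
  obtain ⟨b, hb⟩ := IsIntegrallyClosed.isIntegral_iff.1 hu
  exact ⟨b, by rw [← hk, ← hb, ← IsScalarTower.algebraMap_apply]⟩

variable (p : ℕ) [Fact p.Prime] {L : Type u} [Field L] [CharZero L] (A : Subring L) {m : ℕ} (x : Fin (m + 1) → A)
  (xr : Fin (m + 1) → ℕ → L)

/-- finite level -/
abbrev AA (n : ℕ) : Subalgebra A L := Adjs A (fun i => xr i n)

variable {A x xr} 

theorem xr_pow (hxr : ∀ i n, xr i (n + 1) ^ p = xr i n) (i : Fin (m+1)) (k n : ℕ) :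
    xr i (k + n) ^ p ^ n = xr i k := by
  induction n with
  | zero => simp
  | succ n ih => rw [pow_succ', pow_mul, ← add_assoc, hxr, ih]

theorem AA.mono (hxr : ∀ i n, xr i (n + 1) ^ p = xr i n) : Monotone (AA A xr) := by
  refine monotone_nat_of_le_succ fun n => ?_
  refine Algebra.adjoin_le ?_
  rintro _ ⟨i, rfl⟩
  change xr i n ∈ AA A xr (n+1)
  rw [← hxr]
  exact Subalgebra.pow_mem _ (Adjs.mem (z := fun i => xr i (n+1)) i) p

/-- infinite level -/
def Ainf (A : Subring L) (xr : Fin (m + 1) → ℕ → L) (hxr : ∀ i n, xr i (n + 1) ^ p = xr i n) : Subring L where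
  carrier := {w | ∃ n, w ∈ AA A xr n}
  mul_mem' := by
    rintro a b ⟨n, hn⟩ ⟨k, hk⟩
    exact ⟨max n k, Subalgebra.mul_mem _ (AA.mono p hxr (le_max_left _ _) hn) (AA.mono p hxr (le_max_right _ _) hk)⟩
  add_mem' := by
    rintro a b ⟨n, hn⟩ ⟨k, hk⟩
    exact ⟨max n k, Subalgebra.add_mem _ (AA.mono p hxr (le_max_left _ _) hn) (AA.mono p hxr (le_max_right _ _) hk)⟩
  zero_mem' := ⟨0, Subalgebra.zero_mem _⟩
  one_mem' := ⟨0, Subalgebra.one_mem _⟩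
  neg_mem' := by
    rintro a ⟨n, hn⟩
    exact ⟨n, Subalgebra.neg_mem _ hn⟩

variable (hxr : ∀ i n, xr i (n + 1) ^ p = xr i n) (hxr0 : ∀ i, xr i 0 = x i) (hp0 : x 0 = p) (hA : RLS x)

def Ainf.incl : A →+* Ainf p A xr hxr where
  toFun a := ⟨a, 0, Subalgebra.algebraMap_mem _ a⟩
  map_one' := rfl
  map_mul' _ _ := rfl
  map_zero' := rfl
  map_add' _ _ := rfl

def Ainf.f (n : ℕ) : AA A xr n →+* Ainf p A xr hxr where
  toFun a := ⟨a, n, a.2⟩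
  map_one' := rfl
  map_mul' _ _ := rfl
  map_zero' := rfl
  map_add' _ _ := rfl

theorem Ainf.f_inj (n : ℕ) : Function.Injective (Ainf.f p (A := A) hxr n) := by
  intro a b h
  have : ((Ainf.f p hxr n a : Ainf p A xr hxr) : L) = Ainf.f p hxr n b := by rw [h]
  exact Subtype.ext this

theorem Ainf.cover (d : Ainf p A xr hxr) : ∃ n0, ∀ n ≥ n0, ∃ e, Ainf.f p hxr n e = d := by
  obtain ⟨w, n0, hw⟩ := d
  exact ⟨n0, fun n hn => ⟨⟨w, AA.mono p hxr hn hw⟩, rfl⟩⟩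

/-- roots in Ainf -/
def Ainf.rt (i : Fin (m+1)) (n : ℕ) : Ainf p A xr hxr := ⟨xr i n, n, Adjs.mem (z := fun i => xr i n) i⟩

include hxr hxr0 hA in
theorem AA.rls (n : ℕ) : RLS (Adjs.gen (A := A) (fun i => xr i n)) := by
  refine RLS.adjs (p ^ n) (pow_pos (Fact.out : p.Prime).pos n) (fun i => ?_) hA
  have := xr_pow p hxr i 0 n
  rw [zero_add, hxr0] at this
  exact this

include hxr in
theorem AA.gen_pow (n : ℕ) (i : Fin (m+1)) (hxr0 : ∀ i, xr i 0 = x i) :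
    (Adjs.gen (A := A) (fun i => xr i n) i) ^ p ^ n = algebraMap A (AA A xr n) (x i) := by
  apply Subtype.ext
  have := xr_pow p hxr i 0 n
  rw [zero_add, hxr0] at this
  exact this

include hxr hxr0 hA in
theorem Ainf.wreg : WReg ⊥ (List.ofFn fun i => Ainf.incl p hxr (x i)) := by
  refine WReg.union (fun n => AA A xr n) (Ainf.f p hxr) (Ainf.f_inj p hxr) (Ainf.cover p hxr) _ ⊥ (fun n => ⊥)
    (fun n => (List.ofFn (Adjs.gen (A := A) (fun i => xr i n))).map (· ^ (p ^ n))) ?_ ?_ ?_ ?_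
  · intro d hd
    exact ⟨0, fun n _ => ⟨0, Ideal.zero_mem _, by rw [map_zero]; exact hd.symm⟩⟩
  · intro n e he
    rw [Ideal.mem_bot] at he
    rw [he, map_zero]; exact Ideal.zero_mem _
  · intro n
    rw [List.map_map, List.map_ofFn]
    congr 1
    ext i
    change ((Adjs.gen (A := A) (fun i => xr i n) i ^ p ^ n : AA A xr n) : L) = _
    rw [AA.gen_pow p hxr n i hxr0]; rfl
  · intro n
    exact WReg.pow _ _ _ (AA.rls p hxr hxr0 hA n).main.2.1

include hxr hxr0 hA in
theorem Ainf.hx (hp0 : x 0 = p) : WReg (⊥ : Ideal (ModP (Ainf p A xr hxr) p))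
    (List.ofFn fun k : Fin m => Ideal.Quotient.mk _ (Ainf.incl p hxr (x k.succ))) := by
  have h := Ainf.wreg p hxr hxr0 hA
  rw [List.ofFn_succ] at h
  have h2 := h.2
  rw [bot_sup_eq, hp0, map_natCast] at h2
  have h3 := WReg.of_surjective (Ideal.Quotient.mk (Ideal.span {((p : ℕ) : Ainf p A xr hxr)}))
    Ideal.Quotient.mk_surjective _ ⊥ (by rwa [← RingHom.ker_eq_comap_bot, Ideal.mk_ker])
  rwa [List.map_ofFn] at h3

include hxr hxr0 hA in
theorem AA.normal (n : ℕ) : IsIntegrallyClosed (AA A xr n) :=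
  (AA.rls p hxr hxr0 hA n).main.2.2.1.isIntegrallyClosed

include hxr hxr0 hA in
theorem Ainf.hg (hp0 : x 0 = p) (g : A) (hg : ¬ (p : A) ∣ g) : WReg (⊥ : Ideal (ModP (Ainf p A xr hxr) p))
    (Ideal.Quotient.mk _ (Ainf.incl p hxr g) :: []) := by
  have hnA : IsIntegrallyClosed A := hA.main.2.2.1.isIntegrallyClosed
  have hpA : Prime (x 0) := hA.main.2.2.2 (x 0) (List.ofFn fun i : Fin m => x i.succ) (by rw [List.ofFn_succ])
  have h : WReg ⊥ (Ainf.incl p hxr (x 0) :: Ainf.incl p hxr g :: []) := by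
    refine WReg.union (fun n => AA A xr n) (Ainf.f p hxr) (Ainf.f_inj p hxr) (Ainf.cover p hxr) _ ⊥ (fun n => ⊥)
      (fun n => (Adjs.gen (A := A) (fun i => xr i n) 0) ^ (p ^ n) :: algebraMap A (AA A xr n) g :: []) ?_ ?_ ?_ ?_
    · intro d hd
      exact ⟨0, fun n _ => ⟨0, Ideal.zero_mem _, by rw [map_zero]; exact hd.symm⟩⟩
    · intro n e he
      rw [Ideal.mem_bot] at he
      rw [he, map_zero]; exact Ideal.zero_mem _
    · intro n
      rw [List.map_cons, List.map_cons, List.map_nil, AA.gen_pow p hxr n 0 hxr0]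
      rfl
    · intro n
      apply WReg.pow_head
      obtain ⟨hd, -, -, hpr⟩ := (AA.rls p hxr hxr0 hA n).main
      have hP := hpr _ _ (List.ofFn_succ (f := Adjs.gen (A := A) (fun i => xr i n)))
      refine ⟨fun d hd => ?_, fun d hd => ?_, trivial⟩
      · rw [Ideal.mem_bot] at hd ⊢
        exact (mul_eq_zero.1 hd).resolve_left hP.ne_zero
      · rw [bot_sup_eq, Ideal.mem_span_singleton] at hd ⊢
        refine (hP.dvd_or_dvd hd).resolve_left ?_
        rintro ⟨w, hw⟩
        have h1 := congrArg (· ^ p ^ n) hw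
        simp only [mul_pow] at h1
        rw [AA.gen_pow p hxr n 0 hxr0, ← map_pow] at h1
        have hfin := Adjs.finite (A := A) (z := fun i => xr i n) (x := x) (p ^ n) (pow_pos (Fact.out : p.Prime).pos n) (fun i => by
          have := xr_pow p hxr i 0 n
          rw [zero_add, hxr0] at this
          exact this)
        have hIntg : Algebra.IsIntegral A (Adjs A (fun i => xr i n)) := inferInstance
        have hwi : IsIntegral A ((w : L) ^ p ^ n) := ((hIntg.isIntegral w).map (Subalgebra.val _)).pow _
        obtain ⟨b, hb⟩ := icl_mem (A := A) (L := L) Subtype.val_injective ((w : L) ^ p ^ n) hwi (x 0) (g ^ p ^ n) hpA.ne_zero (by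
          have := congrArg (Subtype.val) h1
          exact this.symm)
        apply hg
        rw [← hp0]
        apply hpA.dvd_of_dvd_pow (n := p ^ n)
        refine ⟨b, Subtype.ext ?_⟩
        have := congrArg (Subtype.val) h1
        change ((g ^ p ^ n : A) : L) = (x 0 : L) * (b : L)
        have hb' : (b : L) = (w : L) ^ p ^ n := hb
        rw [hb']
        exact this
  have h2 := h.2
  rw [bot_sup_eq, hp0, map_natCast] at h2
  exact WReg.of_surjective (Ideal.Quotient.mk (Ideal.span {((p : ℕ) : Ainf p A xr hxr)}))
    Ideal.Quotient.mk_surjective _ ⊥ (by rwa [← RingHom.ker_eq_comap_bot, Ideal.mk_ker])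

include hxr hxr0 hA in
theorem Ainf.tiltable (hp0 : x 0 = p) (hA2 : ∀ a : A, ∃ (b : (Fin (m+1) → Fin p) → A) (c : A),
      a = ∑ k, (∏ i, x i ^ (k i : ℕ)) * (b k) ^ p + p * c) :
    Tiltable p (Ainf p A xr hxr) (Ainf.rt p hxr 0) := by
  have hnu : ¬ IsUnit ((p : ℕ) : Ainf p A xr hxr) := by
    intro h
    obtain ⟨v, hv⟩ := h.exists_right_inv
    obtain ⟨n, hn⟩ := Ainf.cover p hxr v
    obtain ⟨e, rfl⟩ := hn n le_rfl
    have hr := AA.rls p hxr hxr0 hA n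
    have := hr.loc
    have h1 : (p : AA A xr n) * e = 1 := Ainf.f_inj p hxr n (by rw [map_mul, map_natCast, hv, map_one])
    have h2 : Adjs.gen (A := A) (fun i => xr i n) 0 ∈ maximalIdeal _ := by
      rw [hr.max]; exact Ideal.subset_span ⟨0, rfl⟩
    have h3 : (p : AA A xr n) = (Adjs.gen (A := A) (fun i => xr i n) 0) ^ p ^ n := by
      rw [AA.gen_pow p hxr n 0 hxr0, hp0, map_natCast]
    rw [h3] at h1
    have h4 : IsUnit (Adjs.gen (A := A) (fun i => xr i n) 0) :=
      (isUnit_pow_iff (pow_pos (Fact.out : p.Prime).pos n).ne').1 (IsUnit.of_mul_eq_one _ h1)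
    exact h2 h4
  have : Fact (¬ IsUnit ((p : ℕ) : Ainf p A xr hxr)) := ⟨hnu⟩
  have hprs : ∀ i n, Ainf.rt p hxr (A := A) i (n+1) ^ p = Ainf.rt p hxr i n := fun i n => Subtype.ext (hxr i n)
  have hp00 : xr 0 0 = p := by rw [hxr0, hp0]; simp
  refine ⟨hnu, ?_, Subtype.ext ?_, hprs 0, ?_, ?_⟩
  · intro h
    have := congrArg (Subtype.val) h
    have h2 : ((p : ℕ) : L) = 0 := by simpa using this
    exact (Fact.out : p.Prime).ne_zero (by exact_mod_cast h2)
  · change xr 0 0 = _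
    rw [hp00]; simp
  · -- frobenius
    let S : Subring (Ainf p A xr hxr) := (frobenius (ModP (Ainf p A xr hxr) p) p).range.comap (Ideal.Quotient.mk _)
    have hS : ∀ a, a ∈ S ↔ ∃ b c, a - b ^ p = p * c := by
      intro a
      constructor
      · rintro ⟨b, hb⟩
        obtain ⟨b, rfl⟩ := Ideal.Quotient.mk_surjective b
        rw [frobenius_def, ← map_pow, eq_comm] at hb
        obtain ⟨c, hc⟩ := Ideal.mem_span_singleton.1 (Ideal.Quotient.eq.1 hb)
        exact ⟨b, c, hc⟩
      · rintro ⟨b, c, h⟩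
        refine ⟨Ideal.Quotient.mk _ b, ?_⟩
        rw [frobenius_def, ← map_pow, eq_comm]
        exact Ideal.Quotient.eq.2 (Ideal.mem_span_singleton.2 ⟨c, h⟩)
    have hpow : ∀ a : Ainf p A xr hxr, a ^ p ∈ S := fun a => (hS _).2 ⟨a, 0, by ring⟩
    have hSp : ∀ a : Ainf p A xr hxr, (p : Ainf p A xr hxr) * a ∈ S := fun a => (hS _).2 ⟨0, a, by
      rw [zero_pow (Fact.out : p.Prime).ne_zero, sub_zero]⟩
    have hrt : ∀ i n, Ainf.rt p hxr (A := A) i n ∈ S := fun i n => by rw [← hprs]; exact hpow _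
    have hSA : ∀ a : A, Ainf.incl p hxr a ∈ S := by
      intro a
      obtain ⟨b, c, h⟩ := hA2 a
      rw [h, map_add, map_mul, map_natCast, map_sum]
      refine S.add_mem (S.sum_mem fun k _ => ?_) (hSp _)
      rw [map_mul, map_pow, map_prod]
      refine S.mul_mem (S.prod_mem fun i _ => ?_) (hpow _)
      rw [map_pow]
      have : Ainf.incl p hxr (x i) = Ainf.rt p hxr i 0 := Subtype.ext (hxr0 i).symm
      rw [this]
      exact S.pow_mem (hrt _ _) _
    rintro ⟨w, n, hw⟩
    rw [← hS]
    refine Algebra.adjoin_induction (p := fun w hw => (⟨w, n, hw⟩ : Ainf p A xr hxr) ∈ S) ?_ ?_ ?_ ?_ hw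
    · rintro _ ⟨i, rfl⟩
      exact hrt i n
    · intro a
      exact hSA a
    · intro u v hu hv h1 h2
      exact S.add_mem h1 h2
    · intro u v hu hv h1 h2
      exact S.mul_mem h1 h2
  · rintro a k ⟨w, hw⟩
    obtain ⟨n0, hn0⟩ := Ainf.cover p hxr a
    obtain ⟨n1, hn1⟩ := Ainf.cover p hxr w
    obtain ⟨n2, hn2⟩ := Ainf.cover p hxr (Ainf.rt p hxr 0 (k+1))
    obtain ⟨N, hN0, hN1, hN2⟩ : ∃ N, n0 ≤ N ∧ n1 ≤ N ∧ n2 ≤ N := ⟨n0 + n1 + n2, by omega, by omega, by omega⟩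
    obtain ⟨a, rfl⟩ := hn0 N hN0
    obtain ⟨w, rfl⟩ := hn1 N hN1
    obtain ⟨r, hr⟩ := hn2 N hN2
    have := AA.normal p hxr hxr0 hA N
    have h1 : r ^ p ∣ a ^ p := ⟨w, Ainf.f_inj p hxr N (by
      rw [map_mul, map_pow, map_pow, hr, hprs, hw])⟩
    rw [IsIntegrallyClosed.pow_dvd_pow_iff (Fact.out : p.Prime).ne_zero] at h1
    rw [← hr]
    exact map_dvd _ h1
end AInf2
end Part_AI2

section Part_ET1
set_option maxHeartbeats 1000000
set_option synthInstance.maxHeartbeats 400000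
set_option linter.unusedSectionVars false
universe u

open IsLocalRing Polynomial

section ET1

theorem discr_unit_mem {E K M : Type*} [CommRing E] [IsDomain E] [IsIntegrallyClosed E] [Field K] [Field M] [Algebra E K]
    [IsFractionRing E K] [Algebra K M] [Algebra E M] [IsScalarTower E K M] [Module.Finite K M] [Algebra.IsSeparable K M]
    (B : PowerBasis K M) (hIntg : IsIntegral E B.gen) (v : M) (hv : IsIntegral E v)
    (h : aeval B.gen (minpoly K B.gen).derivative * v = 1) (w : M) (hw : IsIntegral E w) :
    w ∈ Algebra.adjoin E ({B.gen} : Set M) := by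
  have h1 := Algebra.discr_mul_isIntegral_mem_adjoin K hIntg hw
  rw [Algebra.discr_powerBasis_eq_norm] at h1
  have h2 : Algebra.norm K (aeval B.gen (minpoly K B.gen).derivative) * Algebra.norm K v = 1 := by
    rw [← map_mul, h, map_one]
  have h3 : IsIntegral E (Algebra.norm K v) := Algebra.isIntegral_norm K hv
  obtain ⟨c, hc⟩ := IsIntegrallyClosed.isIntegral_iff.1 h3
  rw [← hc] at h2
  have h4 := Subalgebra.smul_mem _ h1 ((-1) ^ (Module.finrank K M * (Module.finrank K M - 1) / 2) * c : E)
  convert h4 using 1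
  rw [← algebraMap_smul K (_ * c) , smul_smul, map_mul, map_pow, map_neg, map_one]
  generalize Module.finrank K M * (Module.finrank K M - 1) / 2 = k
  have h5 : ((-1 : K) ^ k) * (-1) ^ k = 1 := by rw [← mul_pow]; simp
  have : ((-1 : K)) ^ k * (algebraMap E K) c *
      ((-1) ^ k * (Algebra.norm K) ((aeval B.gen) (derivative (minpoly K B.gen)))) = 1 := by
    linear_combination (((-1 : K) ^ k) * (-1) ^ k) * h2 + h5
  rw [this, one_smul]

variable {E L : Type*} [CommRing E] [IsDomain E] [Field L] [CharZero L] [Algebra E L]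
  [FaithfulSMul E L] 

theorem adj_integral (z : L) (hz : IsIntegral E z) (w : L) (hw : w ∈ Algebra.adjoin E {z}) : IsIntegral E w := by
  have : Algebra.adjoin E {z} ≤ integralClosure E L := Algebra.adjoin_le (by rw [Set.singleton_subset_iff]; exact hz)
  exact this hw

variable [IsIntegrallyClosed E]
theorem step_dvd (z : L) (f : E[X]) (hf : f.Monic) (hz : aeval z f = 0) (u : L) (hu : u ∈ Algebra.adjoin E {z})
    (h : aeval z f.derivative * u = 1) :
    ∃ v ∈ Algebra.adjoin E {z}, aeval z (minpoly E z).derivative * v = 1 := by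
  have hi : IsIntegral E z := ⟨f, hf, hz⟩
  obtain ⟨q, hq⟩ := minpoly.isIntegrallyClosed_dvd hi hz
  refine ⟨aeval z q * u, Subalgebra.mul_mem _ (aeval_mem_adjoin_singleton _ _) hu, ?_⟩
  rw [hq, derivative_mul, map_add, map_mul, map_mul, minpoly.aeval] at h
  rw [← h]; ring

theorem step_mem (z : L) (hz : IsIntegral E z) 
    (hv : ∃ v ∈ Algebra.adjoin E {z}, aeval z (minpoly E z).derivative * v = 1) (w : L) (hw : IsIntegral E w)
    (hw2 : ∃ s ∈ Algebra.adjoin E {z}, ∃ t ∈ Algebra.adjoin E {z}, t ≠ 0 ∧ t * w = s) : 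
    w ∈ Algebra.adjoin E {z} := by
  obtain ⟨v, hv, hv'⟩ := hv
  obtain ⟨s, hs, t, ht, ht0, hst⟩ := hw2
  let K := FractionRing E
  let _ : Algebra K L := FractionRing.liftAlgebra E L
  have hz' : IsIntegral K z := hz.tower_top
  have hsub : ∀ a ∈ Algebra.adjoin E {z}, a ∈ IntermediateField.adjoin K {z} := by
    intro a ha
    have : Algebra.adjoin E {z} ≤ (IntermediateField.adjoin K {z}).toSubalgebra.restrictScalars E := by
      refine Algebra.adjoin_le ?_
      rw [Set.singleton_subset_iff]
      exact IntermediateField.mem_adjoin_simple_self K z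
    exact this ha
  have hwm : w ∈ IntermediateField.adjoin K {z} := by
    have : w = s / t := by rw [← hst]; field_simp
    rw [this]
    exact div_mem (hsub _ hs) (hsub _ ht)
  have hvm := hsub v hv
  let M := IntermediateField.adjoin K {z}
  have hfd : FiniteDimensional K M := IntermediateField.adjoin.finiteDimensional hz'
  have : CharZero K := (algebraMap K L).charZero
  have htow : IsScalarTower E M L := IsScalarTower.of_algebraMap_eq fun e => by
    rw [IsScalarTower.algebraMap_apply E K L, IsScalarTower.algebraMap_apply E K M]; rfl
  have hB : ((IntermediateField.adjoin.powerBasis hz').gen : L) = z := by simp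
  have hinj : Function.Injective (algebraMap M L) := (algebraMap M L).injective
  have hIntg : ∀ a : M, IsIntegral E (a : L) → IsIntegral E a := fun a ha =>
    (isIntegral_algebraMap_iff hinj).1 ha
  have key := discr_unit_mem (E := E) (K := K) (M := M) (IntermediateField.adjoin.powerBasis hz')
    (hIntg _ (by rw [hB]; exact hz)) ⟨v, hvm⟩ (hIntg _ (adj_integral z hz v hv)) (by
      apply hinj
      rw [map_mul, map_one, ← aeval_algebraMap_apply]
      change aeval (((IntermediateField.adjoin.powerBasis hz').gen : M) : L) _ * v = 1
      rw [hB, ← minpoly.algebraMap_eq hinj]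
      change aeval z (minpoly K (((IntermediateField.adjoin.powerBasis hz').gen : M) : L)).derivative * v = 1
      rw [hB, minpoly.isIntegrallyClosed_eq_field_fractions' K hz, derivative_map, aeval_map_algebraMap, hv'])
    ⟨w, hwm⟩ (hIntg _ hw)
  have := (Subalgebra.mem_map (f := IsScalarTower.toAlgHom E M L)).2 ⟨_, key, rfl⟩
  rw [AlgHom.map_adjoin, Set.image_singleton] at this
  change w ∈ Algebra.adjoin E {(((IntermediateField.adjoin.powerBasis hz').gen : M) : L)} at this
  rwa [hB] at this

theorem etale_adjoinRoot {E : Type*} [CommRing E] (f : E[X]) (hf : f.Monic) (q r : E[X]) (h : derivative f * q + f * r = 1) :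
    Algebra.Etale E (AdjoinRoot f) := by
  let P : StandardEtalePair E := ⟨f, hf, 1, q, r, 0, by rw [h, pow_zero]⟩
  have hm : P.HasMap (AdjoinRoot.root f) := ⟨by simp [P], by simp [P]⟩
  have hX : eval₂ ((Algebra.ofId E P.Ring : E →ₐ[E] P.Ring) : E →+* P.Ring) P.X f = 0 := (P.hasMap_X).1
  obtain ⟨φ, hφ⟩ : ∃ φ : AdjoinRoot f →ₐ[E] P.Ring, φ (AdjoinRoot.root f) = P.X :=
    ⟨AdjoinRoot.liftAlgHom f (Algebra.ofId _ _) P.X hX, AdjoinRoot.liftAlgHom_root _ _ _ _⟩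
  refine Algebra.Etale.of_equiv (A := P.Ring) (AlgEquiv.ofAlgHom (P.lift (AdjoinRoot.root f) hm) φ ?_ ?_)
  · apply AdjoinRoot.algHom_ext
    rw [AlgHom.comp_apply, hφ, StandardEtalePair.lift_X]; rfl
  · apply StandardEtalePair.hom_ext
    rw [AlgHom.comp_apply, StandardEtalePair.lift_X, hφ]; rfl

theorem step_etale (z : L) (hz : IsIntegral E z) 
    (hv : ∃ v ∈ Algebra.adjoin E {z}, aeval z (minpoly E z).derivative * v = 1) :
    Algebra.Etale E (Algebra.adjoin E {z}) ∧ Module.Finite E (Algebra.adjoin E {z}) := by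
  obtain ⟨v, hv, hv'⟩ := hv
  rw [Algebra.adjoin_singleton_eq_range_aeval] at hv
  obtain ⟨q, rfl⟩ := hv
  obtain ⟨r, hr⟩ := minpoly.isIntegrallyClosed_dvd (p := 1 - (minpoly E z).derivative * q) hz (by
    rw [map_sub, map_mul, map_one]
    change 1 - aeval z (minpoly E z).derivative * aeval z q = 0
    have : aeval z (minpoly E z).derivative * aeval z q = 1 := hv'
    rw [this, sub_self])
  have h1 : derivative (minpoly E z) * q + minpoly E z * r = 1 := by rw [← hr]; ring
  have h2 := etale_adjoinRoot _ (minpoly.monic hz) _ _ h1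
  have h3 := (minpoly.monic hz).finite_adjoinRoot
  exact ⟨Algebra.Etale.of_equiv (minpoly.equivAdjoin hz), Module.Finite.equiv (minpoly.equivAdjoin hz).toLinearEquiv⟩

theorem icl_of {E L : Type*} [CommRing E] [IsDomain E] [Field L] [Algebra E L] [FaithfulSMul E L]
    (h : ∀ w : L, IsIntegral E w → (∃ s t : E, t ≠ 0 ∧ algebraMap E L t * w = algebraMap E L s) → ∃ e, algebraMap E L e = w) :
    IsIntegrallyClosed E := by
  let _ : Algebra (FractionRing E) L := FractionRing.liftAlgebra E L
  rw [isIntegrallyClosed_iff (FractionRing E)]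
  intro k hk
  obtain ⟨s, t, ht, rfl⟩ := IsFractionRing.div_surjective (A := E) k
  have ht0 : t ≠ 0 := nonZeroDivisors.ne_zero ht
  obtain ⟨e, he⟩ := h (algebraMap _ L (algebraMap E (FractionRing E) s / algebraMap E _ t)) (hk.algebraMap) ⟨s, t, ht0, by
    rw [map_div₀, ← IsScalarTower.algebraMap_apply, ← IsScalarTower.algebraMap_apply]
    have : algebraMap E L t ≠ 0 := by simpa using ht0
    field_simp⟩
  refine ⟨e, (algebraMap (FractionRing E) L).injective ?_⟩
  rw [← he, ← IsScalarTower.algebraMap_apply]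

end ET1
end Part_ET1

section Part_ET2
set_option maxHeartbeats 1000000
set_option synthInstance.maxHeartbeats 400000
set_option linter.unusedSectionVars false
universe u

open IsLocalRing Polynomial

section ET2

variable {L : Type u} [Field L] [CharZero L]

/-- adjoin one element -/
def Adj (E : Subring L) (z : L) : Subring L := (Algebra.adjoin E {z}).toSubring

theorem Adj.mem_iff (E : Subring L) (z w : L) : w ∈ Adj E z ↔ w ∈ Algebra.adjoin E {z} := Iff.rfl

theorem Adj.le (E : Subring L) (z : L) : E ≤ Adj E z := fun w hw =>
  Subalgebra.algebraMap_mem (Algebra.adjoin E {z}) (⟨w, hw⟩ : E)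

theorem Adj.self (E : Subring L) (z : L) : z ∈ Adj E z := Algebra.subset_adjoin rfl

theorem Adj.le_of {E S : Subring L} {z : L} (h : E ≤ S) (hz : z ∈ S) : Adj E z ≤ S := by
  intro w hw
  refine Algebra.adjoin_induction (p := fun w _ => w ∈ S) ?_ ?_ ?_ ?_ hw
  · rintro _ rfl; exact hz
  · intro r; exact h r.2
  · intro a b _ _ ha hb; exact S.add_mem ha hb
  · intro a b _ _ ha hb; exact S.mul_mem ha hb

/-- separable step -/
def Stp (E : Subring L) (z : L) : Prop :=
  ∃ f : E[X], f.Monic ∧ aeval z f = 0 ∧ ∃ u ∈ Adj E z, aeval z f.derivative * u = 1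

theorem Adj.mono {E E' : Subring L} (h : E ≤ E') (z : L) : Adj E z ≤ Adj E' z :=
  Adj.le_of (h.trans (Adj.le _ _)) (Adj.self _ _)

theorem aeval_incl {E E' : Subring L} (h : E ≤ E') (z : L) (f : E[X]) :
    aeval z (f.map (Subring.inclusion h)) = aeval z f := by
  rw [aeval_def, eval₂_map, aeval_def]; rfl

theorem Stp.mono {E E' : Subring L} (h : E ≤ E') {z : L} (hz : Stp E z) : Stp E' z := by
  obtain ⟨f, hf, h0, u, hu, hu'⟩ := hz
  refine ⟨f.map (Subring.inclusion h), hf.map _, by rw [aeval_incl, h0], u, Adj.mono h z hu, ?_⟩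
  rw [derivative_map, aeval_incl, hu']

inductive Adm (E0 : Subring L) : Subring L → Prop
  | base : Adm E0 E0
  | step (E : Subring L) (z : L) (hE : Adm E0 E) (hz : Stp E z) : Adm E0 (Adj E z)

variable {E0 : Subring L}

theorem Adm.le {E : Subring L} (h : Adm E0 E) : E0 ≤ E := by
  induction h with
  | base => exact le_rfl
  | step E z hE hz ih => exact ih.trans (Adj.le _ _)

theorem Adm.sup {E E' : Subring L} (h : Adm E0 E) (h' : Adm E0 E') : Adm E0 (E ⊔ E') := by
  induction h' with
  | base => rw [sup_eq_left.2 h.le]; exact h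
  | step E' z hE hz ih =>
    have : E ⊔ Adj E' z = Adj (E ⊔ E') z := by
      apply le_antisymm
      · exact sup_le (le_sup_left.trans (Adj.le _ _)) (Adj.mono le_sup_right z)
      · exact Adj.le_of (sup_le_sup_left (Adj.le _ _) _) ((le_sup_right : Adj E' z ≤ E ⊔ Adj E' z) (Adj.self _ _))
    rw [this]
    exact Adm.step _ _ ih (hz.mono le_sup_right)

theorem Stp.integral {E : Subring L} {z : L} (h : Stp E z) : IsIntegral E z := by
  obtain ⟨f, hf, h0, -⟩ := h
  exact ⟨f, hf, h0⟩

theorem Stp.min {E : Subring L} [IsIntegrallyClosed E] {z : L} (h : Stp E z) : 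
    ∃ v ∈ Algebra.adjoin E {z}, aeval z (minpoly E z).derivative * v = 1 := by
  obtain ⟨f, hf, h0, u, hu, hu'⟩ := h
  exact step_dvd z f hf h0 u hu hu'

theorem Stp.mem {E : Subring L} [IsIntegrallyClosed E] {z : L} (h : Stp E z) (w : L) (hw : IsIntegral E w)
    (hw2 : ∃ s ∈ Adj E z, ∃ t ∈ Adj E z, t ≠ 0 ∧ t * w = s) : w ∈ Adj E z :=
  step_mem z h.integral h.min w hw hw2

theorem Stp.normal {E : Subring L} [IsIntegrallyClosed E] {z : L} (h : Stp E z) : IsIntegrallyClosed (Adj E z) := by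
  refine icl_of (L := L) fun w hw hst => ?_
  obtain ⟨s, t, ht, hst⟩ := hst
  have hw' : IsIntegral E w := by
    have : Algebra.IsIntegral E (Algebra.adjoin E {z}) := ⟨fun a => 
      (isIntegral_algebraMap_iff (B := L) Subtype.val_injective).1 (adj_integral z h.integral a a.2)⟩
    exact isIntegral_trans (R := E) (A := Algebra.adjoin E {z}) w hw
  exact ⟨⟨w, h.mem w hw' ⟨s, s.2, t, t.2, fun h => ht (Subtype.ext h), hst⟩⟩, rfl⟩

theorem Adm.normal [IsIntegrallyClosed E0] {E : Subring L} (h : Adm E0 E) : IsIntegrallyClosed E := by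
  induction h with
  | base => infer_instance
  | step E z hE hz ih => exact hz.normal

theorem Adm.etale [IsIntegrallyClosed E0] {E : Subring L} (h : Adm E0 E) :
    ∃ h0 : E0 ≤ E, (Subring.inclusion h0).Etale ∧ (Subring.inclusion h0).Finite := by
  induction h with
  | base => exact ⟨le_rfl, RingHom.Etale.of_bijective Function.bijective_id, RingHom.Finite.id _⟩
  | step E z hE hz ih =>
    obtain ⟨h0, h1, h2⟩ := ih
    have := hE.normal
    obtain ⟨h3, h4⟩ := step_etale z hz.integral hz.min
    have h3' : (algebraMap E (Algebra.adjoin E {z})).Etale := RingHom.etale_algebraMap.2 h3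
    have h4' : (algebraMap E (Algebra.adjoin E {z})).Finite := RingHom.finite_algebraMap.2 h4
    exact ⟨h0.trans (Adj.le _ _), RingHom.Etale.stableUnderComposition _ _ h1 h3', h4'.comp h2⟩

/-- localization inside L -/
def Loc (S : Subring L) (a : L) (ha : a ∈ S) : Subring L where
  carrier := {w | ∃ n : ℕ, a ^ n * w ∈ S}
  mul_mem' := by
    rintro x y ⟨n, hn⟩ ⟨k, hk⟩
    exact ⟨n + k, by convert S.mul_mem hn hk using 1; ring⟩
  add_mem' := by
    rintro x y ⟨n, hn⟩ ⟨k, hk⟩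
    exact ⟨n + k, by
      convert S.add_mem (S.mul_mem (S.pow_mem ha k) hn) (S.mul_mem (S.pow_mem ha n) hk) using 1; ring⟩
  zero_mem' := ⟨0, by simp⟩
  one_mem' := ⟨0, by simp⟩
  neg_mem' := by
    rintro x ⟨n, hn⟩
    exact ⟨n, by convert S.neg_mem hn using 1; ring⟩

theorem Loc.le (S : Subring L) (a : L) (ha : a ∈ S) : S ≤ Loc S a ha := fun w hw => ⟨0, by simpa using hw⟩

theorem Loc.inv (S : Subring L) (a : L) (ha : a ∈ S) (h0 : a ≠ 0) : a⁻¹ ∈ Loc S a ha := 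
  ⟨1, by rw [pow_one, mul_inv_cancel₀ h0]; exact S.one_mem⟩

theorem Loc.le_of (S : Subring L) (a : L) (ha : a ∈ S) (h0 : a ≠ 0) (S' : Subring L) (h : S ≤ S') (ha' : a⁻¹ ∈ S') :
    Loc S a ha ≤ S' := by
  rintro w ⟨n, hn⟩
  have : w = a⁻¹ ^ n * (a ^ n * w) := by
    rw [← mul_assoc, ← mul_pow, inv_mul_cancel₀ h0, one_pow, one_mul]
  rw [this]
  exact S'.mul_mem (S'.pow_mem ha' _) (h hn)

/-- clearing denominators in integral equations -/
theorem Loc.integral (S : Subring L) (a : L) (ha : a ∈ S) (w : L) (hw : IsIntegral (Loc S a ha) w) :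
    ∃ n : ℕ, IsIntegral S (a ^ n * w) := by
  obtain ⟨f, hf, h0⟩ := hw
  have hc : ∀ i, ∃ n : ℕ, a ^ n * (f.coeff i : L) ∈ S := fun i => (f.coeff i).2
  choose n hn using hc
  set N := ∑ i ∈ Finset.range (f.natDegree), n i with hN
  have hcoef : ∀ i, i < f.natDegree → (a ^ N) ^ (f.natDegree - i) * (f.coeff i : L) ∈ S := by
    intro i hi
    have h1 : n i ≤ N := Finset.single_le_sum (f := n) (fun _ _ => Nat.zero_le _) (Finset.mem_range.2 hi)
    obtain ⟨k, hk⟩ := Nat.exists_eq_add_of_le h1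
    obtain ⟨j, hj⟩ : ∃ j, f.natDegree - i = j + 1 := ⟨f.natDegree - i - 1, by omega⟩
    rw [hj, pow_succ]
    have : (a ^ N) ^ j * a ^ N * (f.coeff i : L) = (a ^ N) ^ j * a ^ k * (a ^ n i * f.coeff i) := by
      rw [hk]; ring
    rw [this]
    exact S.mul_mem (S.mul_mem (S.pow_mem (S.pow_mem ha _) _) (S.pow_mem ha _)) (hn i)
  refine ⟨N, ?_⟩
  let Q : S[X] := X ^ f.natDegree + ∑ i ∈ (Finset.range f.natDegree).attach,
    C ⟨_, hcoef i.1 (Finset.mem_range.1 i.2)⟩ * X ^ i.1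
  refine ⟨Q, ?_, ?_⟩
  · apply monic_X_pow_add
    refine (Polynomial.degree_sum_le _ _).trans_lt ?_
    rw [Finset.sup_lt_iff (WithBot.bot_lt_coe _)]
    intro i hi
    exact (degree_C_mul_X_pow_le _ _).trans_lt (by exact_mod_cast Finset.mem_range.1 i.2)
  · change eval₂ (algebraMap S L) (a ^ N * w) Q = 0
    have hQ : eval₂ (algebraMap S L) (a ^ N * w) Q = (a ^ N * w) ^ f.natDegree +
      ∑ i ∈ Finset.range f.natDegree, (a ^ N) ^ (f.natDegree - i) * (f.coeff i : L) * (a ^ N * w) ^ i := by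
      simp only [Q]
      rw [eval₂_add, eval₂_finsetSum, eval₂_pow, eval₂_X]
      congr 1
      rw [← Finset.sum_attach (Finset.range f.natDegree)]
      refine Finset.sum_congr rfl fun i _ => ?_
      rw [eval₂_mul, eval₂_C, eval₂_pow, eval₂_X]
      rfl
    rw [hQ]
    have h1 : (a ^ N) ^ f.natDegree * eval₂ (algebraMap (Loc S a ha) L) w f = 0 := by
      have : eval₂ (algebraMap (Loc S a ha) L) w f = 0 := h0
      rw [this, mul_zero]
    rw [eval₂_eq_sum_range, Finset.sum_range_succ, coeff_natDegree, hf.leadingCoeff, map_one, one_mul, mul_add, 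
      Finset.mul_sum, add_comm] at h1
    rw [← h1]
    congr 1
    · rw [mul_pow]
    · refine Finset.sum_congr rfl fun i hi => ?_
      have h2 : f.natDegree = (f.natDegree - i) + i := by have := Finset.mem_range.1 hi; omega
      rw [mul_pow]
      conv_rhs => rw [h2, pow_add]
      have : (algebraMap (Loc S a ha) L) (f.coeff i) = (f.coeff i : L) := rfl
      rw [this]
      ring

theorem Loc.normal (S : Subring L) [IsIntegrallyClosed S] (a : L) (ha : a ∈ S) (h0 : a ≠ 0) : IsIntegrallyClosed (Loc S a ha) := by
  refine icl_of (L := L) fun w hw hst => ?_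
  obtain ⟨s, t, ht, hst⟩ := hst
  obtain ⟨n, hn⟩ := Loc.integral S a ha w hw
  obtain ⟨k, hk⟩ := s.2
  obtain ⟨l, hl⟩ := t.2
  obtain ⟨b, hb⟩ := icl_mem (A := S) (L := L) Subtype.val_injective _ hn ⟨a ^ k * (a ^ l * t), S.mul_mem (S.pow_mem ha _) hl⟩
    ⟨a ^ l * (a ^ n * (a ^ k * s)), S.mul_mem (S.pow_mem ha _) (S.mul_mem (S.pow_mem ha _) hk)⟩ (by
      intro h
      have h1 : a ^ k * (a ^ l * (t : L)) = 0 := congrArg Subtype.val h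
      have h2 : (t : L) ≠ 0 := fun h => ht (Subtype.ext h)
      have : a ^ k * (a ^ l * (t : L)) ≠ 0 := by positivity
      exact this h1) (by
      change a ^ k * (a ^ l * (t : L)) * (a ^ n * w) = a ^ l * (a ^ n * (a ^ k * (s : L)))
      have : (t : L) * w = s := hst
      rw [← this]; ring)
  exact ⟨⟨w, n, by rw [← hb]; exact b.2⟩, rfl⟩

end ET2
end Part_ET2

section Part_ET3
set_option maxHeartbeats 1000000
set_option synthInstance.maxHeartbeats 400000
set_option linter.unusedSectionVars false
universe u

open IsLocalRing Polynomial

section ET3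

theorem isUnit_one_sub {A S : Type*} [CommRing A] [CommRing S] [Algebra A S] [IsLocalRing A] [Algebra.IsIntegral A S] 
    (a : A) (ha : ¬ IsUnit a) (s : S) : IsUnit (1 - algebraMap A S a * s) := by
  by_contra h
  obtain ⟨M, hM, hM'⟩ := exists_max_ideal_of_mem_nonunits h
  have h1 : (M.comap (algebraMap A S)).IsMaximal := Ideal.isMaximal_comap_of_isIntegral_of_isMaximal M
  have h2 : algebraMap A S a ∈ M := by
    change a ∈ M.comap (algebraMap A S)
    rw [IsLocalRing.eq_maximalIdeal h1]
    exact ha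
  apply hM.ne_top
  rw [Ideal.eq_top_iff_one]
  have := M.add_mem hM' (M.mul_mem_right s h2)
  simpa using this

theorem minpoly_scale {A L : Type*} [CommRing A] [IsDomain A] [IsIntegrallyClosed A] [Field L] [Algebra A L] [FaithfulSMul A L]
    (c : A) (hc : c ≠ 0) (y : L) (hy : IsIntegral A y) :
    (minpoly A y).scaleRoots c = minpoly A (algebraMap A L c * y) := by
  refine IsIntegrallyClosed.minpoly.unique ?_ ?_ ?_
  · exact (monic_scaleRoots_iff c).2 (minpoly.monic hy)
  · exact scaleRoots_aeval_eq_zero (minpoly.aeval A y)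
  · intro Q hQ h0
    rw [degree_scaleRoots]
    have hd : (C c * X : A[X]).natDegree = 1 := natDegree_C_mul_X c hc
    have h1 : aeval y (Q.comp (C c * X)) = 0 := by
      rw [aeval_comp, map_mul, aeval_C, aeval_X, h0]
    have h2 : Q.comp (C c * X) ≠ 0 := by
      intro h
      have h3 := leadingCoeff_comp (p := Q) (q := C c * X) (by rw [hd]; exact one_ne_zero)
      rw [h, hQ.leadingCoeff, leadingCoeff_zero, one_mul, leadingCoeff_C_mul_X] at h3
      exact pow_ne_zero _ hc h3.symm
    refine (minpoly.IsIntegrallyClosed.degree_le_of_ne_zero h2 h1).trans ?_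
    rw [degree_eq_natDegree h2, degree_eq_natDegree hQ.ne_zero, natDegree_comp, hd, mul_one]

theorem integral_div {A L : Type*} [CommRing A] [IsDomain A] [IsIntegrallyClosed A] [Field L] [Algebra A L] [FaithfulSMul A L]
    (p g : A) (hp : Prime p) (hg : ¬ p ∣ g) (v : L) (h1 : IsIntegral A (algebraMap A L p * v)) 
    (h2 : IsIntegral A (algebraMap A L g * v)) : IsIntegral A v := by
  have hg0 : g ≠ 0 := fun h => hg (h ▸ dvd_zero _)
  have e1 := minpoly_scale g hg0 _ h1
  have e2 := minpoly_scale p hp.ne_zero _ h2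
  rw [mul_left_comm, ← e2] at e1
  set P := minpoly A (algebraMap A L p * v) with hP
  set Q := minpoly A (algebraMap A L g * v) with hQ
  have hdeg : P.natDegree = Q.natDegree := by
    have := congrArg natDegree e1
    rwa [natDegree_scaleRoots, natDegree_scaleRoots] at this
  have hco : ∀ i, ∃ b, P.coeff i = b * p ^ (P.natDegree - i) := by
    intro i
    have := congrArg (coeff · i) e1
    simp only [coeff_scaleRoots] at this
    have h3 : p ^ (P.natDegree - i) ∣ P.coeff i := by
      apply hp.pow_dvd_of_dvd_mul_right (b := g ^ (P.natDegree - i))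
      · exact fun h => hg (hp.dvd_of_dvd_pow h)
      · rw [this, hdeg]; exact Dvd.intro_left _ rfl
    obtain ⟨b, hb⟩ := h3
    exact ⟨b, by rw [hb, mul_comm]⟩
  choose b hb using hco
  have hPm : P.Monic := minpoly.monic h1
  let F : A[X] := X ^ P.natDegree + ∑ i ∈ Finset.range P.natDegree, C (b i) * X ^ i
  refine ⟨F, ?_, ?_⟩
  · apply monic_X_pow_add
    refine (Polynomial.degree_sum_le _ _).trans_lt ?_
    rw [Finset.sup_lt_iff (WithBot.bot_lt_coe _)]
    intro i hi
    exact (degree_C_mul_X_pow_le _ _).trans_lt (by exact_mod_cast Finset.mem_range.1 hi)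
  · have h3 : eval₂ (algebraMap A L) (algebraMap A L p * v) P = 0 := minpoly.aeval A _
    rw [eval₂_eq_sum_range, Finset.sum_range_succ, coeff_natDegree, hPm.leadingCoeff, map_one, one_mul] at h3
    have hp0 : algebraMap A L p ≠ 0 := by simpa using hp.ne_zero
    have h4 : algebraMap A L p ^ P.natDegree * eval₂ (algebraMap A L) v F = 0 := by
      simp only [F]
      rw [← h3, eval₂_add, eval₂_finsetSum, eval₂_pow, eval₂_X, mul_add, add_comm, ← mul_pow, Finset.mul_sum]
      congr 1
      refine Finset.sum_congr rfl fun i hi => ?_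
      have h5 : P.natDegree = (P.natDegree - i) + i := by have := Finset.mem_range.1 hi; omega
      rw [hb, eval₂_mul, eval₂_C, eval₂_pow, eval₂_X, map_mul, map_pow, mul_pow]
      conv_lhs => rw [h5, pow_add]
      ring
    exact (mul_eq_zero.1 h4).resolve_left (pow_ne_zero _ hp0)

variable (p : ℕ) [Fact p.Prime] {L : Type u} [Field L] [CharZero L] (A E0 : Subring L) 

/-- the big algebra -/
def TT : Subring L where
  carrier := {w | IsIntegral A w ∧ ∃ E, Adm E0 E ∧ w ∈ E}
  mul_mem' := by
    rintro a b ⟨h1, E, hE, h2⟩ ⟨h1', E', hE', h2'⟩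
    exact ⟨h1.mul h1', _, hE.sup hE', (E ⊔ E').mul_mem (le_sup_left (b := E') h2) (le_sup_right (a := E) h2')⟩
  add_mem' := by
    rintro a b ⟨h1, E, hE, h2⟩ ⟨h1', E', hE', h2'⟩
    exact ⟨h1.add h1', _, hE.sup hE', (E ⊔ E').add_mem (le_sup_left (b := E') h2) (le_sup_right (a := E) h2')⟩
  zero_mem' := ⟨isIntegral_zero, E0, .base, E0.zero_mem⟩
  one_mem' := ⟨isIntegral_one, E0, .base, E0.one_mem⟩
  neg_mem' := by
    rintro a ⟨h1, E, hE, h2⟩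
    exact ⟨h1.neg, E, hE, E.neg_mem h2⟩

variable {A E0} 

theorem Adm.integral_of {E : Subring L} (hE : Adm E0 E) (hAE : A ≤ E0) {w : L} (hw : IsIntegral A w) : IsIntegral E w := by
  obtain ⟨f, hf, h⟩ := hw
  exact ⟨f.map (Subring.inclusion (hAE.trans hE.le)), hf.map _, by rw [eval₂_map]; exact h⟩

theorem TT.normal [IsIntegrallyClosed E0] (hAE : A ≤ E0) : IsIntegrallyClosed (TT A E0) := by
  refine icl_of (L := L) fun w hw hst => ?_
  obtain ⟨s, t, ht, hst⟩ := hst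
  have hw' : IsIntegral A w := by
    have hAT : A ≤ TT A E0 := fun a ha => ⟨isIntegral_algebraMap (R := A) (x := ⟨a, ha⟩), E0, .base, hAE ha⟩
    let _ : Algebra A (TT A E0) := (Subring.inclusion hAT).toAlgebra
    have : IsScalarTower A (TT A E0) L := IsScalarTower.of_algebraMap_eq fun _ => rfl
    have : Algebra.IsIntegral A (TT A E0) := ⟨fun a => 
      (isIntegral_algebraMap_iff (B := L) (A := TT A E0) Subtype.val_injective).1 a.2.1⟩
    exact isIntegral_trans (R := A) (A := TT A E0) w hw
  obtain ⟨-, E, hE, hs⟩ := s.2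
  obtain ⟨-, E', hE', ht'⟩ := t.2
  have := (hE.sup hE').normal
  obtain ⟨b, hb⟩ := icl_mem (A := (E ⊔ E' : Subring L)) (L := L) Subtype.val_injective w ((hE.sup hE').integral_of hAE hw')
    ⟨t, le_sup_right (a := E) ht'⟩ ⟨s, le_sup_left (b := E') hs⟩ (fun h => ht (Subtype.ext (show (t : L) = 0 from congrArg Subtype.val h))) hst
  exact ⟨⟨w, hw', _, hE.sup hE', by rw [← hb]; exact b.2⟩, rfl⟩

theorem unit_adj [IsLocalRing A] (hpA : ¬ IsUnit (p : A)) (w : L) (hw : IsIntegral A w) :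
    ∃ u ∈ Algebra.adjoin A {w}, (1 - p * w) * u = 1 := by
  have : Algebra.IsIntegral A (Algebra.adjoin A {w}) := ⟨fun a => 
    (isIntegral_algebraMap_iff (B := L) Subtype.val_injective).1 (adj_integral w hw a a.2)⟩
  obtain ⟨u, hu⟩ := (isUnit_one_sub (p : A) hpA (⟨w, Algebra.subset_adjoin rfl⟩ : Algebra.adjoin A {w})).exists_right_inv
  refine ⟨u, u.2, ?_⟩
  have := congrArg Subtype.val hu
  simpa using this

theorem TT.frob [IsLocalRing A] [IsAlgClosed L] (hAE : A ≤ E0) (hpA : ¬ IsUnit (p : A)) (hpE : (p : L)⁻¹ ∈ E0) (a : TT A E0) : 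
    ∃ b c : TT A E0, a - b ^ p = p * c := by
  obtain ⟨a, ha, E, hE, haE⟩ := a
  have hp2 : 2 ≤ p := (Fact.out : p.Prime).two_le
  obtain ⟨q, hq⟩ : ∃ q, q = p * p := ⟨_, rfl⟩
  have hpp : 1 < q := by nlinarith
  -- polynomial
  obtain ⟨z, hz⟩ : ∃ z : L, z ^ q - p * z - a = 0 := by
    obtain ⟨z, hz⟩ := IsAlgClosed.exists_root (X ^ q + (- C (p : L) * X - C a) : L[X]) (by
      rw [degree_add_eq_left_of_degree_lt]
      · rw [degree_X_pow]; exact_mod_cast (by omega)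
      · rw [degree_X_pow]
        refine lt_of_le_of_lt (b := (1 : WithBot ℕ)) ?_ (by exact_mod_cast hpp)
        compute_degree)
    refine ⟨z, ?_⟩
    rw [IsRoot.def] at hz
    simp only [eval_add, eval_sub, eval_mul, eval_neg, eval_C, eval_X, eval_pow] at hz
    rw [← hz]; ring
  have hmon : ∀ (B : Type u) [CommRing B] [Nontrivial B] (b : B), (X ^ q + (- C (p : B) * X - C b) : B[X]).Monic := by
    intro B _ _ b
    apply monic_X_pow_add
    refine lt_of_le_of_lt (b := (1 : WithBot ℕ)) ?_ (by exact_mod_cast hpp)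
    compute_degree
  have hzA : IsIntegral A z := by
    have hT : IsIntegral (integralClosure A L) z := by
      refine ⟨_, hmon (integralClosure A L) ⟨a, ha⟩, ?_⟩
      rw [← hz]
      simp only [eval₂_add, eval₂_sub, eval₂_mul, eval₂_neg, eval₂_C, eval₂_X, eval₂_pow]
      rw [map_natCast]
      have : (algebraMap (integralClosure A L) L) ⟨a, ha⟩ = a := rfl
      rw [this]; ring
    exact isIntegral_trans z hT
  have hst : Stp E z := by
    refine ⟨_, hmon E ⟨a, haE⟩, ?_, ?_⟩
    · rw [aeval_def, ← hz]
      simp only [eval₂_add, eval₂_sub, eval₂_mul, eval₂_neg, eval₂_C, eval₂_X, eval₂_pow]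
      rw [map_natCast]
      have : (algebraMap E L) ⟨a, haE⟩ = a := rfl
      rw [this]; ring
    · obtain ⟨u, hu, hu'⟩ := unit_adj p hpA (z ^ (q - 1)) (hzA.pow _)
      have hle : Algebra.adjoin A {z ^ (q - 1)} ≤ (Algebra.adjoin A {z}) := by
        refine Algebra.adjoin_le ?_
        rw [Set.singleton_subset_iff]
        have hz1 : z ∈ Algebra.adjoin A {z} := Algebra.subset_adjoin (Set.mem_singleton z)
        exact SetLike.mem_coe.2 (Subalgebra.pow_mem (Algebra.adjoin A {z}) hz1 (q - 1))
      have hu2 : u ∈ Adj E z := Adj.mono (hAE.trans hE.le) z (hle hu)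
      refine ⟨-(p : L)⁻¹ * u, (Adj E z).mul_mem ((Adj E z).neg_mem (Adj.le _ _ (hE.le hpE))) hu2, ?_⟩
      have hp0 : (p : L) ≠ 0 := by exact_mod_cast (Fact.out : p.Prime).ne_zero
      have : aeval z (derivative (X ^ q + (- C (p : E) * X - C ⟨a, haE⟩) : E[X])) = 
          (q : L) * z ^ (q - 1) - p := by
        rw [derivative_add, derivative_sub, derivative_X_pow, derivative_C, sub_zero, derivative_mul, derivative_neg, derivative_C, neg_zero, zero_mul, zero_add,
          derivative_X, mul_one, map_add, map_mul, map_neg, map_pow, aeval_C, aeval_X, aeval_C, map_natCast, map_natCast]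
        ring
      rw [this, hq, Nat.cast_mul, ← hq]
      calc _ = (p : L) * (p : L)⁻¹ * ((1 - p * z ^ (q - 1)) * u) := by ring
        _ = 1 := by rw [hu', mul_inv_cancel₀ hp0, one_mul]
  have hzT : z ∈ TT A E0 := ⟨hzA, _, .step E z hE hst, Adj.self _ _⟩
  refine ⟨⟨z, hzT⟩ ^ p, - ⟨z, hzT⟩, Subtype.ext ?_⟩
  have : (p : L) * (-z) = a - (z ^ p) ^ p := by rw [← pow_mul, ← hq]; linear_combination hz
  simpa using this.symm

theorem TT.root (hAE : A ≤ E0) (hpE : (p : L)⁻¹ ∈ E0) (z : ℕ → L) (hz : ∀ n, z (n+1) ^ p = z n) (h0 : z 0 ∈ A)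
    (hn0 : z 0 ≠ 0) (h0' : (z 0)⁻¹ ∈ E0) (n : ℕ) : z n ∈ TT A E0 := by
  have hp0 : (p : L) ≠ 0 := by exact_mod_cast (Fact.out : p.Prime).ne_zero
  have hp1 : 0 < p := (Fact.out : p.Prime).pos
  suffices h : IsIntegral A (z n) ∧ z n ≠ 0 ∧ ∃ E, Adm E0 E ∧ z n ∈ E ∧ (z n)⁻¹ ∈ E by
    obtain ⟨h1, -, E, hE, h2, -⟩ := h
    exact ⟨h1, E, hE, h2⟩
  induction n with
  | zero => exact ⟨isIntegral_algebraMap (R := A) (x := ⟨_, h0⟩), hn0, E0, .base, hAE h0, h0'⟩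
  | succ n ih =>
    obtain ⟨h1, h2, E, hE, h3, h4⟩ := ih
    have h5 : z (n+1) ≠ 0 := fun h => h2 (by rw [← hz, h, zero_pow hp1.ne'])
    have h6 : z (n+1) * (z (n+1) ^ (p - 1) * (z n)⁻¹) = 1 := by
      rw [← mul_assoc, ← pow_succ', Nat.sub_add_cancel hp1, hz, mul_inv_cancel₀ h2]
    have h7 : (z (n+1))⁻¹ ∈ Adj E (z (n+1)) := by
      rw [inv_eq_of_mul_eq_one_right h6]
      exact (Adj E _).mul_mem ((Adj E _).pow_mem (Adj.self _ _) _) (Adj.le _ _ h4)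
    refine ⟨IsIntegral.of_pow hp1 (by rw [hz]; exact h1), h5, _, .step E (z (n+1)) hE ?_, Adj.self _ _, h7⟩
    refine ⟨X ^ p - C ⟨z n, h3⟩, monic_X_pow_sub_C _ hp1.ne', ?_, (p : L)⁻¹ * (z (n+1))⁻¹ ^ (p - 1),
      (Adj E _).mul_mem (Adj.le _ _ (hE.le hpE)) ((Adj E _).pow_mem h7 _), ?_⟩
    · rw [map_sub, map_pow, aeval_X, aeval_C, hz]
      exact sub_self _
    · simp only [derivative_sub, derivative_X_pow, derivative_C, sub_zero, map_mul, map_pow, aeval_X, map_natCast]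
      rw [inv_pow]
      have := pow_ne_zero (p - 1) h5
      field_simp

theorem TT.not_unit [IsLocalRing A] (hpA : ¬ IsUnit (p : A)) : ¬ IsUnit (p : TT A E0) := by
  intro h
  obtain ⟨v, hv⟩ := h.exists_right_inv
  obtain ⟨u, hu, hu'⟩ := unit_adj p hpA v v.2.1
  have h2 : (p : L) * v = 1 := by simpa using congrArg Subtype.val hv
  rw [h2, sub_self, zero_mul] at hu'
  exact zero_ne_one hu'

theorem TT.reg [IsIntegrallyClosed A] (hpE : (p : L)⁻¹ ∈ E0) (g : A) (hp : Prime (p : A)) (hg : ¬ (p : A) ∣ g) 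
    (g' : TT A E0) (hg' : (g' : L) = g) (y : TT A E0) (h : (p : TT A E0) ∣ g' * y) : (p : TT A E0) ∣ y := by
  have hp0 : (p : L) ≠ 0 := by exact_mod_cast (Fact.out : p.Prime).ne_zero
  obtain ⟨w, hw⟩ := h
  have hw' : (g : L) * y = p * w := by
    have := congrArg Subtype.val hw
    simpa [hg'] using this
  have h1 : IsIntegral A ((p : L)⁻¹ * y) := by
    refine integral_div (p : A) g hp hg _ ?_ ?_
    · rw [map_natCast, ← mul_assoc, mul_inv_cancel₀ hp0, one_mul]
      exact y.2.1
    · have : algebraMap A L g * ((p : L)⁻¹ * y) = w := by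
        rw [mul_left_comm]
        change (p : L)⁻¹ * ((g : L) * y) = w
        rw [hw', ← mul_assoc, inv_mul_cancel₀ hp0, one_mul]
      rw [this]; exact w.2.1
  obtain ⟨-, E, hE, hy⟩ := y.2
  refine ⟨⟨_, h1, E, hE, E.mul_mem (hE.le hpE) hy⟩, Subtype.ext ?_⟩
  simp [mul_inv_cancel_left₀ hp0]

theorem TT.tiltable [IsLocalRing A] [IsAlgClosed L] [IsIntegrallyClosed E0] (hAE : A ≤ E0) (hpA : ¬ IsUnit (p : A)) 
    (hpE : (p : L)⁻¹ ∈ E0) (pr : ℕ → TT A E0) (h0 : pr 0 = p) (hpr : ∀ n, pr (n+1) ^ p = pr n) : Tiltable p (TT A E0) pr := by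
  refine ⟨TT.not_unit p hpA, ?_, h0, hpr, TT.frob p hAE hpA hpE, ?_⟩
  · exact_mod_cast (Fact.out : p.Prime).ne_zero
  · intro a k h
    have := TT.normal (A := A) (E0 := E0) hAE
    rw [← hpr, IsIntegrallyClosed.pow_dvd_pow_iff (Fact.out : p.Prime).ne_zero] at h
    exact h

end ET3
end Part_ET3

section Part_ET4
set_option maxHeartbeats 1000000
set_option synthInstance.maxHeartbeats 400000
set_option linter.unusedSectionVars false
universe u

open IsLocalRing Polynomial

section ET4

variable {L : Type u} [Field L] [CharZero L]

theorem tow_step (T E : Subring L) [IsIntegrallyClosed E] {B : Type u} [CommRing B] (j : B →+* T) 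
    (hj : Function.Injective j) (hjE : ∀ b, (j b : L) ∈ E) (ab : B) (ha : (j ab : L) ≠ 0)
    (hcov : ∀ w ∈ E, ∃ (n : ℕ) (b : B), (j b : L) = (j ab : L) ^ n * w) (z : L) (hz : IsIntegral E z)
    (hT : ∀ w ∈ Adj E z, IsIntegral T w → w ∈ T) : 
    ∃ (F : B[X]) (_ : F.Monic) (j' : AdjoinRoot F →+* T), j'.comp (AdjoinRoot.of F) = j ∧ Function.Injective j' ∧ 
      (∀ b, (j' b : L) ∈ Adj E z) ∧ ∀ w ∈ Adj E z, ∃ (n : ℕ) (b : AdjoinRoot F), (j' b : L) = (j ab : L) ^ n * w := by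
  obtain ⟨jE, hjE'⟩ : ∃ jE : B →+* E, ∀ b, (jE b : L) = j b := 
    ⟨(T.subtype.comp j).codRestrict E hjE, fun b => rfl⟩
  obtain ⟨a, ha'⟩ : ∃ a : E, a = jE ab := ⟨_, rfl⟩
  have haL : (a : L) = j ab := by rw [ha', hjE']
  have ha0 : a ≠ 0 := by
    intro h; apply ha; rw [← haL, h]; rfl
  have hjEinj : Function.Injective jE := by
    intro b c h
    apply hj
    apply Subtype.ext
    rw [← hjE', ← hjE', h]
  have hcov' : ∀ w : E, ∃ (n : ℕ) (b : B), jE b = a ^ n * w := by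
    intro w
    obtain ⟨n, b, h⟩ := hcov w w.2
    refine ⟨n, b, Subtype.ext ?_⟩
    rw [hjE', h]; push_cast; rw [haL]
  choose nn bb hbb using fun i => hcov' ((minpoly E z).coeff i)
  set D := (minpoly E z).natDegree with hD
  obtain ⟨k, hk⟩ : ∃ k, ∀ i < D, nn i ≤ k := ⟨∑ i ∈ Finset.range D, nn i, fun i hi => 
    Finset.single_le_sum (f := nn) (fun _ _ => Nat.zero_le _) (Finset.mem_range.2 hi)⟩
  have hP := minpoly_scale (a ^ k) (pow_ne_zero k ha0) z hz
  set z' : L := algebraMap E L (a ^ k) * z with hz'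
  have hz'i : IsIntegral E z' := isIntegral_algebraMap.mul hz
  have hmon : (minpoly E z').Monic := minpoly.monic hz'i
  have hlift : minpoly E z' ∈ lifts jE := by
    rw [lifts_iff_coeff_lifts]
    intro i
    rw [← hP, coeff_scaleRoots, ← hD]
    rcases lt_trichotomy i D with hi | hi | hi
    · obtain ⟨e, he⟩ : ∃ e, k * (D - i) = nn i + e := by
        refine Nat.exists_eq_add_of_le ((hk i hi).trans ?_)
        exact Nat.le_mul_of_pos_right _ (by omega)
      refine ⟨ab ^ e * bb i, ?_⟩
      rw [map_mul, map_pow, hbb, ← ha', ← pow_mul, he, pow_add]; ring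
    · subst hi
      refine ⟨1, ?_⟩
      rw [map_one, hD, (minpoly.monic hz).coeff_natDegree]; simp
    · refine ⟨0, ?_⟩
      rw [coeff_eq_zero_of_natDegree_lt hi]; simp
  obtain ⟨F, hFm, hFd, hFmon⟩ := lifts_and_natDegree_eq_and_monic hlift hmon
  have hzA : z' ∈ Adj E z := (Adj E z).mul_mem (Adj.le E z (a ^ k).2) (Adj.self E z)
  have hroot : F.eval₂ (T.subtype.comp j) z' = 0 := by
    have h1 := minpoly.aeval E z'
    rw [← hFm, aeval_def, eval₂_map] at h1
    rw [← h1]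
    congr 1
    ext b
    exact (hjE' b).symm
  have hzT : z' ∈ T := by
    refine hT _ hzA ⟨F.map j, hFmon.map j, ?_⟩
    rw [eval₂_map]; exact hroot
  have hroot' : F.eval₂ j (⟨z', hzT⟩ : T) = 0 := by
    apply Subtype.val_injective
    change T.subtype _ = T.subtype 0
    rw [hom_eval₂, map_zero]; exact hroot
  obtain ⟨j', hj'⟩ : ∃ j' : AdjoinRoot F →+* T, j' = AdjoinRoot.lift j (⟨z', hzT⟩ : T) hroot' := ⟨_, rfl⟩
  have hmk : ∀ q : B[X], (j' (AdjoinRoot.mk F q) : L) = aeval z' (q.map jE) := by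
    intro q
    rw [hj', AdjoinRoot.lift_mk, aeval_def, eval₂_map]
    change T.subtype _ = _
    rw [hom_eval₂]
    congr 1
    ext b
    exact (hjE' b).symm
  have hof : ∀ b, j' (AdjoinRoot.of F b) = j b := fun b => by rw [hj', AdjoinRoot.lift_of]
  have hrt : (j' (AdjoinRoot.root F) : L) = z' := by rw [hj', AdjoinRoot.lift_root]
  refine ⟨F, hFmon, j', RingHom.ext hof, ?_, ?_, ?_⟩
  · rw [injective_iff_map_eq_zero]
    intro u hu
    obtain ⟨q, rfl⟩ := AdjoinRoot.mk_surjective u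
    have hq : AdjoinRoot.mk F q = AdjoinRoot.mk F (q %ₘ F) := by
      rw [AdjoinRoot.mk_eq_mk]
      exact ⟨q /ₘ F, by rw [sub_eq_iff_eq_add, add_comm, modByMonic_add_div]⟩
    rw [hq] at hu ⊢
    have h1 : aeval z' ((q %ₘ F).map jE) = 0 := by rw [← hmk, hu]; rfl
    have h2 : (q %ₘ F).map jE = 0 := by
      by_contra h
      have h3 := minpoly.IsIntegrallyClosed.degree_le_of_ne_zero h h1
      rw [← hFm, hFmon.degree_map] at h3
      have : Nontrivial B := j.domain_nontrivial
      exact absurd (h3.trans (degree_map_le)) (not_le.2 (degree_modByMonic_lt q hFmon))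
    rw [(Polynomial.map_injective jE hjEinj) (h2.trans (Polynomial.map_zero jE).symm), map_zero]
  · intro b
    obtain ⟨q, rfl⟩ := AdjoinRoot.mk_surjective b
    rw [hmk, aeval_eq_sum_range]
    refine (Adj E z).sum_mem fun i _ => ?_
    rw [Algebra.smul_def]
    exact (Adj E z).mul_mem (Adj.le E z (Subtype.prop _)) ((Adj E z).pow_mem hzA i)
  · intro w hw
    refine Algebra.adjoin_induction (p := fun w _ => ∃ (n : ℕ) (b : AdjoinRoot F), (j' b : L) = (j ab : L) ^ n * w) ?_ ?_ ?_ ?_ hw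
    · rintro _ rfl
      refine ⟨k, AdjoinRoot.root F, ?_⟩
      rw [hrt, hz', ← haL]; rfl
    · intro r
      obtain ⟨n, b, h⟩ := hcov r r.2
      exact ⟨n, AdjoinRoot.of F b, by rw [hof, h]; rfl⟩
    · rintro u v - - ⟨n, b, h⟩ ⟨n', b', h'⟩
      refine ⟨n + n', AdjoinRoot.of F ab ^ n' * b + AdjoinRoot.of F ab ^ n * b', ?_⟩
      rw [map_add, map_mul, map_mul, map_pow, map_pow, hof]; push_cast; rw [h, h']; ring
    · rintro u v - - ⟨n, b, h⟩ ⟨n', b', h'⟩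
      refine ⟨n + n', b * b', ?_⟩
      rw [map_mul]; push_cast; rw [h, h']; ring

end ET4
end Part_ET4

section Part_ET5
set_option maxHeartbeats 1000000
set_option synthInstance.maxHeartbeats 400000
set_option linter.unusedSectionVars false
universe u

open IsLocalRing Polynomial

section ET5

variable (p : ℕ) [Fact p.Prime] {L : Type u} [Field L] [CharZero L] 

/-- tower state -/
def Tow (T : Subring L) [Fact (¬ IsUnit (p : T))] (pr gr : ℕ → T) (h : Tiltable p T pr) (hgr : ∀ n, gr (n + 1) ^ p = gr n)
    {A : Subring L} (g : A) {m : ℕ} (x : Fin m → A) (E : Subring L) : Prop :=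
  ∃ (B : Type u) (_ : CommRing B) (j : B →+* T) (i : A →+* B), Function.Injective j ∧ (∀ a, (j (i a) : L) = a) ∧
    (∀ b, (j b : L) ∈ E) ∧ (∀ w ∈ E, ∃ (n : ℕ) (b : B), (j b : L) = ((p : L) * g) ^ n * w) ∧
    ∀ N > 0, PN p N (Tl.el p pr h.prs) (Tl.el p gr hgr) ((Tl.lam p pr h N).comp j) (i g) (fun k => i (x k))

theorem Tow.step (T : Subring L) [Fact (¬ IsUnit (p : T))] (pr gr : ℕ → T) (h : Tiltable p T pr) 
    (hgr : ∀ n, gr (n + 1) ^ p = gr n)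
    {A : Subring L} (g : A) (hg0 : (p : L) * g ≠ 0) {m : ℕ} (x : Fin m → A) (E : Subring L) [IsIntegrallyClosed E] (z : L) (hz : IsIntegral E z)
    (hT : ∀ w ∈ Adj E z, IsIntegral T w → w ∈ T) (hE : Tow p T pr gr h hgr g x E) : 
    Tow p T pr gr h hgr g x (Adj E z) := by
  obtain ⟨B, _, j, i, hj, hji, hjE, hcov, hPN⟩ := hE
  have hab : (j ((p : B) * i g) : L) = (p : L) * g := by
    rw [map_mul, map_natCast]; push_cast; rw [hji]
  obtain ⟨F, hF, j', hj', h1, h2, h3⟩ := tow_step T E j hj hjE ((p : B) * i g) (by rw [hab]; exact hg0) 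
    (by rw [hab]; exact hcov) z hz hT
  rw [hab] at h3
  refine ⟨AdjoinRoot F, inferInstance, j', (AdjoinRoot.of F).comp i, h1, ?_, h2, h3, ?_⟩
  · intro a
    rw [← hji, ← hj']; rfl
  · intro N hN
    refine PN.adjoinRoot p N (Tl.el p pr h.prs) (Tl.el p gr hgr) (Tl.t_reg p pr h) (i g) (fun k => i (x k)) F hF 
      ((Tl.lam p pr h N).comp j') ?_
    rw [RingHom.comp_assoc, hj']
    exact hPN N hN

theorem Tow.base (T : Subring L) [Fact (¬ IsUnit (p : T))] (pr gr : ℕ → T) (h : Tiltable p T pr) 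
    (hgr : ∀ n, gr (n + 1) ^ p = gr n)
    {A : Subring L} (g : A) {m : ℕ} (x : Fin (m+1) → A) (xr : Fin (m + 1) → ℕ → L) (hxr : ∀ i n, xr i (n + 1) ^ p = xr i n)
    (hxr0 : ∀ i, xr i 0 = x i) (hp0 : x 0 = p) (hA : RLS x)
    (hA2 : ∀ a : A, ∃ (b : (Fin (m+1) → Fin p) → A) (c : A),
      a = ∑ k, (∏ i, x i ^ (k i : ℕ)) * (b k) ^ p + p * c) (hpg : ¬ (p : A) ∣ g)
    (hAT : A ≤ T) (hT : ∀ i n, xr i n ∈ T) (hpr : ∀ n, (pr n : L) = xr 0 n) (hgr0 : (gr 0 : L) = g)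
    (ha : (p : L) * g ∈ A) :
    Tow p T pr gr h hgr g (fun k : Fin m => x k.succ) (Loc A ((p : L) * g) ha) := by
  have hAi : Ainf p A xr hxr ≤ T := by
    rintro w ⟨n, hn⟩
    refine Algebra.adjoin_induction (p := fun w _ => w ∈ T) ?_ ?_ ?_ ?_ hn
    · rintro _ ⟨i, rfl⟩; exact hT i n
    · intro r; exact hAT r.2
    · intro a b _ _ ha hb; exact T.add_mem ha hb
    · intro a b _ _ ha hb; exact T.mul_mem ha hb
  have htl := Ainf.tiltable p hxr hxr0 hA hp0 hA2
  have : Fact (¬ IsUnit ((p : ℕ) : Ainf p A xr hxr)) := ⟨htl.nu⟩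
  obtain ⟨j, hj⟩ : ∃ j : A →+* T, j = (Subring.inclusion hAi).comp (Ainf.incl p hxr) := ⟨_, rfl⟩
  have hjv : ∀ a, (j a : L) = a := fun a => by rw [hj]; rfl
  refine ⟨A, inferInstance, j, RingHom.id A, ?_, hjv, ?_, ?_, ?_⟩
  · intro a b hab
    apply Subtype.ext
    rw [← hjv, hab, hjv]
  · intro b; rw [hjv]; exact Loc.le _ _ _ b.2
  · rintro w ⟨n, hn⟩
    exact ⟨n, ⟨_, hn⟩, hjv _⟩
  · intro N hN
    refine PN.of_PN0 p N _ _ (Tl.t_reg p pr h) _ _ _ ?_ ?_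
    · rw [hj]
      refine PN0_tilt p (Ainf.rt p hxr 0) htl pr h (Subring.inclusion hAi) ?_ N hN (Ainf.incl p hxr) g _ ?_ ?_
      · intro n
        apply Subtype.ext
        rw [hpr]; rfl
      · exact Ainf.hg p hxr hxr0 hA hp0 g hpg
      · exact Ainf.hx p hxr hxr0 hA hp0
    · have : j g = gr 0 := Subtype.ext (by rw [hjv, hgr0])
      change Tl.lam p pr h N (j g) = _
      rw [this, Tl.lam_el p pr h N gr hgr]

theorem intData_of {T : Subring L} [Fact (¬ IsUnit (p : T))] {A : Subring L} {B : Type u} [CommRing B] (j : B →+* T) (i : A →+* B)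
    (hj : Function.Injective j) (hji : ∀ a, (j (i a) : L) = a) (g : A) (k : ℕ) (r : T) (hr : IsIntegral A (r : L))
    (b : B) (hb : (j b : L) = ((p : L) * g) ^ k * r) : ∃ e, IntData p j (i g) k r e := by
  obtain ⟨f, hf, h0⟩ := hr
  have hpos : 0 < f.natDegree := by
    rcases Nat.eq_zero_or_pos f.natDegree with h | h
    · rw [(Monic.natDegree_eq_zero hf).1 h, eval₂_one] at h0
      exact absurd h0 one_ne_zero
    · exact h
  refine ⟨f.natDegree, hpos, b, fun l => i (- f.coeff l), ?_, ?_⟩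
  · apply Subtype.ext
    push_cast
    rw [hb, hji]
  · apply hj
    apply Subtype.ext
    have h1 : ∀ c : B, (j c : L) = (T.subtype.comp j) c := fun c => rfl
    have h2 : ∀ a : A, (T.subtype.comp j) (i a) = (a : L) := hji
    rw [h1] at hb
    rw [h1, h1]
    rw [map_sum]
    simp only [map_mul, map_pow, hb, h2, map_natCast]
    rw [eval₂_eq_sum_range, Finset.sum_range_succ, hf.coeff_natDegree, map_one, one_mul] at h0
    rw [mul_pow, eq_neg_of_add_eq_zero_right h0, mul_neg, Finset.mul_sum, ← Finset.sum_neg_distrib]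
    refine Finset.sum_congr rfl fun l hl => ?_
    obtain ⟨q, hq⟩ := Nat.exists_eq_add_of_lt (Finset.mem_range.1 hl)
    have e1 : f.natDegree - l = q + 1 := by omega
    rw [e1, hq]
    generalize ((p : L) * g) = s
    change _ = (-(f.coeff l : L)) * _ * _
    change -(_ * ((f.coeff l : L) * _)) = _
    ring


theorem TT.integral_trans {A E1 : Subring L} (hAE : A ≤ E1) (w : L) (hw : IsIntegral (TT A E1) w) : IsIntegral A w := by
  have hAT : A ≤ TT A E1 := fun a ha => ⟨isIntegral_algebraMap (R := A) (x := ⟨_, ha⟩), E1, .base, hAE ha⟩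
  let _ : Algebra A (TT A E1) := (Subring.inclusion hAT).toAlgebra
  have : IsScalarTower A (TT A E1) L := IsScalarTower.of_algebraMap_eq fun _ => rfl
  have : Algebra.IsIntegral A (TT A E1) := ⟨fun a => 
    (isIntegral_algebraMap_iff (B := L) (A := TT A E1) Subtype.val_injective).1 a.2.1⟩
  exact isIntegral_trans (R := A) (A := TT A E1) w hw

theorem Tow.all {A E1 : Subring L} [IsIntegrallyClosed E1] (hAE : A ≤ E1) [Fact (¬ IsUnit (p : TT A E1))] (pr gr : ℕ → TT A E1) 
    (h : Tiltable p (TT A E1) pr) (hgr : ∀ n, gr (n + 1) ^ p = gr n)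
    (g : A) (hg0 : (p : L) * g ≠ 0) {m : ℕ} (x : Fin m → A) (h0 : Tow p (TT A E1) pr gr h hgr g x E1)
    (E : Subring L) (hE : Adm E1 E) : Tow p (TT A E1) pr gr h hgr g x E := by
  induction hE with
  | base => exact h0
  | step E z hE hz ih => 
    have := hE.normal
    exact Tow.step p _ pr gr h hgr g hg0 x E z hz.integral 
      (fun w hw hi => ⟨TT.integral_trans hAE w hi, _, .step E z hE hz, hw⟩) ih

theorem Adm.common {E1 : Subring L} {ι : Type*} [Fintype ι] (w : ι → L) (hw : ∀ i, ∃ E, Adm E1 E ∧ w i ∈ E) : 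
    ∃ E, Adm E1 E ∧ ∀ i, w i ∈ E := by
  choose E hE hw using hw
  classical
  suffices h : ∀ s : Finset ι, ∃ F, Adm E1 F ∧ ∀ i ∈ s, w i ∈ F by
    obtain ⟨F, h1, h2⟩ := h Finset.univ
    exact ⟨F, h1, fun i => h2 i (Finset.mem_univ i)⟩
  intro s
  induction s using Finset.induction_on with
  | empty => exact ⟨E1, .base, by simp⟩
  | insert i s _ ih =>
    obtain ⟨F, h1, h2⟩ := ih
    refine ⟨F ⊔ E i, h1.sup (hE i), fun l hl => ?_⟩
    rcases Finset.mem_insert.1 hl with rfl | hl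
    · exact (le_sup_right : E l ≤ F ⊔ E l) (hw l)
    · exact (le_sup_left : F ≤ F ⊔ E i) (h2 l hl)

theorem Tow.intData {T : Subring L} [Fact (¬ IsUnit (p : T))] {A : Subring L} (g : A) {B : Type u} [CommRing B] (j : B →+* T) (i : A →+* B)
    (hj : Function.Injective j) (hji : ∀ a, (j (i a) : L) = a) (E : Subring L) 
    (hcov : ∀ w ∈ E, ∃ (n : ℕ) (b : B), (j b : L) = ((p : L) * g) ^ n * w)
    {ι : Type*} [Fintype ι] (w : ι → T) (hw : ∀ l, (w l : L) ∈ E) (hwi : ∀ l, IsIntegral A (w l : L)) :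
    ∃ k, ∀ l, ∃ e, IntData p j (i g) k (w l) e := by
  choose n b hb using fun l => hcov _ (hw l)
  refine ⟨∑ l, n l, fun l => ?_⟩
  obtain ⟨q, hq⟩ := Nat.exists_eq_add_of_le (Finset.single_le_sum (f := n) (fun _ _ => Nat.zero_le _) (Finset.mem_univ l))
  refine intData_of p j i hj hji g _ (w l) (hwi l) (((p : B) * i g) ^ q * b l) ?_
  have h1 : ∀ c : B, (j c : L) = (T.subtype.comp j) c := fun c => rfl
  have h2 : ∀ a : A, (T.subtype.comp j) (i a) = (a : L) := hji
  have h3 := hb l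
  rw [h1] at h3 ⊢
  rw [map_mul, map_pow, map_mul, map_natCast, h2, h3, hq, pow_add]; ring

theorem TT.colon {A E1 : Subring L} [IsIntegrallyClosed E1] (hAE : A ≤ E1) [Fact (¬ IsUnit (p : TT A E1))] (pr gr : ℕ → TT A E1) 
    (h : Tiltable p (TT A E1) pr) (hgr : ∀ n, gr (n + 1) ^ p = gr n)
    (g : A) (hg0 : (p : L) * g ≠ 0) {m : ℕ} (x : Fin m → A) (h0 : Tow p (TT A E1) pr gr h hgr g x E1)
    (hgr0 : (gr 0 : L) = g) (hreg : ∀ y, (p : TT A E1) ∣ gr 0 * y → (p : TT A E1) ∣ y) 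
    (xT : Fin m → TT A E1) (hxT : ∀ k, (xT k : L) = x k) (i : Fin m) (t : TT A E1) 
    (ht : xT i * t ∈ Ideal.span {(p : TT A E1)} ⊔ Ideal.span (xT '' Set.Iio i)) (n : ℕ) :
    pr n * gr n * t ∈ Ideal.span {(p : TT A E1)} ⊔ Ideal.span (xT '' Set.Iio i) := by
  obtain ⟨u, hu, v, hv, huv⟩ := Submodule.mem_sup.1 ht
  obtain ⟨r0, rfl⟩ := Ideal.mem_span_singleton.1 hu
  obtain ⟨rl, hrl⟩ : ∃ rl : Fin m → TT A E1, ∑ l ∈ Finset.Iio i, xT l * rl l = v := by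
    rw [← Finset.coe_Iio] at hv
    obtain ⟨f, hf⟩ := (Submodule.mem_span_image_finset_iff_exists_fun' (TT A E1)).1 hv
    refine ⟨f, ?_⟩
    rw [← hf]
    exact Finset.sum_congr rfl fun l _ => mul_comm _ _
  obtain ⟨E, hE, hw⟩ := Adm.common (E1 := E1) (fun o : Option (Option (Fin m)) => 
    ((o.elim t (fun o' => o'.elim r0 rl) : TT A E1) : L)) (fun o => (Subtype.prop (o.elim t (fun o' => o'.elim r0 rl))).2)
  obtain ⟨B, _, j, iA, hj, hji, hjE, hcov, hPN⟩ := Tow.all p hAE pr gr h hgr g hg0 x h0 E hE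
  obtain ⟨k, hk⟩ := Tow.intData p g j iA hj hji E hcov (fun o : Option (Option (Fin m)) => 
    (o.elim t (fun o' => o'.elim r0 rl) : TT A E1)) hw (fun o => (Subtype.prop (o.elim t (fun o' => o'.elim r0 rl))).1)
  choose e he using hk
  have hjx : ∀ l, j (iA (x l)) = xT l := fun l => Subtype.ext (by rw [hji, hxT])
  have := _root_.colon p pr gr h hgr j hj (iA g) (Subtype.ext (by rw [hji, hgr0])) (fun l => iA (x l)) hPN hreg k i t r0 rl
    (e none) (e (some none)) (fun l => e (some (some l))) (he none) (he (some none)) (fun l => he (some (some l))) 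
    (by simp only [hjx]; rw [hrl, huv]) n
  simpa only [hjx] using this

end ET5
end Part_ET5

section Part_G1
set_option maxHeartbeats 1000000
set_option synthInstance.maxHeartbeats 400000
set_option linter.unusedSectionVars false
universe u

open IsLocalRing Polynomial nonZeroDivisors

section G1

theorem prim {A R : Type*} [CommRing A] [IsDomain A] [CommRing R] [IsDomain R] [CharZero A] [Algebra A R] [FaithfulSMul A R]
    [Module.Finite A R] : ∃ y : R, ∀ r : R, ∃ c : A, c ≠ 0 ∧ algebraMap A R c * r ∈ Algebra.adjoin A {y} := by
  let K := FractionRing A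
  let K' := FractionRing R
  let _ : Algebra K K' := FractionRing.liftAlgebra A K'
  have : IsScalarTower A K K' := FractionRing.isScalarTower_liftAlgebra A K'
  have hi : Function.Injective (algebraMap A K') := FaithfulSMul.algebraMap_injective A K'
  have : Algebra.IsIntegral A R := inferInstance
  have : IsLocalization (Algebra.algebraMapSubmonoid R A⁰) K' := inferInstance
  have : FiniteDimensional K K' := .of_isLocalization A R A⁰
  have : CharZero K := charZero_of_injective_algebraMap (IsFractionRing.injective A K)
  obtain ⟨α, hα⟩ := Field.exists_primitive_element K K'
  have hle : Algebra.adjoin K {α} = ⊤ := by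
    rw [← IntermediateField.adjoin_simple_toSubalgebra_of_isAlgebraic (Algebra.IsAlgebraic.isAlgebraic α), hα]; rfl
  -- clear the denominator of α
  obtain ⟨c0, y, hc0, hy⟩ : ∃ (c : A) (y : R), c ≠ 0 ∧ algebraMap A K' c * α = algebraMap R K' y := by
    obtain ⟨⟨y, s, hs⟩, h⟩ := IsLocalization.surj (Algebra.algebraMapSubmonoid R A⁰) α
    obtain ⟨c, hc, rfl⟩ := hs
    refine ⟨c, y, nonZeroDivisors.ne_zero hc, ?_⟩
    rw [← h, mul_comm, IsScalarTower.algebraMap_apply A R K']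
  refine ⟨y, fun r => ?_⟩
  have hr : algebraMap R K' r ∈ Algebra.adjoin K {α} := by rw [hle]; trivial
  have key : ∃ c : A, c ≠ 0 ∧ algebraMap A K' c * algebraMap R K' r ∈ Algebra.adjoin A {algebraMap R K' y} := by
    refine Algebra.adjoin_induction (p := fun w _ => ∃ c : A, c ≠ 0 ∧ algebraMap A K' c * w ∈ Algebra.adjoin A {algebraMap R K' y}) 
      ?_ ?_ ?_ ?_ hr
    · rintro _ rfl
      exact ⟨c0, hc0, by rw [hy]; exact Algebra.subset_adjoin (Set.mem_singleton _)⟩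
    · intro k
      obtain ⟨⟨b, s⟩, h⟩ := IsLocalization.surj A⁰ k
      refine ⟨s, nonZeroDivisors.ne_zero s.2, ?_⟩
      have : algebraMap A K' s * algebraMap K K' k = algebraMap A K' b := by
        rw [IsScalarTower.algebraMap_apply A K K', IsScalarTower.algebraMap_apply A K K', ← map_mul, mul_comm, h]
      rw [this]
      exact Subalgebra.algebraMap_mem _ _
    · rintro u v - - ⟨c, hc, h⟩ ⟨c', hc', h'⟩
      refine ⟨c * c', mul_ne_zero hc hc', ?_⟩
      have : algebraMap A K' (c * c') * (u + v) = algebraMap A K' c' * (algebraMap A K' c * u) + algebraMap A K' c * (algebraMap A K' c' * v) := by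
        rw [map_mul]; ring
      rw [this]
      exact Subalgebra.add_mem _ (Subalgebra.mul_mem _ (Subalgebra.algebraMap_mem _ _) h) (Subalgebra.mul_mem _ (Subalgebra.algebraMap_mem _ _) h')
    · rintro u v - - ⟨c, hc, h⟩ ⟨c', hc', h'⟩
      refine ⟨c * c', mul_ne_zero hc hc', ?_⟩
      have : algebraMap A K' (c * c') * (u * v) = (algebraMap A K' c * u) * (algebraMap A K' c' * v) := by
        rw [map_mul]; ring
      rw [this]
      exact Subalgebra.mul_mem _ h h'
  obtain ⟨c, hc, h⟩ := key
  refine ⟨c, hc, ?_⟩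
  have h2 := AlgHom.map_adjoin_singleton (IsScalarTower.toAlgHom A R K') y
  rw [IsScalarTower.coe_toAlgHom'] at h2
  rw [← h2] at h
  obtain ⟨z, hz, hz'⟩ := h
  have : algebraMap A R c * r = z := by
    apply IsFractionRing.injective R K'
    rw [map_mul, ← IsScalarTower.algebraMap_apply]
    exact hz'.symm
  rw [this]; exact hz

variable (p : ℕ) [Fact p.Prime] {L : Type u} [Field L] [CharZero L] 

theorem Loc.congr_inv {A : Subring L} (a : L) (ha : a ∈ A) (h0 : a ≠ 0) (c d : L) (hd : d ∈ A) (k : ℕ) (h : c * d = a ^ k) : c⁻¹ ∈ Loc A a ha := by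
  refine ⟨k, ?_⟩
  have hc : c ≠ 0 := by
    rintro rfl
    rw [zero_mul] at h
    exact pow_ne_zero k h0 h.symm
  rw [← h, mul_comm c d, mul_assoc, mul_inv_cancel₀ hc, mul_one]
  exact hd

theorem exists_g {A Rs : Subring L} [IsNoetherianRing A] [IsIntegrallyClosed A] (hAR : A ≤ Rs) (hfin : (Subring.inclusion hAR).Finite)
    (hp : Prime (p : A)) {ι : Type*} [Fintype ι] (x : ι → A) (hx : ∀ i, x i ≠ 0) : 
    ∃ (g : A) (ha : (p : L) * g ∈ A) (ha' : (p : L) * g ∈ Rs), (p : L) * g ≠ 0 ∧ ¬ (p : A) ∣ g ∧ (∀ i, (x i : L)⁻¹ ∈ Loc A ((p : L) * g) ha) ∧ 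
      ∃ y, Stp (Loc A ((p : L) * g) ha) y ∧ Adj (Loc A ((p : L) * g) ha) y = Loc Rs ((p : L) * g) ha' := by
  let _ : Algebra A Rs := (Subring.inclusion hAR).toAlgebra
  have : Module.Finite A Rs := hfin
  have : IsScalarTower A Rs L := IsScalarTower.of_algebraMap_eq fun _ => rfl
  have : FaithfulSMul A Rs := (faithfulSMul_iff_algebraMap_injective A Rs).2 (Subring.inclusion_injective hAR)
  have : CharZero A := inferInstance
  obtain ⟨y, hy⟩ := prim (A := A) (R := Rs)
  have hyi : IsIntegral A (y : L) := (isIntegral_algebraMap_iff (R := A) (A := Rs) (B := L) Subtype.val_injective).2 (Algebra.IsIntegral.isIntegral y)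
  set f := minpoly A (y : L) with hf
  have hfm : f.Monic := minpoly.monic hyi
  have hpos : 0 < f.natDegree := minpoly.natDegree_pos hyi
  have hδ : aeval (y : L) f.derivative ≠ 0 := by
    intro h
    have hne : f.derivative ≠ 0 := by
      intro h
      have := natDegree_eq_zero_of_derivative_eq_zero h
      omega
    have h1 := minpoly.IsIntegrallyClosed.degree_le_of_ne_zero hne h
    exact absurd h1 (not_le.2 (degree_derivative_lt hfm.ne_zero))
  have hδi : IsIntegral A (aeval (y : L) f.derivative) := adj_integral (y : L) hyi _ (aeval_mem_adjoin_singleton _ _)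
  obtain ⟨w, hw, g0, hg0, hwg⟩ := hδi.isAlgebraic.exists_nonzero_eq_adjoin_mul (mem_nonZeroDivisors_of_ne_zero hδ)
  have hw' : w ∈ Algebra.adjoin A {(y : L)} := by
    refine (Algebra.adjoin_le ?_) hw
    rintro _ rfl
    exact aeval_mem_adjoin_singleton _ _
  obtain ⟨s, g, hsg, hpg⟩ := strip (p : A) hp (g0 * ∏ i, x i) (mul_ne_zero hg0 (Finset.prod_ne_zero_iff.2 fun i _ => hx i))
  have hgne : g ≠ 0 := fun h => hpg (h ▸ dvd_zero _)
  have ha : (p : L) * g ∈ A := A.mul_mem (natCast_mem A p) g.2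
  have ha0 : (p : L) * g ≠ 0 := mul_ne_zero (by exact_mod_cast (Fact.out : p.Prime).ne_zero) (fun h => hgne (Subtype.ext h))
  have hdvd : ∀ c : A, c ∣ g0 * ∏ i, x i → (c : L)⁻¹ ∈ Loc A ((p : L) * g) ha := by
    rintro c ⟨e, he⟩
    refine Loc.congr_inv _ ha ha0 (c : L) (e * (p * g ^ s)) (A.mul_mem e.2 (A.mul_mem (natCast_mem A p) (A.pow_mem g.2 s))) (s + 1) ?_
    have h2 : (c : L) * e = (p : L) ^ s * g := by
      have : c * e = (p : A) ^ s * g := by rw [← he, hsg]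
      have := congrArg (Subtype.val) this
      simpa using this
    rw [← mul_assoc, h2]; ring
  refine ⟨g, ha, hAR ha, ha0, hpg, fun i => hdvd _ (Dvd.dvd.mul_left (Finset.dvd_prod_of_mem x (Finset.mem_univ i)) _), y, ?_⟩
  have hg0L := hdvd g0 (Dvd.intro _ rfl)
  set E := Loc A ((p : L) * g) ha with hE
  have hAE : A ≤ E := Loc.le _ _ _
  have hadj : ∀ v ∈ Algebra.adjoin A {(y : L)}, v ∈ Adj E y := by
    intro v hv
    exact Adj.mono hAE _ hv
  have hst : Stp E (y : L) := by
    refine ⟨f.map (Subring.inclusion hAE), hfm.map _, ?_, w * (g0 : L)⁻¹, (Adj E y).mul_mem (hadj w hw') (Adj.le _ _ hg0L), ?_⟩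
    · rw [aeval_incl, hf, minpoly.aeval]
    · rw [derivative_map, aeval_incl, ← mul_assoc, hwg]
      exact mul_inv_cancel₀ (fun h => hg0 (Subtype.ext h))
  refine ⟨hst, ?_⟩
  have : IsIntegrallyClosed E := Loc.normal A _ ha ha0
  apply le_antisymm
  · refine Adj.le_of ?_ (Loc.le _ _ _ y.2)
    exact Loc.le_of A _ ha ha0 _ (hAR.trans (Loc.le _ _ _)) (Loc.inv _ _ _ ha0)
  · refine Loc.le_of Rs _ (hAR ha) ha0 _ ?_ (Adj.le _ _ (Loc.inv _ _ _ ha0))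
    intro r hr
    obtain ⟨c, hc, hcr⟩ := hy ⟨r, hr⟩
    have hri : IsIntegral A r := (isIntegral_algebraMap_iff (R := A) (A := Rs) (B := L) Subtype.val_injective).2 (Algebra.IsIntegral.isIntegral (⟨r, hr⟩ : Rs))
    refine hst.mem r (Adm.integral_of .base hAE hri) ⟨(c : L) * r, hadj _ ?_, c, Adj.le _ _ (hAE c.2), fun h => hc (Subtype.ext h), rfl⟩
    have h2 := AlgHom.map_adjoin_singleton (IsScalarTower.toAlgHom A Rs L) y
    have h3 : (c : L) * r ∈ (Algebra.adjoin A {y}).map (IsScalarTower.toAlgHom A Rs L) := ⟨_, hcr, rfl⟩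
    rw [h2] at h3
    exact h3

end G1
end Part_G1

section Part_F1
set_option maxHeartbeats 1000000
set_option synthInstance.maxHeartbeats 400000
set_option linter.unusedSectionVars false
universe u

open IsLocalRing

section F1

theorem RLS.prime {A : Type u} [CommRing A] {m : ℕ} {x : Fin (m+1) → A} (h : RLS x) (i : Fin (m+1)) : Prime (x i) := by
  have h' : RLS (fun k => x (Equiv.swap 0 i k)) := by
    refine ⟨h.noeth, h.loc, ?_, h.dim⟩
    have := h.loc
    rw [h.max]
    congr 1
    exact ((Equiv.swap 0 i).surjective.range_comp x).symm
  have := h'.main.2.2.2 _ _ (List.ofFn_succ)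
  simpa using this

variable (p : ℕ) [Fact p.Prime] {L : Type u} [Field L] [CharZero L] 

theorem exists_roots [IsAlgClosed L] (a : L) : ∃ z : ℕ → L, z 0 = a ∧ ∀ n, z (n+1) ^ p = z n := by
  have h : ∀ b : L, ∃ c : L, c ^ p = b := fun b => IsAlgClosed.exists_pow_nat_eq b (Fact.out : p.Prime).pos
  choose f hf using h
  exact ⟨fun n => Nat.rec a (fun _ b => f b) n, rfl, fun n => hf _⟩

theorem Adm.trans {E1 E0 E : Subring L} (h0 : Adm E1 E0) (h : Adm E0 E) : Adm E1 E := by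
  induction h with
  | base => exact h0
  | step E z _ hz ih => exact .step E z ih hz

theorem Adm.up {E1 E0 E : Subring L} (h0 : Adm E1 E0) (h : Adm E1 E) : Adm E0 (E ⊔ E0) := by
  induction h with
  | base => rw [sup_eq_right.2 h0.le]; exact .base
  | step E' z hE hz ih =>
    have : Adj E' z ⊔ E0 = Adj (E' ⊔ E0) z := by
      apply le_antisymm
      · exact sup_le (Adj.mono le_sup_left z) (le_sup_right.trans (Adj.le _ _))
      · exact Adj.le_of (sup_le_sup_right (Adj.le _ _) _) ((le_sup_left : Adj E' z ≤ Adj E' z ⊔ E0) (Adj.self _ _))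
    rw [this]
    exact Adm.step _ _ ih (hz.mono le_sup_left)

theorem Adm.int {E1 E : Subring L} (h : Adm E1 E) : ∀ w ∈ E, IsIntegral E1 w := by
  induction h with
  | base => exact fun w hw => isIntegral_algebraMap (R := E1) (x := ⟨w, hw⟩)
  | step E z hE hz ih =>
    intro w hw
    let _ : Algebra E1 E := (Subring.inclusion hE.le).toAlgebra
    have : IsScalarTower E1 E L := IsScalarTower.of_algebraMap_eq fun _ => rfl
    have : Algebra.IsIntegral E1 E := ⟨fun a => 
      (isIntegral_algebraMap_iff (B := L) (A := E) Subtype.val_injective).1 (ih a a.2)⟩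
    have hw' : IsIntegral E w := by
      have h1 : Algebra.adjoin E {z} ≤ integralClosure E L := Algebra.adjoin_le (by
        rintro _ rfl; exact hz.integral)
      exact h1 hw
    exact isIntegral_trans (R := E1) (A := E) w hw'

theorem core [IsAlgClosed L] {A Rs : Subring L} (hAR : A ≤ Rs) (hfin : (Subring.inclusion hAR).Finite) {m : ℕ}
    (x : Fin (m+1) → A) (hA : RLS x) (hp0 : x 0 = p)
    (hA2 : ∀ a : A, ∃ (b : (Fin (m+1) → Fin p) → A) (c : A),
      a = ∑ k, (∏ i, x i ^ (k i : ℕ)) * (b k) ^ p + p * c) :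
    ∃ (g : A) (ha' : (p : L) * g ∈ Rs) (T : Subring L) (pr gr : ℕ → T), (p : L) * g ≠ 0 ∧ Rs ≤ T ∧ 
      (∀ w ∈ T, IsIntegral Rs w) ∧ (pr 0 = p ∧ ∀ n, pr (n+1) ^ p = pr n) ∧ ((gr 0 : L) = g ∧ ∀ n, gr (n+1) ^ p = gr n) ∧
      (∀ a : T, ∃ b c : T, a - b ^ p = p * c) ∧ IsIntegrallyClosed T ∧
      (∀ n, ∀ xT : Fin (m+1) → T, (∀ i, (xT i : L) = x i) → ∀ (i : Fin (m+1)) (t : T), xT i * t ∈ Ideal.span (xT '' {k : Fin (m+1) | (k : ℕ) < (i : ℕ)}) →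
        pr n * gr n * t ∈ Ideal.span (xT '' {k : Fin (m+1) | (k : ℕ) < (i : ℕ)})) ∧
      IsIntegrallyClosed (Loc Rs ((p : L) * g) ha') ∧
      (∀ w ∈ T, ∃ E, Adm (Loc Rs ((p : L) * g) ha') E ∧ w ∈ E) ∧ 
      (∀ E, Adm (Loc Rs ((p : L) * g) ha') E → ∀ w ∈ E, ∃ n : ℕ, ((p : L) * g) ^ n * w ∈ T) := by
  have := hA.noeth
  have := hA.loc
  have hAn : IsIntegrallyClosed A := hA.main.2.2.1.isIntegrallyClosed
  have hpP : Prime (p : A) := by rw [← hp0]; exact hA.prime 0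
  obtain ⟨g, ha, ha', hne, hpg, hxi, y, hy, hyE⟩ := exists_g p hAR hfin hpP x (fun i => (hA.prime i).ne_zero)
  obtain ⟨E1, hE1⟩ : ∃ E1, E1 = Loc A ((p : L) * g) ha := ⟨_, rfl⟩
  obtain ⟨E0, hE0⟩ : ∃ E0, E0 = Loc Rs ((p : L) * g) ha' := ⟨_, rfl⟩
  have hAE : A ≤ E1 := by rw [hE1]; exact Loc.le _ _ _
  have hn1 : IsIntegrallyClosed E1 := by rw [hE1]; exact Loc.normal _ _ _ hne
  have h01 : Adm E1 E0 := by
    rw [hE0, ← hyE, ← hE1]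
    exact .step _ _ .base (by rw [hE1]; exact hy)
  have hn0 : IsIntegrallyClosed E0 := h01.normal
  have hpE : (p : L)⁻¹ ∈ E1 := by
    have := hxi 0
    rw [hp0] at this
    rw [hE1]; simpa using this
  have hg0 : (g : L) ≠ 0 := right_ne_zero_of_mul hne
  have hgE : (g : L)⁻¹ ∈ E1 := by
    rw [hE1]
    exact Loc.congr_inv _ _ hne _ (p : L) (natCast_mem A p) 1 (by ring)
  have hpA : ¬ IsUnit (p : A) := hpP.not_isUnit
  have : ∀ i, ∃ z : ℕ → L, z 0 = x i ∧ ∀ n, z (n+1) ^ p = z n := fun i => exists_roots p _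
  choose xr hxr0 hxr using this
  obtain ⟨gr', hgr0', hgr'⟩ := exists_roots p (g : L)
  have hxT : ∀ i n, xr i n ∈ TT A E1 := fun i n => by
    refine TT.root p hAE hpE (xr i) (hxr i) (by rw [hxr0]; exact (x i).2) ?_ ?_ n
    · rw [hxr0]; exact fun h => (hA.prime i).ne_zero (Subtype.ext h)
    · rw [hxr0, hE1]; exact hxi i
  have hgT : ∀ n, gr' n ∈ TT A E1 := fun n => by
    refine TT.root p hAE hpE gr' hgr' (by rw [hgr0']; exact g.2) ?_ ?_ n
    · rw [hgr0']; exact hg0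
    · rw [hgr0']; exact hgE
  obtain ⟨pr, hpr⟩ : ∃ pr : ℕ → TT A E1, ∀ n, (pr n : L) = xr 0 n := ⟨fun n => ⟨_, hxT 0 n⟩, fun _ => rfl⟩
  obtain ⟨gr, hgr⟩ : ∃ gr : ℕ → TT A E1, ∀ n, (gr n : L) = gr' n := ⟨fun n => ⟨_, hgT n⟩, fun _ => rfl⟩
  have hpr0 : pr 0 = p := Subtype.ext (by rw [hpr, hxr0, hp0]; simp)
  have hprs : ∀ n, pr (n+1) ^ p = pr n := fun n => Subtype.ext (by push_cast; rw [hpr, hpr, hxr])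
  have hgr0 : (gr 0 : L) = g := by rw [hgr, hgr0']
  have hgrs : ∀ n, gr (n+1) ^ p = gr n := fun n => Subtype.ext (by push_cast; rw [hgr, hgr, hgr'])
  have htl : Tiltable p (TT A E1) pr := TT.tiltable p hAE hpA hpE pr hpr0 hprs
  have hfact : Fact (¬ IsUnit (p : TT A E1)) := ⟨htl.nu⟩
  have hAT : A ≤ TT A E1 := fun a ha => ⟨isIntegral_algebraMap (R := A) (x := ⟨a, ha⟩), E1, .base, hAE ha⟩
  have htow := Tow.base p (TT A E1) pr gr htl hgrs g x xr hxr hxr0 hp0 hA hA2 hpg hAT hxT hpr hgr0 ha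
  rw [← hE1] at htow
  have hintR : ∀ w : L, IsIntegral A w → IsIntegral Rs w := by
    rintro w ⟨f, hf, h⟩
    exact ⟨f.map (Subring.inclusion hAR), hf.map _, by rw [Polynomial.eval₂_map]; exact h⟩
  refine ⟨g, ha', TT A E1, pr, gr, hne, ?_, fun w hw => hintR w hw.1, ⟨hpr0, hprs⟩, ⟨hgr0, hgrs⟩, TT.frob p hAE hpA hpE,
    TT.normal hAE, ?_, ?_, ?_, ?_⟩
  · intro r hr
    refine ⟨?_, E0, h01, ?_⟩
    · let _ : Algebra A Rs := (Subring.inclusion hAR).toAlgebra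
      have : Module.Finite A Rs := hfin
      have : IsScalarTower A Rs L := IsScalarTower.of_algebraMap_eq fun _ => rfl
      exact (isIntegral_algebraMap_iff (R := A) (A := Rs) (B := L) Subtype.val_injective).2 (Algebra.IsIntegral.isIntegral (⟨r, hr⟩ : Rs))
    · rw [hE0]; exact Loc.le _ _ _ hr
  · intro n xT hxTv i t ht
    have hx0 : xT 0 = p := Subtype.ext (by rw [hxTv, hp0]; simp)
    induction i using Fin.cases with
    | zero =>
      have he : {k : Fin (m+1) | (k : ℕ) < ((0 : Fin (m+1)) : ℕ)} = ∅ := by ext k; simp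
      rw [he, Set.image_empty, Ideal.span_empty] at ht ⊢
      have h1 : xT 0 * t = 0 := ht
      rw [hx0] at h1
      rw [(mul_eq_zero.1 h1).resolve_left htl.ne, mul_zero]
      exact Ideal.zero_mem _
    | succ l =>
      have he : Ideal.span (xT '' {k : Fin (m+1) | (k : ℕ) < (l.succ : ℕ)}) = 
          Ideal.span {(p : TT A E1)} ⊔ Ideal.span ((fun k : Fin m => xT k.succ) '' Set.Iio l) := by
        rw [← Ideal.span_union]
        congr 1
        ext w
        constructor
        · rintro ⟨k, hk, rfl⟩
          induction k using Fin.cases with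
          | zero => left; rw [hx0]; exact Set.mem_singleton _
          | succ k => right; exact ⟨k, Fin.succ_lt_succ_iff.1 hk, rfl⟩
        · rintro (h | ⟨k, hk, rfl⟩)
          · refine ⟨0, by simp, ?_⟩
            rw [hx0]; exact (Set.mem_singleton_iff.1 h).symm
          · exact ⟨k.succ, Fin.succ_lt_succ_iff.2 hk, rfl⟩
      rw [he] at ht ⊢
      exact TT.colon p hAE pr gr htl hgrs g hne (fun k : Fin m => x k.succ) htow hgr0 
        (fun y hy => TT.reg p hpE g hpP hpg (gr 0) hgr0 y hy) (fun k : Fin m => xT k.succ) (fun k => hxTv _) l t ht n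
  · rw [← hE0]; exact hn0
  · rw [← hE0]
    rintro w ⟨-, E, hE, hw⟩
    exact ⟨_, h01.up hE, le_sup_left (b := E0) hw⟩
  · rw [← hE0]
    intro E hE w hw
    have hE' := h01.trans hE
    have h1 : IsIntegral E1 w := hE'.int w hw
    rw [hE1] at h1
    obtain ⟨n, hn⟩ := Loc.integral A _ ha w h1
    refine ⟨n, hn, E, hE', E.mul_mem (E.pow_mem (hE'.le (hAE ha)) _) hw⟩

end F1
end Part_F1

section Part_F2
set_option maxHeartbeats 1000000
set_option synthInstance.maxHeartbeats 400000
set_option linter.unusedSectionVars false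
universe u v

section F2

theorem etale_comp {A B C : Type*} [CommRing A] [CommRing B] [CommRing C] (f : A →+* B) (g : B →+* C) (hf : f.Etale) (hg : g.Etale) :
    (g.comp f).Etale := by
  let _ : Algebra A B := f.toAlgebra
  let _ : Algebra B C := g.toAlgebra
  let _ : Algebra A C := (g.comp f).toAlgebra
  have : IsScalarTower A B C := IsScalarTower.of_algebraMap_eq fun _ => rfl
  have : Algebra.Etale A B := hf
  have : Algebra.Etale B C := hg
  exact Algebra.Etale.comp A B C

variable {L : Type u} [Field L] [CharZero L] 

theorem etale_clause {R : Type u} [CommRing R] [Algebra R L] (hinj : Function.Injective (algebraMap R L)) 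
    (T : Subalgebra R L) (a : R) (aL : L) (haL : algebraMap R L a = aL) (haL0 : aL ≠ 0) (aT : T) (haT : (aT : L) = aL) 
    (ha' : aL ∈ (algebraMap R L).range)
    [IsIntegrallyClosed (Loc (algebraMap R L).range aL ha')]
    (h1 : ∀ w ∈ T, ∃ E, Adm (Loc (algebraMap R L).range aL ha') E ∧ w ∈ E)
    (h2 : ∀ E, Adm (Loc (algebraMap R L).range aL ha') E → ∀ w ∈ E, ∃ n : ℕ, aL ^ n * w ∈ T)
    (Rpg : Type v) (Tpg : Type v) [CommRing Rpg] [CommRing Tpg]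
    [Algebra R Rpg] [IsLocalization.Away a Rpg]
    [Algebra ↥T Tpg]
    [IsLocalization.Away aT Tpg]
    [Algebra Rpg Tpg] [Algebra R Tpg]
    [IsScalarTower R Rpg Tpg] [IsScalarTower R ↥T Tpg] :
      ∃ (ι : Type v) (F : ι → Subalgebra Rpg Tpg),
            Nonempty ι ∧
            (∀ i j : ι, ∃ k : ι, F i ≤ F k ∧ F j ≤ F k) ∧
            (∀ i : ι, Module.Finite Rpg ↥(F i) ∧ Algebra.Etale Rpg ↥(F i)) ∧
            (∀ y : Tpg, ∃ i : ι, y ∈ F i) := by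
  obtain ⟨E0, hE0⟩ : ∃ E0, E0 = Loc (algebraMap R L).range aL ha' := ⟨_, rfl⟩
  have hn0 : IsIntegrallyClosed E0 := by rw [hE0]; infer_instance
  rw [← hE0] at h1 h2
  have hinv : aL⁻¹ ∈ E0 := by rw [hE0]; exact Loc.inv _ _ _ haL0
  have hRE : ∀ r : R, algebraMap R L r ∈ E0 := fun r => by rw [hE0]; exact Loc.le _ _ _ ⟨r, rfl⟩
  have hu : IsUnit (T.val.toRingHom aT) := by
    change IsUnit (aT : L)
    rw [haT]; exact haL0.isUnit
  obtain ⟨ψ, hψ⟩ : ∃ ψ : Tpg →+* L, ∀ t : T, ψ (algebraMap T Tpg t) = t :=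
    ⟨IsLocalization.Away.lift aT hu, fun t => IsLocalization.Away.lift_eq aT hu t⟩
  have hsurjT : ∀ y : Tpg, ∃ (n : ℕ) (t : T), y * algebraMap T Tpg aT ^ n = algebraMap T Tpg t := fun y => by
    obtain ⟨n, t, h⟩ := IsLocalization.Away.surj aT y
    exact ⟨n, t, h⟩
  have hsurjR : ∀ y : Rpg, ∃ (n : ℕ) (t : R), y * algebraMap R Rpg a ^ n = algebraMap R Rpg t := fun y => by
    obtain ⟨n, t, h⟩ := IsLocalization.Away.surj a y
    exact ⟨n, t, h⟩
  have huT : IsUnit (algebraMap T Tpg aT) := IsLocalization.Away.algebraMap_isUnit aT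
  have huR : IsUnit (algebraMap R Rpg a) := IsLocalization.Away.algebraMap_isUnit a
  have hψi : Function.Injective ψ := by
    rw [injective_iff_map_eq_zero]
    intro y hy
    obtain ⟨n, t, h⟩ := hsurjT y
    have h3 : (t : L) = 0 := by rw [← hψ, ← h, map_mul, hy, zero_mul]
    have h4 : t = 0 := Subtype.ext h3
    rw [h4, map_zero] at h
    exact (huT.pow n).mul_left_eq_zero.1 h
  obtain ⟨φ, hφd⟩ : ∃ φ : Rpg →+* L, φ = ψ.comp (algebraMap Rpg Tpg) := ⟨_, rfl⟩
  have hφψ : ∀ r, φ r = ψ (algebraMap Rpg Tpg r) := fun r => by rw [hφd]; rfl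
  have hφ : ∀ r, φ (algebraMap R Rpg r) = algebraMap R L r := fun r => by
    rw [hφψ, ← IsScalarTower.algebraMap_apply R Rpg Tpg, IsScalarTower.algebraMap_apply R T Tpg, hψ]; rfl
  have hφi : Function.Injective φ := by
    rw [injective_iff_map_eq_zero]
    intro y hy
    obtain ⟨n, t, h⟩ := hsurjR y
    have h3 : algebraMap R L t = 0 := by rw [← hφ, ← h, map_mul, hy, zero_mul]
    have h4 : t = 0 := hinj (by rw [h3, map_zero])
    rw [h4, map_zero] at h
    exact (huR.pow n).mul_left_eq_zero.1 h
  have hφE : ∀ r, φ r ∈ E0 := fun r => by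
    obtain ⟨n, t, h⟩ := hsurjR r
    have h3 : φ r * aL ^ n = algebraMap R L t := by
      rw [← hφ, ← h, map_mul, map_pow, hφ, haL]
    rw [← mul_inv_cancel_right₀ (pow_ne_zero n haL0) (φ r), h3, ← inv_pow]
    exact E0.mul_mem (hRE _) (E0.pow_mem hinv _)
  have hφs : ∀ w ∈ E0, ∃ r, φ r = w := by
    intro w hw
    rw [hE0] at hw
    obtain ⟨n, r, hr⟩ := hw
    obtain ⟨u, hu⟩ := (huR.pow n).exists_right_inv
    refine ⟨algebraMap R Rpg r * u, ?_⟩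
    have h3 : aL ^ n * φ u = 1 := by
      rw [← haL, ← hφ, ← map_pow, ← map_mul, hu, map_one]
    rw [map_mul, hφ, hr, mul_right_comm, h3, one_mul]
  have hψs : ∀ E, Adm E0 E → ∀ w ∈ E, ∃ y, ψ y = w := by
    intro E hE w hw
    obtain ⟨n, hn⟩ := h2 E hE w hw
    obtain ⟨u, hu⟩ := (huT.pow n).exists_right_inv
    refine ⟨algebraMap T Tpg ⟨_, hn⟩ * u, ?_⟩
    have h3 : aL ^ n * ψ u = 1 := by
      rw [← haT, ← hψ, ← map_pow, ← map_mul, hu, map_one]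
    rw [map_mul, hψ, mul_right_comm]
    change aL ^ n * ψ u * w = w
    rw [h3, one_mul]
  have hmem : ∀ E : Subring L, Adm E0 E → ∀ r : Rpg, algebraMap Rpg Tpg r ∈ E.comap ψ := fun E hE r => by
    rw [Subring.mem_comap, ← hφψ]; exact hE.le (hφE r)
  have hex : ∀ E : Subring L, Adm E0 E → ∃ S : Subalgebra Rpg Tpg, ∀ y, y ∈ S ↔ ψ y ∈ E := fun E hE =>
    ⟨{ toSubsemiring := (E.comap ψ).toSubsemiring
       algebraMap_mem' := hmem E hE }, fun y => Iff.rfl⟩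
  choose mk hmk using hex
  refine ⟨{S : Subalgebra Rpg Tpg // ∃ E, Adm E0 E ∧ ∀ y, y ∈ S ↔ ψ y ∈ E}, fun S => S.1, 
    ⟨⟨mk E0 .base, E0, .base, hmk E0 .base⟩⟩, ?_, ?_, ?_⟩
  · rintro ⟨S, E, hE, hS⟩ ⟨S', E', hE', hS'⟩
    refine ⟨⟨mk _ (hE.sup hE'), _, hE.sup hE', hmk _ (hE.sup hE')⟩, ?_, ?_⟩
    · intro y hy
      exact (hmk _ _ _).2 (le_sup_left (b := E') ((hS y).1 hy))
    · intro y hy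
      exact (hmk _ _ _).2 (le_sup_right (a := E) ((hS' y).1 hy))
  · rintro ⟨S, E, hE, hS⟩
    change Module.Finite Rpg S ∧ Algebra.Etale Rpg S
    obtain ⟨h0, het, hfin⟩ := hE.etale
    have e1 : Function.Bijective (φ.codRestrict E0 hφE) := by
      constructor
      · intro r s h
        exact hφi (congrArg Subtype.val h)
      · rintro ⟨w, hw⟩
        obtain ⟨r, hr⟩ := hφs w hw
        exact ⟨r, Subtype.ext hr⟩
    have e2 : Function.Bijective ((ψ.comp S.val.toRingHom).codRestrict E (fun y => (hS y).1 y.2)) := by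
      constructor
      · intro r s h
        exact Subtype.ext (hψi (congrArg Subtype.val h))
      · rintro ⟨w, hw⟩
        obtain ⟨r, hr⟩ := hψs E hE w hw
        exact ⟨⟨r, (hS r).2 (by rw [hr]; exact hw)⟩, Subtype.ext hr⟩
    obtain ⟨f2, hf2⟩ : ∃ f2 : S ≃+* E, ∀ y, (f2 y : L) = ψ y := ⟨RingEquiv.ofBijective _ e2, fun _ => rfl⟩
    have heq : algebraMap Rpg S = (f2.symm.toRingHom.comp (Subring.inclusion h0)).comp (φ.codRestrict E0 hφE) := by
      ext1 r
      apply f2.injective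
      change _ = f2 (f2.symm _)
      rw [RingEquiv.apply_symm_apply]
      apply Subtype.ext
      rw [hf2]
      exact (hφψ r).symm
    constructor
    · rw [← RingHom.finite_algebraMap, heq]
      exact ((RingHom.Finite.of_surjective _ f2.symm.surjective).comp hfin).comp (RingHom.Finite.of_surjective _ e1.2)
    · rw [← RingHom.etale_algebraMap, heq]
      exact etale_comp _ _ (.of_bijective e1) (etale_comp _ _ het (.of_bijective f2.symm.bijective))
  · intro y
    obtain ⟨n, t, h⟩ := hsurjT y
    obtain ⟨E, hE, ht⟩ := h1 t t.2
    refine ⟨⟨mk E hE, E, hE, hmk E hE⟩, (hmk _ _ _).2 ?_⟩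
    have h3 : ψ y * aL ^ n = t := by
      rw [← hψ, ← h, map_mul, map_pow, hψ, haT]
    rw [← mul_inv_cancel_right₀ (pow_ne_zero n haL0) (ψ y), h3, ← inv_pow]
    exact E.mul_mem ht (E.pow_mem (hE.le hinv) _)

end F2
end Part_F2

theorem exists_almost_CohenMacaulay_algebra_with_almost_zero_local_cohomology.{u, v}
    (p : ℕ) (hp : p.Prime)
    (R : Type u) [CommRing R] [IsDomain R] [IsNoetherianRing R] [IsLocalRing R]
    [IsAdicComplete (IsLocalRing.maximalIdeal R) R]
    [CharZero R]
    (hres : CharP (IsLocalRing.ResidueField R) p)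
    [ExpChar (IsLocalRing.ResidueField R) p]
    [PerfectRing (IsLocalRing.ResidueField R) p]
    (d : ℕ) (hd0 : 0 < d) (hdim : ringKrullDim R = d)
    (x : Fin d → R) (hx0 : x ⟨0, hd0⟩ = (p : R))
    (hsop₁ : Ideal.span (Set.range x) ≤ IsLocalRing.maximalIdeal R)
    (hsop₂ : IsLocalRing.maximalIdeal R ≤ (Ideal.span (Set.range x)).radical) :
    ∃ g : R, g ≠ 0 ∧
    ∃ T : Subalgebra R (AlgebraicClosure (FractionRing R)),
      -- R ⊆ T ⊆ R⁺
      T ≤ integralClosure R (AlgebraicClosure (FractionRing R)) ∧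
      ∃ pr gr : ℕ → ↥T,
        -- compatible systems of p-power roots of p and of g in T
        (pr 0 = (p : ↥T) ∧ ∀ n, pr (n + 1) ^ p = pr n) ∧
        (gr 0 = algebraMap R ↥T g ∧ ∀ n, gr (n + 1) ^ p = gr n) ∧
        -- Frobenius is surjective on T/pT
        (∀ a : ↥T, ∃ b c : ↥T, a - b ^ p = p * c) ∧
        -- T is a normal domain ...
        IsIntegrallyClosed ↥T ∧
        -- ... which is (pg)^{1/p^∞}-almost Cohen–Macaulay with respect to p, x₂, …, x_d
        (∃ n : ℕ, pr n * gr n ∉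
            Ideal.map (algebraMap R ↥T) (IsLocalRing.maximalIdeal R)) ∧
        (∀ n : ℕ, 0 < n → ∀ i : Fin d, ∀ t : ↥T,
            algebraMap R ↥T (x i) * t ∈
                Ideal.span ((fun k : Fin d => algebraMap R ↥T (x k)) ''
                  {k : Fin d | (k : ℕ) < (i : ℕ)}) →
            pr n * gr n * t ∈
                Ideal.span ((fun k : Fin d => algebraMap R ↥T (x k)) ''
                  {k : Fin d | (k : ℕ) < (i : ℕ)})) ∧
        -- T[1/(pg)] is an increasing union of finite étale R[1/(pg)]-subalgebras
        (∀ (Rpg : Type v) (Tpg : Type v) [CommRing Rpg] [CommRing Tpg]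
            [Algebra R Rpg] [IsLocalization.Away ((p : R) * g) Rpg]
            [Algebra ↥T Tpg]
            [IsLocalization.Away ((p : ↥T) * algebraMap R ↥T g) Tpg]
            [Algebra Rpg Tpg] [Algebra R Tpg]
            [IsScalarTower R Rpg Tpg] [IsScalarTower R ↥T Tpg],
          ∃ (ι : Type v) (F : ι → Subalgebra Rpg Tpg),
            Nonempty ι ∧
            (∀ i j : ι, ∃ k : ι, F i ≤ F k ∧ F j ≤ F k) ∧
            (∀ i : ι, Module.Finite Rpg ↥(F i) ∧ Algebra.Etale Rpg ↥(F i)) ∧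
            (∀ y : Tpg, ∃ i : ι, y ∈ F i)) ∧
        -- in addition: H^i_𝔪(T) is (pg)^{1/p^∞}-almost zero for 0 ≤ i ≤ d-1,
        -- i.e. multiplication by (pg)^{1/p^n} is zero on H^i_𝔪(T) for all n > 0
        (∀ i : ℕ, i < d → ∀ n : ℕ, 0 < n →
          (localCohomology (IsLocalRing.maximalIdeal R) i).map
              (ModuleCat.ofHom
                (Algebra.lmul R ↥T (pr n * gr n) : ↥T →ₗ[R] ↥T)) = 0) := by
  have hpF : Fact p.Prime := ⟨hp⟩
  obtain ⟨m, rfl⟩ : ∃ m, d = m + 1 := ⟨d - 1, by omega⟩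
  have hx0' : x 0 = (p : R) := hx0
  have hinj : Function.Injective (algebraMap R (AlgebraicClosure (FractionRing R))) := by
    rw [IsScalarTower.algebraMap_eq R (FractionRing R) (AlgebraicClosure (FractionRing R))]
    exact (algebraMap (FractionRing R) (AlgebraicClosure (FractionRing R))).injective.comp (IsFractionRing.injective R (FractionRing R))
  have hch : CharZero (AlgebraicClosure (FractionRing R)) := charZero_of_injective_algebraMap hinj
  obtain ⟨φ, hφ⟩ : ∃ φ, φ = algebraMap R (AlgebraicClosure (FractionRing R)) := ⟨_, rfl⟩
  have hφi : Function.Injective φ := by rw [hφ]; exact hinj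
  obtain ⟨A0, xA, hxA, hN, hfin, hloc, hmax, hA2⟩ := cohen p R (m+1) x 0 hx0' hsop₁ hsop₂
  obtain ⟨A, hAd⟩ : ∃ A, A = A0.map φ := ⟨_, rfl⟩
  obtain ⟨e, he⟩ : ∃ e : A0 ≃+* A, ∀ a, (e a : AlgebraicClosure (FractionRing R)) = φ a := by
    subst hAd
    exact ⟨A0.equivMapOfInjective φ hφi, fun _ => rfl⟩
  have hAR : A ≤ φ.range := by
    rw [hAd]; rintro _ ⟨a, -, rfl⟩; exact ⟨a, rfl⟩
  have hfinA : (Subring.inclusion hAR).Finite := by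
    have h1 : Subring.inclusion hAR = (φ.rangeRestrict.comp A0.subtype).comp e.symm.toRingHom := by
      ext1 a
      apply Subtype.ext
      change (a : AlgebraicClosure (FractionRing R)) = φ (e.symm a)
      rw [← he, RingEquiv.apply_symm_apply]
    rw [h1]
    exact ((RingHom.Finite.of_surjective _ φ.rangeRestrict_surjective).comp hfin).comp (RingHom.Finite.of_surjective _ e.symm.surjective)
  have hRLS : RLS (fun i => e (xA i)) := by
    have hl : IsLocalRing A := e.isLocalRing
    refine ⟨isNoetherianRing_of_ringEquiv A0 e, hl, ?_, ?_⟩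
    · have h1 : Ideal.map e (IsLocalRing.maximalIdeal A0) = Ideal.span (Set.range fun i => e (xA i)) := by
        rw [hmax, Ideal.map_span, ← Set.range_comp]; rfl
      rw [← h1]
      have := Ideal.map_isMaximal_of_equiv e (p := IsLocalRing.maximalIdeal A0)
      exact (IsLocalRing.eq_maximalIdeal this).symm
    · rw [← ringKrullDim_eq_of_ringEquiv e]
      have : Module.Finite A0 R := hfin
      rw [← dim_integral (A := A0) (B := R) Subtype.val_injective, hdim]
  have hA2' : ∀ a : A, ∃ (b : (Fin (m+1) → Fin p) → A) (c : A),
      a = ∑ k, (∏ i, e (xA i) ^ (k i : ℕ)) * (b k) ^ p + p * c := by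
    intro a
    obtain ⟨b, c, h⟩ := hA2 (e.symm a)
    refine ⟨fun k => e (b k), e c, ?_⟩
    have := congrArg e h
    simpa using this
  have hp0 : e (xA 0) = p := by
    have : xA 0 = p := Subtype.ext (by rw [hxA, hx0']; simp)
    rw [this, map_natCast]
  obtain ⟨gA, ha', T', pr, gr, hne, hRT, hIntg, hpr, hgr, hfrob, hnorm, hcol, hn0, hE1, hE2⟩ := 
    core p hAR hfinA (fun i => e (xA i)) hRLS hp0 hA2'
  have hgv : (gA : AlgebraicClosure (FractionRing R)) = φ (e.symm gA) := by
    rw [← he, RingEquiv.apply_symm_apply]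
  obtain ⟨g, hg⟩ : ∃ g : R, g = e.symm gA := ⟨_, rfl⟩
  rw [← hg] at hgv
  rw [hφ] at hgv hRT
  obtain ⟨T, rfl⟩ : ∃ T : Subalgebra R (AlgebraicClosure (FractionRing R)), T.toSubring = T' := 
    ⟨{ toSubsemiring := T'.toSubsemiring, algebraMap_mem' := fun r => hRT ⟨r, rfl⟩ }, rfl⟩
  have hcolT : ∀ n : ℕ, 0 < n → ∀ i : Fin (m+1), ∀ t : ↥T,
            algebraMap R ↥T (x i) * t ∈
                Ideal.span ((fun k : Fin (m+1) => algebraMap R ↥T (x k)) ''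
                  {k : Fin (m+1) | (k : ℕ) < (i : ℕ)}) →
            pr n * gr n * t ∈
                Ideal.span ((fun k : Fin (m+1) => algebraMap R ↥T (x k)) ''
                  {k : Fin (m+1) | (k : ℕ) < (i : ℕ)}) := by
    intro n _ i t ht
    refine hcol n (fun k => algebraMap R ↥T (x k)) ?_ i t ht
    intro k
    rw [he, hxA, hφ]; rfl
  have hpg : algebraMap R (AlgebraicClosure (FractionRing R)) ((p : R) * g) = (p : AlgebraicClosure (FractionRing R)) * gA := by
    rw [map_mul, map_natCast, hgv]
  have hg0 : g ≠ 0 := by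
    rintro rfl
    rw [mul_zero, map_zero] at hpg
    exact hne hpg.symm
  have hp0R : (p : R) ≠ 0 := by exact_mod_cast hp.ne_zero
  have hintT : ∀ w ∈ T, IsIntegral R w := by
    intro w hw
    obtain ⟨f, hf, h⟩ := hIntg w hw
    have hs : Function.Surjective φ.rangeRestrict := φ.rangeRestrict_surjective
    have hst : ∃ q : Polynomial R, q.map φ.rangeRestrict = f ∧ q.degree = f.degree ∧ q.Monic := 
      Polynomial.lifts_and_degree_eq_and_monic ((Polynomial.mem_lifts f).2 (Polynomial.map_surjective _ hs f)) hf
    obtain ⟨q, rfl, -, hq⟩ := hst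
    refine ⟨q, hq, ?_⟩
    rw [Polynomial.eval₂_map] at h
    have h5 : ((algebraMap φ.range (AlgebraicClosure (FractionRing R))).comp φ.rangeRestrict) = φ := by ext1; rfl
    rw [h5, hφ] at h
    exact h
  have hTi : Algebra.IsIntegral R T := ⟨fun t => 
    (isIntegral_algebraMap_iff (A := T) (B := AlgebraicClosure (FractionRing R)) Subtype.val_injective).1 (hintT t t.2)⟩
  have hgrT : gr 0 = algebraMap R ↥T g := Subtype.ext (by rw [hgr.1, hgv]; rfl)
  have hprT : (pr 0 : ↥T) = (p : ↥T) := hpr.1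
  have hprs : ∀ n, (pr (n + 1) : ↥T) ^ p = pr n := hpr.2
  have hgrs : ∀ n, (gr (n + 1) : ↥T) ^ p = gr n := hgr.2
  have hcs : ∀ n, ((pr (n + 1) : ↥T) * gr (n + 1)) ^ p = (pr n : ↥T) * gr n := fun n => by
    rw [mul_pow, hprs, hgrs]
  refine ⟨g, hg0, T, fun w hw => hintT w hw, pr, gr, ⟨hprT, hprs⟩, ⟨hgrT, hgrs⟩, hfrob, hnorm, ?_, hcolT, ?_, ?_⟩
  · refine noncont (R := R) (T := T) ?_ p hp.two_le ((p : R) * g) (mul_ne_zero hp0R hg0) (fun n => (pr n : ↥T) * gr n) ?_ hcs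
    · intro a b h
      exact hinj (congrArg Subtype.val h)
    · rw [map_mul, map_natCast, ← hgrT, ← hprT]
  · intro Rpg Tpg _ _ _ _ _ _ _ _ _ _
    subst hφ
    exact etale_clause hinj T ((p : R) * g) ((p : AlgebraicClosure (FractionRing R)) * gA) hpg hne
      ((p : ↥T) * algebraMap R ↥T g) (by rw [← hpg, map_mul, map_natCast]; rfl) ha' hE1 hE2 Rpg Tpg
  · intro i hi n hn
    refine acm_localCohomology (R := R) (T := T) (IsLocalRing.maximalIdeal R) p hp.two_le (fun n => (pr n : ↥T) * gr n) hcs (m+1)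
      (fun j => Ideal.span ((fun k : Fin (m+1) => algebraMap R ↥T (x k)) '' {k : Fin (m+1) | (k : ℕ) < j}))
      (fun j => if h : j < m + 1 then x ⟨j, h⟩ else 0) ?_ ?_ ?_ ?_ i hi n hn
    · intro j hj
      rw [dif_pos hj]
      exact hsop₁ (Ideal.subset_span ⟨_, rfl⟩)
    · simp
    · intro j hj
      rw [dif_pos hj, ← Ideal.span_union]
      congr 1
      ext w
      constructor
      · rintro ⟨k, hk, rfl⟩
        rcases Nat.lt_succ_iff_lt_or_eq.1 hk with h | h
        · exact Or.inl ⟨k, h, rfl⟩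
        · right
          have : k = ⟨j, hj⟩ := Fin.ext h
          rw [this]; exact Set.mem_singleton _
      · rintro (⟨k, hk, rfl⟩ | h)
        · exact ⟨k, Nat.lt_succ_of_lt hk, rfl⟩
        · exact ⟨⟨j, hj⟩, Nat.lt_succ_self j, (Set.mem_singleton_iff.1 h).symm⟩
    · intro j hj n hn t ht
      rw [dif_pos hj] at ht
      exact hcolT n hn ⟨j, hj⟩ t ht
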